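/- For each n, assume the martingale differences (X_i)_{1≤i≤n} satisfy conditions (A1) and (A4), and let (x_n) be a sequence with x_n ≥ 0 and x_n γ_n → 0 (i.e. x_n = o(γ_n^{-1})). Write γ̂_n(x, ρ) = γ_n^{ρ(2−ρ)/4} / (1 + x^{ρ(2+ρ)/4}). Then: [i] if ρ ∈ (0, 1), there is a constant c_ρ > 0 depending only on ρ such that for all sufficiently large n there exists θ_n with |θ_n| ≤ 1 with P(W_n ≥ x_n)/(1 − Φ(x_n)) = exp{ θ_n c_ρ ( x_n^{2+ρ} γ_n^ρ + x_n² δ_n² + (1 + x_n)( δ_n + γ̂_n(x_n, ρ) ) ) }; [ii] if ρ = 1, there is an absolute constant c > 0 such that for all sufficiently large n there exists θ_n with |θ_n| ≤ 1 with P(W_n ≥ x_n)/(1 − Φ(x_n)) = exp{ θ_n c ( x_n³ γ_n + x_n² δ_n² + (1 + x_n)( δ_n + γ_n |ln γ_n| + γ̂_n(x_n, 1) ) ) }. Both equalities remain valid with P(W_n ≥ x_n)/(1 − Φ(x_n)) replaced by P(W_n ≤ −x_n)/Φ(−x_n). -/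

import Mathlib

open MeasureTheory Filter
open scoped Topology ENNReal

noncomputable def stdNormalCDF (x : ℝ) : ℝ :=
  (Real.sqrt (2 * Real.pi))⁻¹ * ∫ t in Set.Iic x, Real.exp (-(t ^ 2) / 2)

/-- A finite sequence of square-integrable martingale differences
`X 1, ..., X n` adapted to a filtration `F 0 ⊆ F 1 ⊆ ... ⊆ F n`, with
`F 0` trivial, `E[X i | F (i-1)] = 0` and `0 < E[(X i)^2] < ∞`. -/
structure MDS (Ω : Type) [mΩ : MeasurableSpace Ω] (P : Measure Ω) where
  n : ℕ
  npos : 0 < n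
  F : ℕ → MeasurableSpace Ω
  F_mono : Monotone F
  F_le : ∀ i, F i ≤ mΩ
  F_zero : F 0 = ⊥
  X : ℕ → Ω → ℝ
  meas : ∀ i, 1 ≤ i → i ≤ n → StronglyMeasurable[F i] (X i)
  sq_int : ∀ i, 1 ≤ i → i ≤ n → Integrable (fun ω => (X i ω) ^ 2) P
  mean_zero : ∀ i, 1 ≤ i → i ≤ n → P[X i|F (i - 1)] =ᵐ[P] 0
  var_pos : ∀ i, 1 ≤ i → i ≤ n → 0 < ∫ ω, (X i ω) ^ 2 ∂P

namespace MDS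

variable {Ω : Type} [mΩ : MeasurableSpace Ω] {P : Measure Ω}

/-- `S_n = ∑_{i=1}^n X_i`. -/
noncomputable def S (A : MDS Ω P) : Ω → ℝ := fun ω => ∑ i ∈ Finset.Icc 1 A.n, A.X i ω

/-- `B_n² = ∑_{i=1}^n E[X_i²]`. -/
noncomputable def Bsq (A : MDS Ω P) : ℝ := ∑ i ∈ Finset.Icc 1 A.n, ∫ ω, (A.X i ω) ^ 2 ∂P

/-- `[S]_n = ∑_{i=1}^n X_i²`. -/
noncomputable def QV (A : MDS Ω P) : Ω → ℝ := fun ω => ∑ i ∈ Finset.Icc 1 A.n, (A.X i ω) ^ 2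

/-- `⟨S⟩_n = ∑_{i=1}^n E[X_i² | F_{i-1}]`. -/
noncomputable def CV (A : MDS Ω P) : Ω → ℝ :=
  fun ω => ∑ i ∈ Finset.Icc 1 A.n, (P[fun ω' => (A.X i ω') ^ 2|A.F (i - 1)]) ω

/-- `W_n = S_n / √[S]_n`. -/
noncomputable def W (A : MDS Ω P) : Ω → ℝ := fun ω => A.S ω / Real.sqrt (A.QV ω)

/-- Condition (A1): `|⟨S⟩_n − B_n²| ≤ δ² B_n²` a.s., with `δ ∈ [0, 1/4]`. -/
def CondA1 (A : MDS Ω P) (δ : ℝ) : Prop :=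
  0 ≤ δ ∧ δ ≤ 1 / 4 ∧ ∀ᵐ ω ∂P, |A.CV ω - A.Bsq| ≤ δ ^ 2 * A.Bsq

/-- Condition (A2): `∑_{i=1}^n E[|X_i|^{2+ρ} | F_{i-1}] ≤ ε^ρ B_n^{2+ρ}` a.s.,
with `ε ∈ (0, 1/4]`. -/
def CondA2 (A : MDS Ω P) (ρ ε : ℝ) : Prop :=
  0 < ε ∧ ε ≤ 1 / 4 ∧
    (∀ i, 1 ≤ i → i ≤ A.n → Integrable (fun ω => |A.X i ω| ^ (2 + ρ)) P) ∧
    ∀ᵐ ω ∂P,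
      ∑ i ∈ Finset.Icc 1 A.n, (P[fun ω' => |A.X i ω'| ^ (2 + ρ)|A.F (i - 1)]) ω ≤
        ε ^ ρ * A.Bsq ^ ((2 + ρ) / 2)

/-- Condition (A3): `E[X_i² | F_{i-1}] ≤ κ² B_n²` a.s. for each `i`, with `κ ∈ (0, 1/4]`. -/
def CondA3 (A : MDS Ω P) (κ : ℝ) : Prop :=
  0 < κ ∧ κ ≤ 1 / 4 ∧
    ∀ i, 1 ≤ i → i ≤ A.n →
      ∀ᵐ ω ∂P, (P[fun ω' => (A.X i ω') ^ 2|A.F (i - 1)]) ω ≤ κ ^ 2 * A.Bsq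

/-- Condition (A4): `E[|X_i|^{2+ρ} | F_{i-1}] ≤ (γ B_n)^ρ E[X_i² | F_{i-1}]` a.s.
for each `i`, with `γ ∈ (0, 1/4]`. -/
def CondA4 (A : MDS Ω P) (ρ γ : ℝ) : Prop :=
  0 < γ ∧ γ ≤ 1 / 4 ∧
    (∀ i, 1 ≤ i → i ≤ A.n → Integrable (fun ω => |A.X i ω| ^ (2 + ρ)) P) ∧
    ∀ i, 1 ≤ i → i ≤ A.n →
      ∀ᵐ ω ∂P,
        (P[fun ω' => |A.X i ω'| ^ (2 + ρ)|A.F (i - 1)]) ω ≤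
          (γ * Real.sqrt A.Bsq) ^ ρ * (P[fun ω' => (A.X i ω') ^ 2|A.F (i - 1)]) ω

end MDS


namespace Cr

/-- standard normal density -/
noncomputable def phi (t : ℝ) : ℝ := (Real.sqrt (2 * Real.pi))⁻¹ * Real.exp (-(t ^ 2) / 2)

lemma c0_pos : 0 < (Real.sqrt (2 * Real.pi))⁻¹ := by positivity

lemma c0_le : (Real.sqrt (2 * Real.pi))⁻¹ ≤ 1 / 2 := by
  have h : (2:ℝ) ≤ Real.sqrt (2 * Real.pi) := by
    apply Real.le_sqrt_of_sq_le
    nlinarith [Real.pi_gt_three]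
  rw [one_div]
  exact inv_anti₀ (by norm_num) h

lemma c0_ge : 1 / 3 ≤ (Real.sqrt (2 * Real.pi))⁻¹ := by
  have h : Real.sqrt (2 * Real.pi) ≤ 3 := by
    apply Real.sqrt_le_iff.2
    constructor
    · norm_num
    · nlinarith [Real.pi_lt_four]
  rw [one_div]
  exact inv_anti₀ (by positivity) h

lemma phi_pos (t : ℝ) : 0 < phi t := by unfold phi; positivity

lemma phi_le (t : ℝ) : phi t ≤ 1 / 2 := by
  unfold phi
  have : Real.exp (-(t ^ 2) / 2) ≤ 1 := by
    apply Real.exp_le_one_iff.2; nlinarith [sq_nonneg t]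
  nlinarith [c0_le, c0_pos, Real.exp_pos (-(t ^ 2) / 2)]

lemma phi_neg (t : ℝ) : phi (-t) = phi t := by unfold phi; rw [neg_sq]

lemma phi_cont : Continuous phi := by unfold phi; fun_prop

lemma phi_int : Integrable phi := by
  unfold phi
  apply Integrable.const_mul
  have := integrable_exp_neg_mul_sq (b := 1/2) (by norm_num)
  refine this.congr (Eventually.of_forall fun t => ?_)
  simp only; congr 1; ring

lemma phi_total : ∫ t, phi t = 1 := by
  unfold phi
  rw [integral_const_mul]
  have h := integral_gaussian (1/2)
  have h2 : (∫ t : ℝ, Real.exp (-(t ^ 2) / 2)) = Real.sqrt (2 * Real.pi) := by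
    have e : (Real.pi / (1/2)) = 2 * Real.pi := by ring
    rw [← e, ← h]; congr 1; ext t; congr 1; ring
  rw [h2]; field_simp

lemma cdf_eq (x : ℝ) : stdNormalCDF x = ∫ t in Set.Iic x, phi t := by
  unfold stdNormalCDF phi
  rw [integral_const_mul]

lemma cdf_deriv (x : ℝ) : HasDerivAt stdNormalCDF (phi x) x := by
  have h1 : ∀ y, stdNormalCDF y = (∫ t in (0:ℝ)..y, phi t) + stdNormalCDF 0 := by
    intro y
    rw [cdf_eq, cdf_eq, ← intervalIntegral.integral_Iic_sub_Iic phi_int.integrableOn phi_int.integrableOn]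
    ring
  have h2 : HasDerivAt (fun y => ∫ t in (0:ℝ)..y, phi t) (phi x) x :=
    intervalIntegral.integral_hasDerivAt_right (phi_cont.intervalIntegrable _ _)
      (phi_cont.stronglyMeasurableAtFilter _ _) phi_cont.continuousAt
  have h3 : stdNormalCDF = fun y => (∫ t in (0:ℝ)..y, phi t) + stdNormalCDF 0 := funext h1
  rw [h3]
  exact h2.add_const _

lemma cdf_cont : Continuous stdNormalCDF :=
  continuous_iff_continuousAt.2 fun x => (cdf_deriv x).continuousAt

lemma cdf_mono : Monotone stdNormalCDF :=
  monotone_of_deriv_nonneg (fun x => (cdf_deriv x).differentiableAt)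
    (fun x => by rw [(cdf_deriv x).deriv]; exact (phi_pos x).le)

lemma cdf_compl (x : ℝ) : 1 - stdNormalCDF x = ∫ t in Set.Ioi x, phi t := by
  rw [cdf_eq, ← phi_total, ← intervalIntegral.integral_Iic_add_Ioi phi_int.integrableOn phi_int.integrableOn (b := x)]
  ring

lemma cdf_neg (x : ℝ) : stdNormalCDF (-x) = 1 - stdNormalCDF x := by
  rw [cdf_compl, cdf_eq]
  have h := integral_comp_neg_Iic (-x) phi
  rw [neg_neg] at h
  rw [← h]
  congr 1; ext t; rw [phi_neg]

lemma cdf_nonneg (x : ℝ) : 0 ≤ stdNormalCDF x := by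
  rw [cdf_eq]; exact integral_nonneg fun t => (phi_pos t).le

lemma cdf_le_one (x : ℝ) : stdNormalCDF x ≤ 1 := by
  have : 0 ≤ 1 - stdNormalCDF x := by
    rw [cdf_compl]; exact integral_nonneg fun t => (phi_pos t).le
  linarith

lemma cdf_zero : stdNormalCDF 0 = 1 / 2 := by
  have := cdf_neg 0
  rw [neg_zero] at this; linarith

/-- mean value inequality in the form used throughout -/
lemma mvt_pow {f f' : ℝ → ℝ} {C : ℝ} (k : ℕ) (hf : ∀ t, HasDerivAt f (f' t) t) (h0 : f 0 = 0) (h : ℝ)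
    (hb : ∀ t, |t| ≤ |h| → |f' t| ≤ C * |t| ^ k) (hC : 0 ≤ C) : |f h| ≤ C * |h| ^ (k + 1) := by
  have hs : ∀ t ∈ Set.uIcc 0 h, |t| ≤ |h| := by
    intro t ht
    rcases le_total 0 h with hh | hh
    · rw [Set.uIcc_of_le hh] at ht
      rw [abs_of_nonneg ht.1, abs_of_nonneg hh]; exact ht.2
    · rw [Set.uIcc_of_ge hh] at ht
      rw [abs_of_nonpos ht.2, abs_of_nonpos hh]; linarith [ht.1]
  have := (convex_uIcc (0:ℝ) h).norm_image_sub_le_of_norm_hasDerivWithin_le (f := f) (f' := f')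
    (C := C * |h| ^ k)
    (fun t _ => (hf t).hasDerivWithinAt)
    (fun t ht => by
      rw [Real.norm_eq_abs]
      refine (hb t (hs t ht)).trans ?_
      exact mul_le_mul_of_nonneg_left (pow_le_pow_left₀ (abs_nonneg t) (hs t ht) k) hC)
    (Set.left_mem_uIcc) (Set.right_mem_uIcc)
  rw [h0, sub_zero, sub_zero, Real.norm_eq_abs, Real.norm_eq_abs] at this
  rw [pow_succ, ← mul_assoc]; exact this

lemma phi_deriv (x : ℝ) : HasDerivAt phi (-x * phi x) x := by
  unfold phi
  have h : HasDerivAt (fun t : ℝ => -(t ^ 2) / 2) (-x) x := by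
    have := ((hasDerivAt_pow 2 x).neg).div_const 2
    exact this.congr_deriv (by simp; ring)
  have := (h.exp).const_mul (Real.sqrt (2 * Real.pi))⁻¹
  exact this.congr_deriv (by ring)

lemma exp_neg_half_le (s : ℝ) (hs : 0 ≤ s) : (1 + s / 2 + s ^ 2 / 8) * Real.exp (-s / 2) ≤ 1 := by
  have h := Real.quadratic_le_exp_of_nonneg (x := s / 2) (by linarith)
  have h2 : Real.exp (s / 2) * Real.exp (-s / 2) = 1 := by
    rw [← Real.exp_add]; ring_nf; exact Real.exp_zero
  calc (1 + s / 2 + s ^ 2 / 8) * Real.exp (-s / 2) ≤ Real.exp (s / 2) * Real.exp (-s / 2) := by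
        apply mul_le_mul_of_nonneg_right _ (Real.exp_pos _).le
        nlinarith
    _ = 1 := h2

lemma phi_poly (t : ℝ) : (1 + t ^ 2 / 2 + t ^ 4 / 8) * phi t ≤ 1 / 2 := by
  have h := exp_neg_half_le (t ^ 2) (sq_nonneg t)
  unfold phi
  have e : (1 + t ^ 2 / 2 + t ^ 4 / 8) * ((Real.sqrt (2 * Real.pi))⁻¹ * Real.exp (-(t ^ 2) / 2))
    = (Real.sqrt (2 * Real.pi))⁻¹ * ((1 + t ^ 2 / 2 + (t ^ 2) ^ 2 / 8) * Real.exp (-(t ^ 2) / 2)) := by ring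
  rw [e]
  calc _ ≤ (Real.sqrt (2 * Real.pi))⁻¹ * 1 := mul_le_mul_of_nonneg_left h c0_pos.le
    _ ≤ 1 / 2 := by linarith [c0_le]

lemma abs_mul_phi (t : ℝ) : |t| * phi t ≤ 1 := by
  have h := phi_poly t
  have hp := phi_pos t
  have h1 : |t| ≤ 2 * (1 + t ^ 2 / 2 + t ^ 4 / 8) := by
    rw [abs_le]; constructor <;> nlinarith [sq_nonneg (t-1), sq_nonneg (t+1), sq_nonneg (t^2)]
  nlinarith

lemma sq_mul_phi (t : ℝ) : |(t ^ 2 - 1) * phi t| ≤ 1 := by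
  have h := phi_poly t
  have hp := phi_pos t
  rw [abs_mul, abs_of_pos hp]
  have h1 : |t ^ 2 - 1| ≤ 2 * (1 + t ^ 2 / 2 + t ^ 4 / 8) := by
    rw [abs_le]; constructor <;> nlinarith [sq_nonneg (t^2), sq_nonneg t]
  nlinarith

lemma cube_mul_phi (t : ℝ) : |t * (t ^ 2 - 1) * phi t| ≤ 6 := by
  have h := phi_poly t
  have hp := phi_pos t
  rw [abs_mul, abs_of_pos hp]
  have h1 : |t * (t ^ 2 - 1)| ≤ 12 * (1 + t ^ 2 / 2 + t ^ 4 / 8) := by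
    rw [abs_le]; constructor <;>
      nlinarith [sq_nonneg (t^2), sq_nonneg (t^2-t), sq_nonneg (t^2+t), sq_nonneg t, sq_nonneg (t-1), sq_nonneg (t+1)]
  nlinarith

lemma taylor_aux (z h : ℝ) :
    |stdNormalCDF (z + h) - stdNormalCDF z - phi z * h + z * phi z * h ^ 2 / 2| ≤ 2 * |h| ^ 2 ∧
    |stdNormalCDF (z + h) - stdNormalCDF z - phi z * h + z * phi z * h ^ 2 / 2| ≤ |h| ^ 3 := by
  have d3 : ∀ t, HasDerivAt (fun t => -(z + t) * phi (z + t) + z * phi z)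
      (((z + t) ^ 2 - 1) * phi (z + t)) t := by
    intro t
    have a : HasDerivAt (fun t : ℝ => z + t) 1 t := (hasDerivAt_id t).const_add z
    have b := (phi_deriv (z + t)).comp t a
    have := (a.neg.mul b).add_const (z * phi z)
    exact this.congr_deriv (by simp only [Function.comp, Pi.neg_apply]; ring)
  have d2 : ∀ t, HasDerivAt (fun t => phi (z + t) - phi z + z * phi z * t)
      (-(z + t) * phi (z + t) + z * phi z) t := by
    intro t
    have a : HasDerivAt (fun t : ℝ => z + t) 1 t := (hasDerivAt_id t).const_add z
    have b := (phi_deriv (z + t)).comp t a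
    have := (b.sub_const (phi z)).add ((hasDerivAt_id t).const_mul (z * phi z))
    exact this.congr_deriv (by ring)
  have d1 : ∀ t, HasDerivAt
      (fun h => stdNormalCDF (z + h) - stdNormalCDF z - phi z * h + z * phi z * h ^ 2 / 2)
      (phi (z + t) - phi z + z * phi z * t) t := by
    intro t
    have a : HasDerivAt (fun t : ℝ => z + t) 1 t := (hasDerivAt_id t).const_add z
    have b := (cdf_deriv (z + t)).comp t a
    have := ((b.sub_const (stdNormalCDF z)).sub ((hasDerivAt_id t).const_mul (phi z))).add
      (((hasDerivAt_pow 2 t).const_mul (z * phi z)).div_const 2)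
    exact this.congr_deriv (by simp; ring)
  have b3 : ∀ t, |(-(z + t) * phi (z + t) + z * phi z)| ≤ 1 * |t| ^ 1 := by
    intro t
    exact mvt_pow 0 d3 (by simp) t (fun s _ => by simpa using sq_mul_phi (z + s)) (by norm_num)
  have b3' : ∀ t, |(-(z + t) * phi (z + t) + z * phi z)| ≤ 2 * |t| ^ 0 := by
    intro t
    have h1 := abs_mul_phi (z + t)
    have h2 := abs_mul_phi z
    calc _ ≤ |(-(z + t) * phi (z + t))| + |z * phi z| := abs_add_le _ _
      _ = |z + t| * phi (z + t) + |z| * phi z := by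
          rw [abs_mul, abs_mul, abs_neg, abs_of_pos (phi_pos _), abs_of_pos (phi_pos _)]
      _ ≤ 2 * |t| ^ 0 := by simp; linarith
  constructor
  · exact mvt_pow 1 d1 (by simp) h (fun s _ => mvt_pow 0 d2 (by simp) s (fun u _ => b3' u) (by norm_num)) (by norm_num)
  · have := mvt_pow 2 d1 (by simp) h (fun s _ => mvt_pow 1 d2 (by simp) s (fun u _ => b3 u) (by norm_num)) (by norm_num)
    simpa using this

lemma taylor_rho {ρ : ℝ} (h0 : 0 ≤ ρ) (h1 : ρ ≤ 1) (z h : ℝ) :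
    |stdNormalCDF (z + h) - stdNormalCDF z - phi z * h + z * phi z * h ^ 2 / 2| ≤ 2 * |h| ^ (2 + ρ) := by
  obtain ⟨a, b⟩ := taylor_aux z h
  have h2 : (0:ℝ) ≤ |h| := abs_nonneg h
  rcases le_total |h| 1 with hh | hh
  · rcases h2.eq_or_lt with h3 | h3
    · rw [← h3] at a ⊢
      rw [Real.zero_rpow (by linarith)]; simpa using a
    · have : |h| ^ (3:ℕ) ≤ |h| ^ (2 + ρ) := by
        rw [← Real.rpow_natCast]
        exact Real.rpow_le_rpow_of_exponent_ge h3 hh (by push_cast; linarith)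
      have h4 : 0 ≤ |h| ^ (2 + ρ) := by positivity
      linarith
  · have : |h| ^ (2:ℕ) ≤ |h| ^ (2 + ρ) := by
      rw [← Real.rpow_natCast]
      exact Real.rpow_le_rpow_of_exponent_le hh (by push_cast; linarith)
    linarith

lemma cdf_lip (a b : ℝ) : |stdNormalCDF a - stdNormalCDF b| ≤ |a - b| := by
  have := mvt_pow (f := fun h => stdNormalCDF (b + h) - stdNormalCDF b) (f' := fun h => phi (b + h)) (C := 1) 0
    (fun t => by
      have a : HasDerivAt (fun t : ℝ => b + t) 1 t := (hasDerivAt_id t).const_add b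
      have b' := (cdf_deriv (b + t)).comp t a
      have := b'.sub_const (stdNormalCDF b)
      exact this.congr_deriv (by ring)) (by simp) (a - b)
    (fun t _ => by
      rw [abs_of_pos (phi_pos _)]; have := phi_le (b + t); simp; linarith) (by norm_num)
  simpa using this

end Cr


namespace Cr

lemma compl_shift (w : ℝ) : 1 - stdNormalCDF w = ∫ s in Set.Ioi (0:ℝ), phi (s + w) := by
  have h := (measurePreserving_add_right volume w).setIntegral_preimage_emb
    (measurableEmbedding_addRight w) phi (Set.Ioi w)
  have e : (fun s : ℝ => s + w) ⁻¹' Set.Ioi w = Set.Ioi 0 := by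
    ext s; simp
  rw [e] at h
  rw [cdf_compl, h]

lemma cdf_tail {w : ℝ} (hw : 0 ≤ w) : 1 - stdNormalCDF w ≤ Real.exp (-(w ^ 2) / 2) / 2 := by
  have h1 : 1 - stdNormalCDF w = ∫ s in Set.Ioi (0:ℝ), phi (s + w) := compl_shift w
  have h2 : (∫ s in Set.Ioi (0:ℝ), phi (s + w)) ≤ ∫ s in Set.Ioi (0:ℝ), Real.exp (-(w ^ 2) / 2) * phi s := by
    apply setIntegral_mono_on
    · exact (phi_int.comp_add_right w).integrableOn
    · exact (phi_int.const_mul _).integrableOn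
    · exact measurableSet_Ioi
    · intro s hs
      have hs' : 0 < s := hs
      unfold phi
      rw [mul_left_comm, ← Real.exp_add]
      apply mul_le_mul_of_nonneg_left _ c0_pos.le
      apply Real.exp_le_exp.2
      nlinarith [mul_nonneg hs'.le hw]
  rw [integral_const_mul, ← cdf_compl, cdf_zero] at h2
  rw [h1]; linarith

lemma cdf_tail_phi {w : ℝ} (hw : 0 ≤ w) : 1 - stdNormalCDF w ≤ 3 / 2 * phi w := by
  have h := cdf_tail hw
  have : Real.exp (-(w ^ 2) / 2) ≤ 3 * phi w := by
    unfold phi; nlinarith [c0_ge, Real.exp_pos (-(w ^ 2) / 2)]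
  linarith

/-- lower bound for increments -/
lemma cdf_incr {a b m : ℝ} (hab : a ≤ b) (hm : ∀ t, a ≤ t → t ≤ b → m ≤ phi t) :
    m * (b - a) ≤ stdNormalCDF b - stdNormalCDF a := by
  apply Convex.mul_sub_le_image_sub_of_le_deriv (convex_Icc a b) cdf_cont.continuousOn
    (fun x _ => (cdf_deriv x).differentiableAt.differentiableWithinAt) _ _ (Set.left_mem_Icc.2 hab) _ (Set.right_mem_Icc.2 hab) hab
  intro x hx
  rw [interior_Icc] at hx
  rw [(cdf_deriv x).deriv]; exact hm x hx.1.le hx.2.le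

lemma cdf_compl_pos (x : ℝ) : 0 < 1 - stdNormalCDF x := by
  have hm : ∀ t, x ≤ t → t ≤ x + 1 → (Real.sqrt (2 * Real.pi))⁻¹ * Real.exp (-((|x| + 1) ^ 2) / 2) ≤ phi t := by
    intro t h1 h2
    unfold phi
    apply mul_le_mul_of_nonneg_left _ c0_pos.le
    apply Real.exp_le_exp.2
    have : |t| ≤ |x| + 1 := by
      rw [abs_le]; constructor <;> linarith [neg_abs_le x, le_abs_self x]
    have := sq_le_sq' (by linarith [abs_nonneg t, abs_nonneg x]) this
    rw [sq_abs] at this; linarith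
  have h := cdf_incr (by linarith) hm
  have h2 := cdf_le_one (x + 1)
  have h3 : 0 < (Real.sqrt (2 * Real.pi))⁻¹ * Real.exp (-((|x| + 1) ^ 2) / 2) := by positivity
  have : x + 1 - x = 1 := by ring
  rw [this, mul_one] at h
  linarith

lemma exp_two_le : Real.exp 2 ≤ 9 := by
  have h : Real.exp 2 = Real.exp 1 * Real.exp 1 := by rw [← Real.exp_add]; norm_num
  have := Real.exp_one_lt_d9
  rw [h]; nlinarith [Real.exp_pos 1]

/-- Mills ratio lower bound -/
lemma mills {x : ℝ} (hx : 0 ≤ x) : Real.exp (-(x ^ 2) / 2) / (27 * (1 + x)) ≤ 1 - stdNormalCDF x := by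
  have hp : 0 < 1 + x := by linarith
  have hq : 0 < 1 / (1 + x) := by positivity
  have hm : ∀ t, x ≤ t → t ≤ x + 1 / (1 + x) →
      Real.exp (-(x ^ 2) / 2) / 27 ≤ phi t := by
    intro t h1 h2
    have ht : t ^ 2 ≤ x ^ 2 + 3 := by
      have h3 : t ^ 2 ≤ (x + 1 / (1 + x)) ^ 2 := by
        apply pow_le_pow_left₀ (by linarith) h2
      have h4 : x * (1 / (1 + x)) ≤ 1 := by
        rw [mul_one_div, div_le_one hp]; linarith
      have h5 : 1 / (1 + x) ≤ 1 := by
        rw [div_le_one hp]; linarith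
      nlinarith
    unfold phi
    have h6 : Real.exp (-(x ^ 2) / 2) ≤ Real.exp (-(t ^ 2) / 2) * Real.exp 2 := by
      rw [← Real.exp_add]; apply Real.exp_le_exp.2; linarith
    have := exp_two_le
    have h7 := Real.exp_pos (-(t ^ 2) / 2)
    nlinarith [c0_ge]
  have h := cdf_incr (by linarith) hm
  have h2 := cdf_le_one (x + 1 / (1 + x))
  have e : Real.exp (-(x ^ 2) / 2) / 27 * (x + 1 / (1 + x) - x) = Real.exp (-(x ^ 2) / 2) / (27 * (1 + x)) := by
    field_simp; ring
  rw [e] at h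
  linarith

/-- smoothing inequality -/
lemma smooth_aux {w h : ℝ} (hw : 0 ≤ w) (hh : 1 / 2 ≤ h) :
    1 - stdNormalCDF w ≤ 12 * (stdNormalCDF (w + h) - stdNormalCDF (w - h)) := by
  have h1 := cdf_tail_phi hw
  have hm : ∀ t, w - 1 / 2 ≤ t → t ≤ w → phi w / 4 ≤ phi t := by
    intro t h2 h3
    unfold phi
    have : Real.exp (-(w ^ 2) / 2) ≤ 4 * Real.exp (-(t ^ 2) / 2) := by
      have h4 : Real.exp (-(w ^ 2) / 2) ≤ Real.exp (-(t ^ 2) / 2) * Real.exp 1 := by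
        rw [← Real.exp_add]; apply Real.exp_le_exp.2
        nlinarith
      have := Real.exp_one_lt_d9
      nlinarith [Real.exp_pos (-(t ^ 2) / 2)]
    nlinarith [c0_pos]
  have h5 := cdf_incr (by linarith) hm
  have h6 : stdNormalCDF w ≤ stdNormalCDF (w + h) := cdf_mono (by linarith)
  have h7 : stdNormalCDF (w - h) ≤ stdNormalCDF (w - 1/2) := cdf_mono (by linarith)
  nlinarith

lemma smooth {z h : ℝ} (hh : 1 / 2 ≤ h) :
    |(if 0 ≤ z then (1:ℝ) else 0) - stdNormalCDF z| ≤ 12 * (stdNormalCDF (z + h) - stdNormalCDF (z - h)) := by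
  split_ifs with hz
  · rw [abs_of_nonneg (by linarith [cdf_le_one z])]
    exact smooth_aux hz hh
  · push Not at hz
    rw [zero_sub, abs_neg, abs_of_nonneg (cdf_nonneg z)]
    have := smooth_aux (w := -z) (by linarith) hh
    rw [cdf_neg z, show -z + h = -(z - h) by ring, show -z - h = -(z + h) by ring, cdf_neg, cdf_neg] at this
    linarith

/-- heat-type expansion -/
lemma heat (z τ : ℝ) (hτ : 0 ≤ τ) :
    |stdNormalCDF (z / Real.sqrt (1 + τ)) - stdNormalCDF z + z * phi z * τ / 2| ≤ 5 * τ ^ 2 := by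
  -- derivatives in s on [0, τ]
  set u : ℝ → ℝ := fun s => z / Real.sqrt (1 + s) with hu
  have du : ∀ s, 0 ≤ s → HasDerivAt u (-(u s) / (2 * (1 + s))) s := by
    intro s hs
    have hp : 0 < 1 + s := by linarith
    have h1 : HasDerivAt (fun s : ℝ => 1 + s) 1 s := (hasDerivAt_id s).const_add 1
    have h2 := h1.sqrt hp.ne'
    have h3 := (h2.inv (Real.sqrt_pos.2 hp).ne').const_mul z
    have h4 : u = fun s => z * (Real.sqrt (1 + s))⁻¹ := by
      ext s; simp only [hu]; rw [div_eq_mul_inv]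
    rw [h4]
    refine h3.congr_deriv ?_
    have h5 := Real.sq_sqrt hp.le
    have h6 := Real.sqrt_pos.2 hp
    field_simp
    rw [h5]
  have dk : ∀ s, 0 ≤ s → HasDerivAt (fun s => u s * phi (u s) / (1 + s))
      (((u s) * ((u s) ^ 2 - 1) * phi (u s) / 2 - u s * phi (u s)) / (1 + s) ^ 2) s := by
    intro s hs
    have hp : 0 < 1 + s := by linarith
    have h1 : HasDerivAt (fun s : ℝ => 1 + s) 1 s := (hasDerivAt_id s).const_add 1
    have h2 := ((du s hs).mul ((phi_deriv (u s)).comp s (du s hs))).div h1 hp.ne'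
    refine h2.congr_deriv ?_
    simp only [Function.comp, Pi.mul_apply]
    field_simp
    ring
  have dP : ∀ s, 0 ≤ s → HasDerivAt (fun s => stdNormalCDF (u s) - stdNormalCDF z + z * phi z * s / 2)
      ((z * phi z - u s * phi (u s) / (1 + s)) / 2) s := by
    intro s hs
    have hp : 0 < 1 + s := by linarith
    have h2 := (((cdf_deriv (u s)).comp s (du s hs)).sub_const (stdNormalCDF z)).add
      (((hasDerivAt_id s).const_mul (z * phi z)).div_const 2)
    refine h2.congr_deriv ?_
    field_simp
    ring
  have u0 : u 0 = z := by simp [hu]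
  have bk : ∀ s, 0 ≤ s → |(u s) * phi (u s) / (1 + s) - z * phi z| ≤ 4 * s := by
    intro s hs
    have := (convex_Icc (0:ℝ) s).norm_image_sub_le_of_norm_hasDerivWithin_le
      (f := fun s => u s * phi (u s) / (1 + s)) (C := 4)
      (fun t ht => (dk t ht.1).hasDerivWithinAt)
      (fun t ht => by
        have hp : 1 ≤ (1 + t) ^ 2 := by nlinarith [ht.1]
        rw [Real.norm_eq_abs, abs_div, abs_of_pos (by positivity : 0 < (1 + t) ^ 2)]
        have h1 := cube_mul_phi (u t)
        have h2 := abs_mul_phi (u t)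
        have h3 : |(u t) * ((u t) ^ 2 - 1) * phi (u t) / 2 - u t * phi (u t)| ≤ 4 := by
          have h4 : |u t * phi (u t)| ≤ 1 := by rwa [abs_mul, abs_of_pos (phi_pos _)]
          rw [abs_le] at h1 h4 ⊢
          constructor <;> linarith
        calc _ ≤ |(u t) * ((u t) ^ 2 - 1) * phi (u t) / 2 - u t * phi (u t)| / 1 := by
              apply div_le_div_of_nonneg_left (abs_nonneg _) (by norm_num) hp
          _ ≤ 4 := by simpa using h3)
      (Set.left_mem_Icc.2 hs) (Set.right_mem_Icc.2 hs)
    simp only [Real.norm_eq_abs, u0, sub_zero, add_zero, div_one] at this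
    rwa [abs_of_nonneg hs] at this
  have := (convex_Icc (0:ℝ) τ).norm_image_sub_le_of_norm_hasDerivWithin_le
      (f := fun s => stdNormalCDF (u s) - stdNormalCDF z + z * phi z * s / 2) (C := 5 * τ)
      (fun t ht => (dP t ht.1).hasDerivWithinAt)
      (fun t ht => by
        have h1 := bk t ht.1
        rw [Real.norm_eq_abs, abs_div, abs_sub_comm]
        rw [abs_of_pos (by norm_num : (0:ℝ) < 2)]
        linarith [ht.1, ht.2])
      (Set.left_mem_Icc.2 hτ) (Set.right_mem_Icc.2 hτ)
  simp only [Real.norm_eq_abs, u0, sub_zero, mul_zero, zero_div, sub_self, add_zero] at this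
  rw [abs_of_nonneg hτ] at this
  calc _ ≤ 5 * τ * τ := this
    _ = 5 * τ ^ 2 := by ring

/-- Gaussian transform -/
lemma J_identity (x : ℝ) : ∫ w in Set.Ioi (0:ℝ), Real.exp (-(x * w)) * phi w
    = Real.exp (x ^ 2 / 2) * (1 - stdNormalCDF x) := by
  have h1 : 1 - stdNormalCDF x = ∫ s in Set.Ioi (0:ℝ), phi (s + x) := compl_shift x
  rw [h1, ← integral_const_mul]
  congr 1; ext w
  unfold phi
  rw [mul_left_comm, ← Real.exp_add, mul_left_comm, ← Real.exp_add]
  congr 2; ring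

end Cr


namespace Cr

lemma pow_interp {ρ t a K : ℝ} (k : ℕ) (hk : 0 < (k:ℝ) + ρ) (h0 : 0 ≤ ρ) (h1 : ρ ≤ 1) (ht : 0 ≤ t) (hK : 0 ≤ K)
    (ha : a ≤ K * t ^ k) (hb : a ≤ K * t ^ (k + 1)) : a ≤ K * t ^ ((k:ℝ) + ρ) := by
  rcases ht.eq_or_lt with h | h
  · rw [← h, Real.zero_rpow hk.ne']; rw [← h] at hb; simpa using hb
  rcases le_total t 1 with h2 | h2
  · refine hb.trans (mul_le_mul_of_nonneg_left ?_ hK)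
    rw [← Real.rpow_natCast]
    exact Real.rpow_le_rpow_of_exponent_ge h h2 (by push_cast; linarith)
  · refine ha.trans (mul_le_mul_of_nonneg_left ?_ hK)
    rw [← Real.rpow_natCast]
    exact Real.rpow_le_rpow_of_exponent_le h2 (by linarith)

lemma pow_interp2 {ρ t a K : ℝ} (h0 : 0 ≤ ρ) (h1 : ρ ≤ 1) (ht : 0 ≤ t) (hK : 0 ≤ K)
    (ha : a ≤ K * t ^ 2) (hb : a ≤ K * t ^ 3) : a ≤ K * t ^ (2 + ρ) := by
  have := pow_interp (ρ := ρ) 2 (by push_cast; linarith) h0 h1 ht hK ha hb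
  push_cast at this; exact this

lemma pow_interp1 {ρ t a K : ℝ} (h0 : 0 ≤ ρ) (h1 : ρ ≤ 1) (ht : 0 ≤ t) (hK : 0 ≤ K)
    (ha : a ≤ K * t) (hb : a ≤ K * t ^ 2) : a ≤ K * t ^ (1 + ρ) := by
  have := pow_interp (ρ := ρ) 1 (by push_cast; linarith) h0 h1 ht hK (by simpa using ha) hb
  push_cast at this; exact this

lemma pow_interp0 {ρ t a K : ℝ} (h0 : 0 < ρ) (h1 : ρ ≤ 1) (ht : 0 ≤ t) (hK : 0 ≤ K)
    (ha : a ≤ K) (hb : a ≤ K * t) : a ≤ K * t ^ ρ := by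
  have := pow_interp (ρ := ρ) 0 (by push_cast; linarith) h0.le h1 ht hK (by simpa using ha) (by simpa using hb)
  simpa using this

lemma exp_taylor2 (h : ℝ) : |Real.exp h - 1 - h| ≤ Real.exp |h| * |h| ^ 2 := by
  refine mvt_pow (f := fun h => Real.exp h - 1 - h) (f' := fun h => Real.exp h - 1) 1
    (fun t => ?_) (by simp) h (fun t ht => ?_) (Real.exp_pos _).le
  · exact ((Real.hasDerivAt_exp t).sub_const 1).sub (hasDerivAt_id t)
  · refine mvt_pow (f := fun h => Real.exp h - 1) (f' := fun h => Real.exp h) 0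
      (fun t => ?_) (by simp) t (fun s hs => ?_) (Real.exp_pos _).le
    · exact ((Real.hasDerivAt_exp t).sub_const 1)
    · rw [abs_of_pos (Real.exp_pos _), pow_zero, mul_one]
      exact Real.exp_le_exp.2 ((le_abs_self s).trans (hs.trans ht))

lemma exp_taylor3 (h : ℝ) : |Real.exp h - 1 - h - h ^ 2 / 2| ≤ Real.exp |h| * |h| ^ 3 := by
  refine mvt_pow (f := fun h => Real.exp h - 1 - h - h ^ 2 / 2) (f' := fun h => Real.exp h - 1 - h) 2
    (fun t => ?_) (by simp) h (fun t ht => ?_) (Real.exp_pos _).le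
  · exact ((((Real.hasDerivAt_exp t).sub_const 1).sub (hasDerivAt_id t)).sub
      ((hasDerivAt_pow 2 t).div_const 2)).congr_deriv (by simp)
  · refine (exp_taylor2 t).trans ?_
    exact mul_le_mul_of_nonneg_right (Real.exp_le_exp.2 ht) (by positivity)

/-- second order expansion of exp (a y - b y^2) -/
lemma exp_quad (a b : ℝ) (hb : 0 < b) : ∃ C : ℝ, 0 ≤ C ∧ ∀ ρ y : ℝ, 0 ≤ ρ → ρ ≤ 1 →
    |Real.exp (a * y - b * y ^ 2) - 1 - a * y - (a ^ 2 / 2 - b) * y ^ 2| ≤ C * |y| ^ (2 + ρ) := by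
  set W := |a| + b with hW
  have hW0 : 0 < W := by have := abs_nonneg a; linarith
  set C1 := Real.exp W * W ^ 3 + |a| * b + b ^ 2 with hC1
  set C2 := Real.exp (a ^ 2 / (4 * b)) + 1 + |a| + |a ^ 2 / 2 - b| with hC2
  have hC1' : 0 ≤ C1 := by positivity
  have hC2' : 0 ≤ C2 := by positivity
  refine ⟨C1 + C2, by positivity, fun ρ y h0 h1 => ?_⟩
  have ht : 0 ≤ |y| := abs_nonneg y
  have hy2 : |y| ^ 2 = y ^ 2 := sq_abs y
  rcases le_total |y| 1 with h | h
  · have key : |Real.exp (a * y - b * y ^ 2) - 1 - a * y - (a ^ 2 / 2 - b) * y ^ 2| ≤ (C1 + C2) * |y| ^ 3 := by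
      set w := a * y - b * y ^ 2 with hw
      have hwb : |w| ≤ W * |y| := by
        calc |w| ≤ |a * y| + |b * y ^ 2| := abs_sub _ _
          _ = |a| * |y| + b * |y| ^ 2 := by rw [abs_mul, abs_mul, abs_of_pos hb, abs_pow]
          _ ≤ W * |y| := by
              have : |y| ^ 2 ≤ |y| := by nlinarith
              have := mul_le_mul_of_nonneg_left this hb.le
              rw [hW]; linarith
      have h3 := exp_taylor3 w
      have e : Real.exp w - 1 - a * y - (a ^ 2 / 2 - b) * y ^ 2
          = (Real.exp w - 1 - w - w ^ 2 / 2) + (b ^ 2 * y ^ 4 / 2 - a * b * y ^ 3) := by rw [hw]; ring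
      rw [e]
      have h4 : |w| ≤ W := hwb.trans (by nlinarith)
      have h5 : Real.exp |w| * |w| ^ 3 ≤ Real.exp W * W ^ 3 * |y| ^ 3 := by
        calc _ ≤ Real.exp W * (W * |y|) ^ 3 := by gcongr
          _ = _ := by ring
      have h6 : |b ^ 2 * y ^ 4 / 2 - a * b * y ^ 3| ≤ (|a| * b + b ^ 2) * |y| ^ 3 := by
        calc _ ≤ |b ^ 2 * y ^ 4 / 2| + |a * b * y ^ 3| := abs_sub _ _
          _ = b ^ 2 * |y| ^ 4 / 2 + |a| * b * |y| ^ 3 := by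
              simp only [abs_mul, abs_div, abs_pow, abs_of_pos hb, abs_two]
          _ ≤ _ := by
              have : |y| ^ 4 ≤ |y| ^ 3 := pow_le_pow_of_le_one ht h (by norm_num)
              have h7 : 0 ≤ |y| ^ 3 := by positivity
              nlinarith [sq_nonneg b]
      have h8 : 0 ≤ C2 * |y| ^ 3 := by positivity
      calc _ ≤ _ := abs_add_le _ _
        _ ≤ Real.exp W * W ^ 3 * |y| ^ 3 + (|a| * b + b ^ 2) * |y| ^ 3 := by linarith
        _ ≤ _ := by rw [hC1]; linarith
    refine pow_interp2 h0 h1 ht (by positivity) (key.trans ?_) key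
    apply mul_le_mul_of_nonneg_left _ (by positivity)
    exact pow_le_pow_of_le_one ht h (by norm_num)
  · have key : |Real.exp (a * y - b * y ^ 2) - 1 - a * y - (a ^ 2 / 2 - b) * y ^ 2| ≤ (C1 + C2) * |y| ^ 2 := by
      have h3 : Real.exp (a * y - b * y ^ 2) ≤ Real.exp (a ^ 2 / (4 * b)) := by
        apply Real.exp_le_exp.2
        rw [le_div_iff₀ (by positivity)]
        nlinarith [sq_nonneg (a - 2 * b * y)]
      have h4 : 1 ≤ |y| ^ 2 := one_le_pow₀ h
      have h5 : |y| ≤ |y| ^ 2 := by nlinarith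
      have h6 := Real.exp_pos (a * y - b * y ^ 2)
      have h7 := Real.exp_pos (a ^ 2 / (4 * b))
      calc _ ≤ |Real.exp (a * y - b * y ^ 2)| + |1| + |a * y| + |(a ^ 2 / 2 - b) * y ^ 2| := by
            refine (abs_sub _ _).trans ?_
            gcongr
            refine (abs_sub _ _).trans ?_
            gcongr
            exact abs_sub _ _
        _ = Real.exp (a * y - b * y ^ 2) + 1 + |a| * |y| + |a ^ 2 / 2 - b| * |y| ^ 2 := by
            rw [abs_of_pos h6, abs_one, abs_mul, abs_mul, abs_pow]
        _ ≤ Real.exp (a ^ 2 / (4 * b)) * |y| ^ 2 + 1 * |y| ^ 2 + |a| * |y| ^ 2 + |a ^ 2 / 2 - b| * |y| ^ 2 := by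
            have : Real.exp (a ^ 2 / (4 * b)) * 1 ≤ Real.exp (a ^ 2 / (4 * b)) * |y| ^ 2 :=
              mul_le_mul_of_nonneg_left h4 h7.le
            have := mul_le_mul_of_nonneg_left h5 (abs_nonneg a)
            linarith
        _ = C2 * |y| ^ 2 := by rw [hC2]; ring
        _ ≤ _ := by
            have : 0 ≤ C1 * |y| ^ 2 := by positivity
            linarith
    refine pow_interp2 h0 h1 ht (by positivity) key (key.trans ?_)
    apply mul_le_mul_of_nonneg_left _ (by positivity)
    exact pow_le_pow_right₀ h (by norm_num)

/-! facts on `exp (y - y^2/2)` -/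

lemma E_poly (y : ℝ) : (1 + y ^ 2 / 4 + y ^ 4 / 32) * Real.exp (y - y ^ 2 / 2) ≤ 3 := by
  have h := exp_neg_half_le (y ^ 2 / 2) (by positivity)
  have h2 : Real.exp (y - y ^ 2 / 2) ≤ 3 * Real.exp (-(y ^ 2 / 2) / 2) := by
    have : Real.exp (y - y ^ 2 / 2) ≤ Real.exp 1 * Real.exp (-(y ^ 2 / 2) / 2) := by
      rw [← Real.exp_add]; apply Real.exp_le_exp.2; nlinarith [sq_nonneg (y - 2)]
    have h3 := Real.exp_one_lt_d9
    nlinarith [Real.exp_pos (-(y ^ 2 / 2) / 2)]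
  calc _ ≤ (1 + y ^ 2 / 4 + y ^ 4 / 32) * (3 * Real.exp (-(y ^ 2 / 2) / 2)) := by gcongr
    _ = 3 * ((1 + (y ^ 2 / 2) / 2 + (y ^ 2 / 2) ^ 2 / 8) * Real.exp (-(y ^ 2 / 2) / 2)) := by ring
    _ ≤ 3 := by linarith

lemma E_le (y : ℝ) : Real.exp (y - y ^ 2 / 2) ≤ 2 := by
  have h1 : Real.exp (y - y ^ 2 / 2) ≤ Real.exp (1 / 2) := by
    apply Real.exp_le_exp.2; nlinarith [sq_nonneg (y - 1)]
  have h2 : Real.exp (1 / 2) ^ 2 = Real.exp 1 := by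
    rw [← Real.exp_nat_mul]; norm_num
  have := Real.exp_one_lt_d9
  nlinarith [Real.exp_pos (1/2 : ℝ)]

/-- `(1+t)^3 E ≤ K` -/
lemma E_cube (y : ℝ) : (1 + |y|) ^ 3 * Real.exp (y - y ^ 2 / 2) ≤ 300 := by
  have h := E_poly y
  have hp := Real.exp_pos (y - y ^ 2 / 2)
  have ht := abs_nonneg y
  have e2 : y ^ 2 = |y| ^ 2 := (sq_abs y).symm
  have e4 : y ^ 4 = |y| ^ 4 := by rw [show y ^ 4 = (y ^ 2) ^ 2 by ring, e2]; ring
  have : (1 + |y|) ^ 3 ≤ 100 * (1 + y ^ 2 / 4 + y ^ 4 / 32) := by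
    rw [e2, e4]
    nlinarith [sq_nonneg (|y| ^ 2 - |y|), sq_nonneg (|y| - 1), sq_nonneg (|y| ^ 2)]
  nlinarith

lemma E_sub_one (y : ℝ) : |Real.exp (y - y ^ 2 / 2) - 1| ≤ 5 ∧ |Real.exp (y - y ^ 2 / 2) - 1| ≤ 5 * |y| := by
  have h2 := E_le y
  have hp := Real.exp_pos (y - y ^ 2 / 2)
  have h1 : |Real.exp (y - y ^ 2 / 2) - 1| ≤ 1 := by
    rw [abs_le]; constructor <;> linarith
  refine ⟨by linarith, ?_⟩
  rcases le_total |y| 1 with h | h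
  · have hw : |y - y ^ 2 / 2| ≤ 3 / 2 * |y| := by
      calc _ ≤ |y| + |y ^ 2 / 2| := abs_sub _ _
        _ = |y| + |y| ^ 2 / 2 := by rw [abs_div, abs_pow, abs_two]
        _ ≤ _ := by nlinarith [abs_nonneg y]
    rcases le_total 0 (y - y ^ 2 / 2) with h3 | h3
    · -- e^w - 1 ≤ w e^w ≤ 2w
      have h4 := Real.add_one_le_exp (-(y - y ^ 2 / 2))
      have h5 : Real.exp (y - y ^ 2 / 2) * Real.exp (-(y - y ^ 2 / 2)) = 1 := by
        rw [← Real.exp_add]; simp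
      rw [abs_of_nonneg h3] at hw
      have h6 : 1 ≤ Real.exp (y - y ^ 2 / 2) := Real.one_le_exp h3
      rw [abs_of_nonneg (by linarith)]
      nlinarith
    · have h4 := Real.add_one_le_exp ((y - y ^ 2 / 2))
      have h6 : Real.exp (y - y ^ 2 / 2) ≤ 1 := Real.exp_le_one_iff.2 h3
      rw [abs_of_nonpos h3] at hw
      rw [abs_of_nonpos (by linarith)]
      nlinarith [abs_nonneg y]
  · nlinarith

lemma E_sub_one_rho {ρ : ℝ} (h0 : 0 < ρ) (h1 : ρ ≤ 1) (y : ℝ) :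
    |Real.exp (y - y ^ 2 / 2) - 1| ≤ 5 * |y| ^ ρ :=
  pow_interp0 h0 h1 (abs_nonneg y) (by norm_num) (E_sub_one y).1 (E_sub_one y).2

lemma E_mul_pow {ρ : ℝ} (h0 : 0 < ρ) (h1 : ρ ≤ 1) (y : ℝ) :
    Real.exp (y - y ^ 2 / 2) * (|y| + |y| ^ 2) ≤ 300 * |y| ^ ρ := by
  have h := E_cube y
  have hp := Real.exp_pos (y - y ^ 2 / 2)
  have ht := abs_nonneg y
  refine pow_interp0 h0 h1 ht (by norm_num) ?_ ?_
  · refine le_trans ?_ h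
    rw [mul_comm]
    apply mul_le_mul_of_nonneg_right _ hp.le
    nlinarith [pow_nonneg ht 3, pow_nonneg ht 2]
  · have : Real.exp (y - y ^ 2 / 2) * (1 + |y|) ≤ 300 := by
      refine le_trans ?_ h
      rw [mul_comm]
      apply mul_le_mul_of_nonneg_right _ hp.le
      nlinarith [pow_nonneg ht 3, pow_nonneg ht 2]
    nlinarith

lemma E_first (y : ℝ) {ρ : ℝ} (h0 : 0 ≤ ρ) (h1 : ρ ≤ 1) :
    |Real.exp (y - y ^ 2 / 2) - 1 - y| ≤ 40 * |y| ^ (1 + ρ) := by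
  have ht := abs_nonneg y
  have hA : |Real.exp (y - y ^ 2 / 2) - 1 - y| ≤ 6 * |y| := by
    have := (E_sub_one y).2
    have h2 := abs_sub (Real.exp (y - y ^ 2 / 2) - 1) y
    linarith
  rcases le_total |y| 1 with h | h
  · have hw : |y - y ^ 2 / 2| ≤ 3 / 2 * |y| := by
      calc _ ≤ |y| + |y ^ 2 / 2| := abs_sub _ _
        _ = |y| + |y| ^ 2 / 2 := by rw [abs_div, abs_pow, abs_two]
        _ ≤ _ := by nlinarith [abs_nonneg y]
    have h3 := exp_taylor2 (y - y ^ 2 / 2)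
    have h4 : Real.exp |y - y ^ 2 / 2| ≤ 9 := by
      refine le_trans (Real.exp_le_exp.2 ?_) exp_two_le
      linarith
    have h5 : |Real.exp (y - y ^ 2 / 2) - 1 - y| ≤ 40 * |y| ^ 2 := by
      have e : Real.exp (y - y ^ 2 / 2) - 1 - y = (Real.exp (y - y ^ 2 / 2) - 1 - (y - y ^ 2 / 2)) - y ^ 2 / 2 := by ring
      rw [e]
      calc _ ≤ |Real.exp (y - y ^ 2 / 2) - 1 - (y - y ^ 2 / 2)| + |y ^ 2 / 2| := abs_sub _ _
        _ ≤ 9 * (3 / 2 * |y|) ^ 2 + |y| ^ 2 / 2 := by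
            rw [abs_div, abs_pow, abs_two]
            gcongr
            refine h3.trans ?_
            gcongr
        _ ≤ _ := by nlinarith [sq_nonneg (|y|)]
    exact pow_interp1 h0 h1 ht (by norm_num) (by linarith) h5
  · exact pow_interp1 h0 h1 ht (by norm_num) (by linarith) (by nlinarith)

/-! truncated exponentials -/

lemma exp_le_quad {w : ℝ} (h : |w| ≤ 1) : Real.exp w ≤ 1 + w + w ^ 2 := by
  have h1 := Real.abs_exp_sub_one_sub_id_le h
  rw [abs_le] at h1; linarith [h1.2]

lemma abs_rpow_ge_one {y ρ : ℝ} (hρ : 0 ≤ ρ) (h : 1 ≤ |y|) : y ^ 2 ≤ |y| ^ (2 + ρ) ∧ 1 ≤ |y| ^ (2 + ρ) := by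
  constructor
  · rw [← sq_abs, ← Real.rpow_natCast]
    exact Real.rpow_le_rpow_of_exponent_le h (by push_cast; linarith)
  · exact Real.one_le_rpow h (by linarith)

lemma trunc_sq {s : ℝ} (hs : |s| = 1) {ρ : ℝ} (h0 : 0 ≤ ρ) (h1 : ρ ≤ 1) (y : ℝ) :
    Real.exp (s * min (y ^ 2) 1) ≤ 1 + s * y ^ 2 + 4 * |y| ^ (2 + ρ) := by
  have ht := abs_nonneg y
  rcases le_total |y| 1 with h | h
  · have h2 : y ^ 2 ≤ 1 := by rw [← sq_abs]; nlinarith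
    rw [min_eq_left h2]
    have h3 : |s * y ^ 2| ≤ 1 := by
      rw [abs_mul, hs, one_mul, abs_of_nonneg (sq_nonneg y)]; exact h2
    have h4 := exp_le_quad h3
    have h5 : y ^ 4 ≤ 4 * |y| ^ (2 + ρ) := by
      have e : y ^ 4 = |y| ^ 4 := by rw [← abs_pow, abs_of_nonneg (by positivity)]
      rw [e]
      apply pow_interp2 h0 h1 ht (by norm_num)
      · have : |y| ^ 4 ≤ |y| ^ 2 := pow_le_pow_of_le_one ht h (by norm_num)
        nlinarith [sq_nonneg |y|]
      · have : |y| ^ 4 ≤ |y| ^ 3 := pow_le_pow_of_le_one ht h (by norm_num)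
        nlinarith [pow_nonneg ht 3]
    have h6 : s ^ 2 = 1 := by rw [← sq_abs, hs]; norm_num
    have h7 : (s * y ^ 2) ^ 2 = y ^ 4 := by rw [mul_pow, h6]; ring
    linarith
  · have h2 : 1 ≤ y ^ 2 := by rw [← sq_abs]; nlinarith
    rw [min_eq_right h2, mul_one]
    obtain ⟨h3, h4⟩ := abs_rpow_ge_one h0 h
    have h5 : s ≤ 1 := by rw [← hs]; exact le_abs_self s
    have h5' : -1 ≤ s := by rw [← hs]; exact neg_abs_le s
    have h6 : Real.exp s ≤ 3 := by
      refine (Real.exp_le_exp.2 h5).trans ?_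
      have := Real.exp_one_lt_d9; linarith
    nlinarith

lemma trunc_lin {ρ : ℝ} (h0 : 0 ≤ ρ) (h1 : ρ ≤ 1) (y : ℝ) :
    Real.exp (3 / 2 * (if |y| ≤ 1 then y else 0)) ≤ 1 + 3 / 2 * y + 9 / 8 * y ^ 2 + 31 * |y| ^ (2 + ρ) := by
  have ht := abs_nonneg y
  split_ifs with h
  · have h2 := exp_taylor3 (3 / 2 * y)
    have h3 : |3 / 2 * y| = 3 / 2 * |y| := by rw [abs_mul]; norm_num
    rw [h3] at h2
    have h4 : Real.exp (3 / 2 * |y|) ≤ 9 := by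
      refine le_trans (Real.exp_le_exp.2 ?_) exp_two_le
      linarith
    have h5 : Real.exp (3 / 2 * |y|) * (3 / 2 * |y|) ^ 3 ≤ 31 * |y| ^ 3 := by
      calc _ ≤ 9 * (3 / 2 * |y|) ^ 3 := by gcongr
        _ ≤ _ := by nlinarith [pow_nonneg ht 3]
    have h6 : |y| ^ 3 ≤ |y| ^ (2 + ρ) := by
      rw [← one_mul (|y| ^ (2 + ρ))]
      apply pow_interp2 h0 h1 ht (by norm_num) _ (by linarith)
      have : |y| ^ 3 ≤ |y| ^ 2 := pow_le_pow_of_le_one ht h (by norm_num)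
      linarith
    rw [abs_le] at h2
    linarith [h2.2]
  · push Not at h
    obtain ⟨h3, h4⟩ := abs_rpow_ge_one h0 h.le
    rw [mul_zero, Real.exp_zero]
    have : |y| ≤ y ^ 2 := by rw [← sq_abs]; nlinarith
    nlinarith [neg_abs_le y, sq_nonneg y]

lemma trunc_jump {ρ K : ℝ} (h0 : 0 ≤ ρ) (hK : 0 ≤ K) (y : ℝ) :
    Real.exp (K * (if |y| ≤ 1 then 0 else 1)) ≤ 1 + Real.exp K * |y| ^ (2 + ρ) := by
  split_ifs with h
  · rw [mul_zero, Real.exp_zero]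
    have : 0 ≤ Real.exp K * |y| ^ (2 + ρ) := by positivity
    linarith
  · push Not at h
    obtain ⟨h3, h4⟩ := abs_rpow_ge_one h0 h.le
    rw [mul_one]
    nlinarith [Real.exp_pos K]

end Cr


namespace Cr

/-- bounded measurable functions -/
def BM {Ω : Type} (m : MeasurableSpace Ω) (Y : Ω → ℝ) : Prop :=
  Measurable[m] Y ∧ ∃ C : ℝ, ∀ ω, |Y ω| ≤ C

namespace BM
variable {Ω : Type} {m m' : MeasurableSpace Ω} {Y Y' : Ω → ℝ}

lemma const (c : ℝ) : BM m (fun _ : Ω => c) := ⟨measurable_const, |c|, fun _ => le_rfl⟩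

lemma mul (h : BM m Y) (h' : BM m Y') : BM m (fun ω => Y ω * Y' ω) := by
  obtain ⟨a, C, hC⟩ := h
  obtain ⟨a', C', hC'⟩ := h'
  refine ⟨a.mul a', C * C', fun ω => ?_⟩
  rw [abs_mul]
  exact mul_le_mul (hC ω) (hC' ω) (abs_nonneg _) ((abs_nonneg _).trans (hC ω))

lemma add (h : BM m Y) (h' : BM m Y') : BM m (fun ω => Y ω + Y' ω) := by
  obtain ⟨a, C, hC⟩ := h
  obtain ⟨a', C', hC'⟩ := h'
  exact ⟨a.add a', C + C', fun ω => (abs_add_le _ _).trans (add_le_add (hC ω) (hC' ω))⟩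

lemma neg (h : BM m Y) : BM m (fun ω => - Y ω) := by
  obtain ⟨a, C, hC⟩ := h
  exact ⟨a.neg, C, fun ω => by rw [abs_neg]; exact hC ω⟩

lemma sub (h : BM m Y) (h' : BM m Y') : BM m (fun ω => Y ω - Y' ω) := by
  simpa [sub_eq_add_neg] using h.add h'.neg

lemma mono (h : BM m Y) (hm : m ≤ m') : BM m' Y := ⟨h.1.mono hm le_rfl, h.2⟩

lemma of_bdd (h : Measurable[m] Y) {C : ℝ} (h' : ∀ ω, |Y ω| ≤ C) : BM m Y := ⟨h, C, h'⟩

lemma integrable {mΩ : MeasurableSpace Ω} {P : Measure Ω} [IsFiniteMeasure P] (h : BM mΩ Y) : Integrable Y P := by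
  obtain ⟨a, C, hC⟩ := h
  exact Integrable.of_bound a.aestronglyMeasurable C (Eventually.of_forall fun ω => by
    rw [Real.norm_eq_abs]; exact hC ω)

lemma mul_integrable {mΩ : MeasurableSpace Ω} {P : Measure Ω} (h : BM mΩ Y) (h' : Integrable Y' P) :
    Integrable (fun ω => Y ω * Y' ω) P := by
  obtain ⟨a, C, hC⟩ := h
  exact h'.bdd_mul a.aestronglyMeasurable (Eventually.of_forall fun ω => by
    rw [Real.norm_eq_abs]; exact hC ω)

end BM

/-- normalised martingale difference data -/
structure Good {Ω : Type} [mΩ : MeasurableSpace Ω] (P : Measure Ω) (F : ℕ → MeasurableSpace Ω) (n : ℕ)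
    (X v : ℕ → Ω → ℝ) (ρ γ δ : ℝ) : Prop where
  mono : Monotone F
  le : ∀ i, F i ≤ mΩ
  Xm : ∀ i, Measurable[F (i + 1)] (X i)
  vm : ∀ i, Measurable[F i] (v i)
  v0 : ∀ i ω, 0 ≤ v i ω
  vle : ∀ i ω, v i ω ≤ γ ^ 2
  int : ∀ i, Integrable (fun ω => |X i ω| ^ (2 + ρ)) P
  e1 : ∀ i Y, BM (F i) Y → ∫ ω, Y ω * X i ω ∂P = 0
  e2 : ∀ i Y, BM (F i) Y → ∫ ω, Y ω * X i ω ^ 2 ∂P = ∫ ω, Y ω * v i ω ∂P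
  e3 : ∀ i Y, BM (F i) Y → (∀ ω, 0 ≤ Y ω) →
    ∫ ω, Y ω * |X i ω| ^ (2 + ρ) ∂P ≤ γ ^ ρ * ∫ ω, Y ω * v i ω ∂P
  sum : ∀ᵐ ω ∂P, |(∑ i ∈ Finset.range n, v i ω) - 1| ≤ δ ^ 2
  ρ0 : 0 < ρ
  ρ1 : ρ ≤ 1
  γ0 : 0 < γ
  γ1 : γ ≤ 1 / 4
  δ0 : 0 ≤ δ
  δ1 : δ ≤ 1 / 4

namespace Good

variable {Ω : Type} [mΩ : MeasurableSpace Ω] {P : Measure Ω} [IsProbabilityMeasure P]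
  {F : ℕ → MeasurableSpace Ω} {n : ℕ} {X v : ℕ → Ω → ℝ} {ρ γ δ : ℝ}

lemma neg (g : Good P F n X v ρ γ δ) : Good P F n (fun i ω => - X i ω) v ρ γ δ where
  mono := g.mono
  le := g.le
  Xm i := (g.Xm i).neg
  vm := g.vm
  v0 := g.v0
  vle := g.vle
  int i := by simpa using g.int i
  e1 i Y hY := by
    have := g.e1 i Y hY
    simp only [mul_neg, integral_neg, this, neg_zero]
  e2 i Y hY := by simpa using g.e2 i Y hY
  e3 i Y hY h := by simpa using g.e3 i Y hY h
  sum := g.sum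
  ρ0 := g.ρ0
  ρ1 := g.ρ1
  γ0 := g.γ0
  γ1 := g.γ1
  δ0 := g.δ0
  δ1 := g.δ1

lemma Xmeas (g : Good P F n X v ρ γ δ) (i : ℕ) : Measurable (X i) := (g.Xm i).mono (g.le _) le_rfl

lemma vBM (g : Good P F n X v ρ γ δ) (i : ℕ) : BM (F i) (v i) :=
  ⟨g.vm i, γ ^ 2, fun ω => by rw [abs_of_nonneg (g.v0 i ω)]; exact g.vle i ω⟩

lemma int_dom (g : Good P F n X v ρ γ δ) (i : ℕ) {G : Ω → ℝ} (hG : Measurable G) {C : ℝ}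
    (hb : ∀ ω, |G ω| ≤ C * (1 + |X i ω| ^ (2 + ρ))) : Integrable G P := by
  have : Integrable (fun ω => C * (1 + |X i ω| ^ (2 + ρ))) P :=
    ((integrable_const 1).add (g.int i)).const_mul C
  refine this.mono' hG.aestronglyMeasurable (Eventually.of_forall fun ω => ?_)
  rw [Real.norm_eq_abs]; exact hb ω

lemma poly_le (g : Good P F n X v ρ γ δ) (y : ℝ) : |y| ≤ 1 + |y| ^ (2 + ρ) ∧ y ^ 2 ≤ 1 + |y| ^ (2 + ρ) := by
  have h0 : 0 ≤ |y| ^ (2 + ρ) := by positivity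
  rcases le_total |y| 1 with h | h
  · have : y ^ 2 ≤ 1 := by rw [← sq_abs]; nlinarith [abs_nonneg y]
    constructor <;> linarith
  · obtain ⟨h1, h2⟩ := abs_rpow_ge_one g.ρ0.le h
    have : |y| ≤ y ^ 2 := by rw [← sq_abs]; nlinarith
    constructor <;> linarith

lemma intX (g : Good P F n X v ρ γ δ) (i : ℕ) : Integrable (X i) P :=
  g.int_dom i (g.Xmeas i) (C := 1) fun ω => by rw [one_mul]; exact (g.poly_le _).1

lemma intX2 (g : Good P F n X v ρ γ δ) (i : ℕ) : Integrable (fun ω => X i ω ^ 2) P :=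
  g.int_dom i ((g.Xmeas i).pow_const 2) (C := 1) fun ω => by
    rw [one_mul, abs_of_nonneg (sq_nonneg _)]; exact (g.poly_le _).2

lemma gr_pos (g : Good P F n X v ρ γ δ) : 0 < γ ^ ρ := Real.rpow_pos_of_pos g.γ0 _

lemma gr_le (g : Good P F n X v ρ γ δ) : γ ^ ρ ≤ 1 :=
  Real.rpow_le_one g.γ0.le (by linarith [g.γ1]) g.ρ0.le

/-- polynomial integral identity -/
lemma quad_int (g : Good P F n X v ρ γ δ) (i : ℕ) {Y : Ω → ℝ} (hY : BM (F i) Y) (α β κ : ℝ) :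
    Integrable (fun ω => Y ω * (1 + α * X i ω + β * X i ω ^ 2 + κ * |X i ω| ^ (2 + ρ))) P ∧
    ∫ ω, Y ω * (1 + α * X i ω + β * X i ω ^ 2 + κ * |X i ω| ^ (2 + ρ)) ∂P
     = ∫ ω, Y ω * (1 + β * v i ω) ∂P + κ * ∫ ω, Y ω * |X i ω| ^ (2 + ρ) ∂P := by
  have hY' := hY.mono (g.le i)
  have i0 := hY'.integrable (P := P)
  have i1 := hY'.mul_integrable (g.intX i)
  have i2 := hY'.mul_integrable (g.intX2 i)
  have i3 := hY'.mul_integrable (g.int i)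
  have iv := (hY.mul (g.vBM i)).mono (g.le i) |>.integrable (P := P)
  have e : (fun ω => Y ω * (1 + α * X i ω + β * X i ω ^ 2 + κ * |X i ω| ^ (2 + ρ)))
      = fun ω => Y ω + α * (Y ω * X i ω) + β * (Y ω * X i ω ^ 2) + κ * (Y ω * |X i ω| ^ (2 + ρ)) := by
    ext ω; ring
  have e' : (fun ω => Y ω * (1 + β * v i ω)) = fun ω => Y ω + β * (Y ω * v i ω) := by
    ext ω; ring
  rw [e, e']
  have j1 : Integrable (fun ω => Y ω + α * (Y ω * X i ω)) P := i0.add (i1.const_mul α)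
  have j2 : Integrable (fun ω => Y ω + α * (Y ω * X i ω) + β * (Y ω * X i ω ^ 2)) P := j1.add (i2.const_mul β)
  refine ⟨j2.add (i3.const_mul κ), ?_⟩
  rw [integral_add j2 (i3.const_mul κ), integral_add j1 (i2.const_mul β),
    integral_add i0 (i1.const_mul α), integral_add i0 (iv.const_mul β)]
  simp only [integral_const_mul]
  rw [g.e1 i Y hY, g.e2 i Y hY]; ring

lemma expBM (g : Good P F n X v ρ γ δ) {f : ℝ → ℝ} (hf : Measurable f) {B : ℝ} (hB : ∀ y, f y ≤ B) (c : ℝ) (m : ℕ) :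
    BM (F m) (fun ω => Real.exp (∑ i ∈ Finset.range m, (f (X i ω) - c * v i ω))) := by
  constructor
  · apply Real.measurable_exp.comp
    apply Finset.measurable_sum
    intro i hi
    have hi' := Finset.mem_range.1 hi
    exact (hf.comp ((g.Xm i).mono (g.mono hi') le_rfl)).sub
      (((g.vm i).mono (g.mono hi'.le) le_rfl).const_mul c)
  · refine ⟨Real.exp (∑ i ∈ Finset.range m, (B + |c| * γ ^ 2)), fun ω => ?_⟩
    rw [abs_of_pos (Real.exp_pos _)]
    apply Real.exp_le_exp.2
    apply Finset.sum_le_sum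
    intro i _
    have h1 := hB (X i ω)
    have h2 : -c * v i ω ≤ |c| * γ ^ 2 :=
      mul_le_mul (neg_le_abs c) (g.vle i ω) (g.v0 i ω) (abs_nonneg c)
    linarith

/-- general exponential upper bound -/
lemma gl_upper (g : Good P F n X v ρ γ δ) {f : ℝ → ℝ} (hf : Measurable f) {B : ℝ} (hB : ∀ y, f y ≤ B)
    {α β κ : ℝ} (hκ : 0 ≤ κ)
    (h : ∀ y, Real.exp (f y) ≤ 1 + α * y + β * y ^ 2 + κ * |y| ^ (2 + ρ)) (m : ℕ) :
    ∫ ω, Real.exp (∑ i ∈ Finset.range m, (f (X i ω) - (β + κ * γ ^ ρ) * v i ω)) ∂P ≤ 1 := by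
  induction m with
  | zero => simp
  | succ m ih =>
    set c := β + κ * γ ^ ρ with hc
    refine le_trans ?_ ih
    have hY := g.expBM hf hB c m
    set Y := fun ω => Real.exp (∑ i ∈ Finset.range m, (f (X i ω) - c * v i ω)) with hYdef
    have hV : BM (F m) (fun ω => Real.exp (-c * v m ω)) := by
      refine ⟨Real.measurable_exp.comp ((g.vm m).const_mul _), Real.exp (|c| * γ ^ 2), fun ω => ?_⟩
      rw [abs_of_pos (Real.exp_pos _)]
      apply Real.exp_le_exp.2
      exact mul_le_mul (neg_le_abs c) (g.vle m ω) (g.v0 m ω) (abs_nonneg c)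
    have hY2 := hY.mul hV
    obtain ⟨q1, q2⟩ := g.quad_int m hY2 α β κ
    have p0 : ∀ ω, 0 ≤ Y ω * Real.exp (-c * v m ω) := fun ω => by positivity
    calc ∫ ω, Real.exp (∑ i ∈ Finset.range (m + 1), (f (X i ω) - c * v i ω)) ∂P
        ≤ ∫ ω, Y ω * Real.exp (-c * v m ω) * (1 + α * X m ω + β * X m ω ^ 2 + κ * |X m ω| ^ (2 + ρ)) ∂P := by
          apply integral_mono (((g.expBM hf hB c (m+1)).mono (g.le _)).integrable) q1
          intro ω
          simp only
          rw [Finset.sum_range_succ, Real.exp_add, sub_eq_add_neg, Real.exp_add, ← neg_mul,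
            mul_comm (Real.exp (f (X m ω))), ← mul_assoc]
          exact mul_le_mul_of_nonneg_left (h _) (p0 ω)
      _ = _ := q2
      _ ≤ ∫ ω, Y ω * Real.exp (-c * v m ω) * (1 + β * v m ω) ∂P +
            κ * (γ ^ ρ * ∫ ω, Y ω * Real.exp (-c * v m ω) * v m ω ∂P) := by
          have := mul_le_mul_of_nonneg_left (g.e3 m _ hY2 p0) hκ
          linarith
      _ = ∫ ω, Y ω * Real.exp (-c * v m ω) * (1 + c * v m ω) ∂P := by
          rw [← mul_assoc, ← integral_const_mul, ← integral_add]
          · congr 1; ext ω; rw [hc]; ring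
          · exact ((hY2.mul ((BM.const 1).add ((BM.const β).mul (g.vBM m)))).mono (g.le m)).integrable
          · exact ((hY2.mul (g.vBM m)).mono (g.le m)).integrable.const_mul _
      _ ≤ ∫ ω, Y ω ∂P := by
          apply integral_mono
          · exact ((hY2.mul ((BM.const 1).add ((BM.const c).mul (g.vBM m)))).mono (g.le m)).integrable
          · exact (hY.mono (g.le m)).integrable
          · intro ω
            simp only
            have h1 := Real.add_one_le_exp (c * v m ω)
            calc Y ω * Real.exp (-c * v m ω) * (1 + c * v m ω)
                ≤ Y ω * Real.exp (-c * v m ω) * Real.exp (c * v m ω) :=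
                  mul_le_mul_of_nonneg_left (by linarith) (p0 ω)
              _ = Y ω := by rw [mul_assoc, ← Real.exp_add]; simp

/-- general exponential lower bound -/
lemma gl_lower (g : Good P F n X v ρ γ δ) {f : ℝ → ℝ} (hf : Measurable f) {B : ℝ} (hB : ∀ y, f y ≤ B)
    {α β κ c : ℝ} (hκ : 0 ≤ κ)
    (h : ∀ y, 1 + α * y + β * y ^ 2 - κ * |y| ^ (2 + ρ) ≤ Real.exp (f y))
    (hc : ∀ w, 0 ≤ w → w ≤ γ ^ 2 → Real.exp (c * w) ≤ 1 + (β - κ * γ ^ ρ) * w) (m : ℕ) :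
    1 ≤ ∫ ω, Real.exp (∑ i ∈ Finset.range m, (f (X i ω) - c * v i ω)) ∂P := by
  induction m with
  | zero => simp
  | succ m ih =>
    refine ih.trans ?_
    have hY := g.expBM hf hB c m
    set Y := fun ω => Real.exp (∑ i ∈ Finset.range m, (f (X i ω) - c * v i ω)) with hYdef
    have hV : BM (F m) (fun ω => Real.exp (-c * v m ω)) := by
      refine ⟨Real.measurable_exp.comp ((g.vm m).const_mul _), Real.exp (|c| * γ ^ 2), fun ω => ?_⟩
      rw [abs_of_pos (Real.exp_pos _)]
      apply Real.exp_le_exp.2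
      exact mul_le_mul (neg_le_abs c) (g.vle m ω) (g.v0 m ω) (abs_nonneg c)
    have hY2 := hY.mul hV
    obtain ⟨q1, q2⟩ := g.quad_int m hY2 α β (-κ)
    have p0 : ∀ ω, 0 ≤ Y ω * Real.exp (-c * v m ω) := fun ω => by positivity
    calc ∫ ω, Y ω ∂P ≤ ∫ ω, Y ω * Real.exp (-c * v m ω) * (1 + (β - κ * γ ^ ρ) * v m ω) ∂P := by
          apply integral_mono
          · exact (hY.mono (g.le m)).integrable
          · exact ((hY2.mul ((BM.const 1).add ((BM.const (β - κ * γ ^ ρ)).mul (g.vBM m)))).mono (g.le m)).integrable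
          · intro ω
            simp only
            have h1 := hc (v m ω) (g.v0 m ω) (g.vle m ω)
            calc Y ω = Y ω * Real.exp (-c * v m ω) * Real.exp (c * v m ω) := by
                  rw [mul_assoc, ← Real.exp_add]; simp
              _ ≤ _ := mul_le_mul_of_nonneg_left h1 (p0 ω)
      _ = ∫ ω, Y ω * Real.exp (-c * v m ω) * (1 + β * v m ω) ∂P +
            (-κ) * (γ ^ ρ * ∫ ω, Y ω * Real.exp (-c * v m ω) * v m ω ∂P) := by
          rw [← mul_assoc, ← integral_const_mul, ← integral_add]
          · congr 1; ext ω; ring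
          · exact ((hY2.mul ((BM.const 1).add ((BM.const β).mul (g.vBM m)))).mono (g.le m)).integrable
          · exact ((hY2.mul (g.vBM m)).mono (g.le m)).integrable.const_mul _
      _ ≤ ∫ ω, Y ω * Real.exp (-c * v m ω) * (1 + β * v m ω) ∂P +
            (-κ) * ∫ ω, Y ω * Real.exp (-c * v m ω) * |X m ω| ^ (2 + ρ) ∂P := by
          have := mul_le_mul_of_nonneg_left (g.e3 m _ hY2 p0) hκ
          linarith
      _ = _ := q2.symm
      _ ≤ ∫ ω, Real.exp (∑ i ∈ Finset.range (m + 1), (f (X i ω) - c * v i ω)) ∂P := by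
          apply integral_mono q1 (((g.expBM hf hB c (m+1)).mono (g.le _)).integrable)
          intro ω
          simp only
          rw [Finset.sum_range_succ, Real.exp_add, sub_eq_add_neg (f (X m ω)), Real.exp_add, ← neg_mul,
            mul_comm (Real.exp (f (X m ω))), ← mul_assoc]
          apply mul_le_mul_of_nonneg_left _ (p0 ω)
          have := h (X m ω); linarith

end Good
end Cr


namespace Cr

lemma rpow_mix {p s ρ : ℝ} (hp : 0 ≤ p) (hs : 0 ≤ s) (h0 : 0 < ρ) :
    p ^ ρ * s ^ 2 ≤ p ^ (2 + ρ) + s ^ (2 + ρ) ∧ p ^ ρ * p ^ 2 ≤ p ^ (2 + ρ) + s ^ (2 + ρ)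
      ∧ s ^ ρ * s ^ 2 ≤ p ^ (2 + ρ) + s ^ (2 + ρ) := by
  have e : ∀ q : ℝ, 0 ≤ q → q ^ (2 + ρ) = q ^ ρ * q ^ 2 := by
    intro q hq
    rcases hq.eq_or_lt with h | h
    · rw [← h, Real.zero_rpow (by linarith)]; simp
    · rw [add_comm, Real.rpow_add h]; norm_num
  have p1 : 0 ≤ p ^ (2 + ρ) := by positivity
  have p2 : 0 ≤ s ^ (2 + ρ) := by positivity
  refine ⟨?_, by rw [← e p hp]; linarith, by rw [← e s hs]; linarith⟩
  rcases le_total p s with h | h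
  · have : p ^ ρ * s ^ 2 ≤ s ^ ρ * s ^ 2 :=
      mul_le_mul_of_nonneg_right (Real.rpow_le_rpow hp h h0.le) (by positivity)
    rw [← e s hs] at this; linarith
  · have : p ^ ρ * s ^ 2 ≤ p ^ ρ * p ^ 2 :=
      mul_le_mul_of_nonneg_left (pow_le_pow_left₀ hs h 2) (by positivity)
    rw [← e p hp] at this; linarith

lemma rpow_add_le' {a b ρ : ℝ} (ha : 0 ≤ a) (hb : 0 ≤ b) (h0 : 0 < ρ) (h1 : ρ ≤ 1) :
    (a + b) ^ (2 + ρ) ≤ 8 * (a ^ (2 + ρ) + b ^ (2 + ρ)) := by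
  have key : ∀ c : ℝ, 0 ≤ c → (2 * c) ^ (2 + ρ) ≤ 8 * c ^ (2 + ρ) := by
    intro c hc
    rw [Real.mul_rpow (by norm_num) hc]
    apply mul_le_mul_of_nonneg_right _ (by positivity)
    calc (2:ℝ) ^ (2 + ρ) ≤ 2 ^ (3:ℝ) := Real.rpow_le_rpow_of_exponent_le (by norm_num) (by linarith)
      _ = 8 := by norm_num
  have p1 : 0 ≤ a ^ (2 + ρ) := by positivity
  have p2 : 0 ≤ b ^ (2 + ρ) := by positivity
  rcases le_total a b with h | h
  · have : (a + b) ^ (2 + ρ) ≤ (2 * b) ^ (2 + ρ) := Real.rpow_le_rpow (by linarith) (by linarith) (by linarith)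
    linarith [key b hb]
  · have : (a + b) ^ (2 + ρ) ≤ (2 * a) ^ (2 + ρ) := Real.rpow_le_rpow (by linarith) (by linarith) (by linarith)
    linarith [key a ha]

set_option maxHeartbeats 800000 in
/-- the three moments bounds for the increment -/
lemma incr_bounds {ρ x X σ : ℝ} (h0 : 0 < ρ) (h1 : ρ ≤ 1) (hx : 0 ≤ x) (hσ : 0 ≤ σ) (hxσ : x * σ ≤ 1) :
    let E := Real.exp (x * X - (x * X) ^ 2 / 2)
    let m := X - x / 2 * (X ^ 2 + σ ^ 2)
    let H := |X| ^ (2 + ρ) + σ ^ (2 + ρ)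
    E * |m| ^ (2 + ρ) ≤ 2400 * H ∧
    |E * m - X - x / 2 * (X ^ 2 - σ ^ 2)| ≤ 60 * (x ^ (1 + ρ) * H) ∧
    |E * m ^ 2 - X ^ 2| ≤ 1000 * (x ^ ρ * H) := by
  intro E m H
  have hp : 0 ≤ |X| := abs_nonneg X
  obtain ⟨m1, m2, m3⟩ := rpow_mix hp hσ h0
  set t := |x * X| with ht
  have htp : t = x * |X| := by rw [ht, abs_mul, abs_of_nonneg hx]
  have ht0 : 0 ≤ t := abs_nonneg _
  have hE0 : 0 < E := Real.exp_pos _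
  have hE2 : E ≤ 2 := E_le _
  have hE3 := E_cube (x * X)
  have hE1 := E_sub_one_rho h0 h1 (x * X)
  have hEf := E_first (x * X) h0.le h1
  have hEp := E_mul_pow h0 h1 (x * X)
  rw [← ht] at hE3 hE1 hEf hEp
  have q1 : 0 ≤ |X| ^ (2 + ρ) := by positivity
  have q2 : 0 ≤ σ ^ (2 + ρ) := by positivity
  have hH0 : 0 ≤ H := add_nonneg q1 q2
  have tr : t ^ ρ = x ^ ρ * |X| ^ ρ := by rw [htp, Real.mul_rpow hx hp]
  have tr1 : t ^ (1 + ρ) = x ^ (1 + ρ) * |X| ^ (1 + ρ) := by rw [htp, Real.mul_rpow hx hp]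
  have xr : 0 ≤ x ^ ρ := by positivity
  have xr1 : 0 ≤ x ^ (1 + ρ) := by positivity
  have xx : x ^ (1 + ρ) = x * x ^ ρ := by
    rcases hx.eq_or_lt with h | h
    · rw [← h, Real.zero_rpow (by linarith)]; simp
    · rw [Real.rpow_add h, Real.rpow_one]
  have pp : |X| * |X| ^ (1 + ρ) = |X| ^ (2 + ρ) := by
    rcases hp.eq_or_lt with h | h
    · rw [← h, Real.zero_rpow (by linarith), Real.zero_rpow (by linarith)]; simp
    · rw [← Real.rpow_one_add' h.le (by linarith)]; congr 1; ring
  have sqX : X ^ 2 = |X| ^ 2 := (sq_abs X).symm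
  refine ⟨?_, ?_, ?_⟩
  · have hm : |m| ≤ |X| * (1 + t) + σ := by
      calc |m| ≤ |X| + |x / 2 * (X ^ 2 + σ ^ 2)| := abs_sub _ _
        _ = |X| + x / 2 * (|X| ^ 2 + σ ^ 2) := by
            rw [abs_of_nonneg (a := x / 2 * (X ^ 2 + σ ^ 2)) (by positivity), sqX]
        _ ≤ _ := by rw [htp]; nlinarith [mul_nonneg hx (sq_nonneg |X|), mul_nonneg hx hσ]
    have h2 : |m| ^ (2 + ρ) ≤ 8 * ((|X| * (1 + t)) ^ (2 + ρ) + σ ^ (2 + ρ)) :=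
      (Real.rpow_le_rpow (abs_nonneg m) hm (by linarith)).trans (rpow_add_le' (by positivity) hσ h0 h1)
    have h3 : E * (|X| * (1 + t)) ^ (2 + ρ) ≤ 300 * |X| ^ (2 + ρ) := by
      rw [Real.mul_rpow hp (by positivity)]
      have h4 : (1 + t) ^ (2 + ρ) ≤ (1 + t) ^ 3 := by
        rw [← Real.rpow_natCast]
        exact Real.rpow_le_rpow_of_exponent_le (by linarith) (by push_cast; linarith)
      have h5 : (1 + t) ^ (2 + ρ) * E ≤ 300 := (mul_le_mul_of_nonneg_right h4 hE0.le).trans hE3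
      calc _ = ((1 + t) ^ (2 + ρ) * E) * |X| ^ (2 + ρ) := by ring
        _ ≤ _ := mul_le_mul_of_nonneg_right h5 q1
    calc E * |m| ^ (2 + ρ) ≤ E * (8 * ((|X| * (1 + t)) ^ (2 + ρ) + σ ^ (2 + ρ))) :=
          mul_le_mul_of_nonneg_left h2 hE0.le
      _ = 8 * (E * (|X| * (1 + t)) ^ (2 + ρ)) + 8 * (E * σ ^ (2 + ρ)) := by ring
      _ ≤ 8 * (300 * |X| ^ (2 + ρ)) + 8 * (2 * σ ^ (2 + ρ)) := by
          have := mul_le_mul_of_nonneg_right hE2 q2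
          linarith
      _ ≤ 2400 * (|X| ^ (2 + ρ) + σ ^ (2 + ρ)) := by linarith
  · have e : E * m - X - x / 2 * (X ^ 2 - σ ^ 2)
        = X * (E - 1 - x * X) - x / 2 * ((E - 1) * (X ^ 2 + σ ^ 2)) := by simp only [m]; ring
    rw [e]
    have b1 : |X * (E - 1 - x * X)| ≤ 40 * (x ^ (1 + ρ) * H) := by
      rw [abs_mul]
      calc |X| * |E - 1 - x * X| ≤ |X| * (40 * t ^ (1 + ρ)) := mul_le_mul_of_nonneg_left hEf hp
        _ = 40 * (x ^ (1 + ρ) * (|X| * |X| ^ (1 + ρ))) := by rw [tr1]; ring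
        _ ≤ 40 * (x ^ (1 + ρ) * H) := by
            rw [pp]; gcongr; simp only [H]; linarith
    have b2 : |x / 2 * ((E - 1) * (X ^ 2 + σ ^ 2))| ≤ 5 * (x ^ (1 + ρ) * H) := by
      rw [abs_mul, abs_mul, abs_of_nonneg (by linarith : 0 ≤ x / 2), abs_of_nonneg (by positivity : 0 ≤ X ^ 2 + σ ^ 2), sqX]
      calc x / 2 * (|E - 1| * (|X| ^ 2 + σ ^ 2)) ≤ x / 2 * ((5 * t ^ ρ) * (|X| ^ 2 + σ ^ 2)) := by gcongr
        _ = 5 / 2 * (x ^ (1 + ρ) * (|X| ^ ρ * |X| ^ 2 + |X| ^ ρ * σ ^ 2)) := by rw [tr, xx]; ring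
        _ ≤ 5 / 2 * (x ^ (1 + ρ) * (H + H)) := by
            gcongr
        _ = _ := by ring
    have := abs_sub (X * (E - 1 - x * X)) (x / 2 * ((E - 1) * (X ^ 2 + σ ^ 2)))
    have h9 : 0 ≤ x ^ (1 + ρ) * H := by positivity
    linarith
  · have e : E * m ^ 2 - X ^ 2 = (E - 1) * X ^ 2 - E * (x * X) * (X ^ 2 + σ ^ 2)
        + E * (x ^ 2 / 4 * (X ^ 2 + σ ^ 2) ^ 2) := by simp only [m]; ring
    rw [e]
    have hQ : 0 ≤ x ^ ρ * H := by positivity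
    have b1 : |(E - 1) * X ^ 2| ≤ 5 * (x ^ ρ * H) := by
      rw [abs_mul, abs_of_nonneg (sq_nonneg X), sqX]
      calc |E - 1| * |X| ^ 2 ≤ 5 * t ^ ρ * |X| ^ 2 := by gcongr
        _ = 5 * (x ^ ρ * (|X| ^ ρ * |X| ^ 2)) := by rw [tr]; ring
        _ ≤ _ := by gcongr
    have hEt0 : 0 ≤ E * t := mul_nonneg hE0.le ht0
    have hEt3 : 0 ≤ E * t ^ 2 := mul_nonneg hE0.le (sq_nonneg t)
    have hEp' : E * t + E * t ^ 2 ≤ 300 * t ^ ρ := by rw [← mul_add]; exact hEp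
    have hEt : E * t ≤ 300 * t ^ ρ := by linarith
    have hEt2 : E * t ^ 2 ≤ 300 * t ^ ρ := by linarith
    have b2 : |E * (x * X) * (X ^ 2 + σ ^ 2)| ≤ 600 * (x ^ ρ * H) := by
      rw [abs_mul, abs_mul, abs_of_pos hE0, ← ht, abs_of_nonneg (by positivity : 0 ≤ X ^ 2 + σ ^ 2), sqX]
      calc E * t * (|X| ^ 2 + σ ^ 2) ≤ 300 * t ^ ρ * (|X| ^ 2 + σ ^ 2) := by gcongr
        _ = 300 * (x ^ ρ * (|X| ^ ρ * |X| ^ 2 + |X| ^ ρ * σ ^ 2)) := by rw [tr]; ring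
        _ ≤ 300 * (x ^ ρ * (H + H)) := by gcongr
        _ = _ := by ring
    have b3 : |E * (x ^ 2 / 4 * (X ^ 2 + σ ^ 2) ^ 2)| ≤ 151 * (x ^ ρ * H) := by
      rw [abs_of_nonneg (by positivity), sqX]
      have s2 : (x * σ) ^ 2 ≤ (x * σ) ^ ρ := by
        rw [← Real.rpow_natCast]
        rcases (mul_nonneg hx hσ).eq_or_lt with h | h
        · rw [← h, Real.zero_rpow (by norm_num), Real.zero_rpow h0.ne']
        · exact Real.rpow_le_rpow_of_exponent_ge h hxσ (by push_cast; linarith)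
      have s3 : (x * σ) ^ ρ = x ^ ρ * σ ^ ρ := Real.mul_rpow hx hσ
      calc E * (x ^ 2 / 4 * (|X| ^ 2 + σ ^ 2) ^ 2)
          ≤ E * (x ^ 2 / 2 * ((|X| ^ 2) ^ 2 + (σ ^ 2) ^ 2)) := by
            apply mul_le_mul_of_nonneg_left _ hE0.le
            have := mul_nonneg (sq_nonneg x) (sq_nonneg (|X| ^ 2 - σ ^ 2))
            linear_combination this / 4
        _ = (E * t ^ 2) * |X| ^ 2 / 2 + E * ((x * σ) ^ 2 * σ ^ 2) / 2 := by rw [htp]; ring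
        _ ≤ (300 * t ^ ρ) * |X| ^ 2 / 2 + 2 * ((x * σ) ^ ρ * σ ^ 2) / 2 := by gcongr
        _ = 150 * (x ^ ρ * (|X| ^ ρ * |X| ^ 2)) + x ^ ρ * (σ ^ ρ * σ ^ 2) := by rw [tr, s3]; ring
        _ ≤ 150 * (x ^ ρ * H) + x ^ ρ * H := by gcongr
        _ = _ := by ring
    have a1 := abs_add_le ((E - 1) * X ^ 2 - E * (x * X) * (X ^ 2 + σ ^ 2)) (E * (x ^ 2 / 4 * (X ^ 2 + σ ^ 2) ^ 2))
    have a2 := abs_sub ((E - 1) * X ^ 2) (E * (x * X) * (X ^ 2 + σ ^ 2))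
    linarith

lemma mixed_powers {ρ x s : ℝ} (h0 : 0 < ρ) (h1 : ρ ≤ 1) (hx : 0 ≤ x) (hs : 0 < s) :
    x ^ ρ / s ^ 2 ≤ (1 + x) ^ (1 + ρ) / s + (1 / s) ^ (2 + ρ) ∧
    (1 / s) ^ (2 + ρ) ≤ (1 + x) ^ (1 + ρ) / s + 1 / s ^ 3 ∧ x ^ (1 + ρ) / s ≤ (1 + x) ^ (1 + ρ) / s := by
  have hle : x ^ (1 + ρ) ≤ (1 + x) ^ (1 + ρ) := Real.rpow_le_rpow hx (by linarith) (by linarith)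
  have h3 : x ^ (1 + ρ) / s ≤ (1 + x) ^ (1 + ρ) / s := by gcongr
  have hone : 1 ≤ (1 + x) ^ (1 + ρ) := Real.one_le_rpow (by linarith) (by linarith)
  have xx : x ^ (1 + ρ) = x * x ^ ρ := by
    rw [Real.rpow_one_add' hx (by linarith)]
  have hu : 0 < 1 / s := by positivity
  have p1 : 0 ≤ (1 / s) ^ (2 + ρ) := by positivity
  have xr : 0 ≤ x ^ ρ := by positivity
  refine ⟨?_, ?_, h3⟩
  · rcases le_total 1 (x * s) with h | h
    · have : x ^ ρ / s ^ 2 ≤ x ^ (1 + ρ) / s := by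
        rw [xx, div_le_div_iff₀ (by positivity) hs]
        nlinarith [mul_nonneg xr hs.le, mul_nonneg (mul_nonneg xr hs.le) (sub_nonneg.2 h)]
      linarith
    · have hx1 : x ≤ 1 / s := by rw [le_div_iff₀ hs]; exact h
      have : x ^ ρ / s ^ 2 ≤ (1 / s) ^ (2 + ρ) := by
        rw [add_comm, Real.rpow_add hu, div_eq_mul_one_div]
        have e : (1 / s) ^ (2:ℝ) = 1 / s ^ 2 := by
          rw [show (2:ℝ) = ((2:ℕ):ℝ) by norm_num, Real.rpow_natCast, one_div_pow]
        rw [e]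
        gcongr
      have : 0 ≤ (1 + x) ^ (1 + ρ) / s := by positivity
      linarith
  · have h4 : 1 / s ≤ (1 + x) ^ (1 + ρ) / s := by gcongr
    rcases le_total 1 (1 / s) with h | h
    · have : (1 / s) ^ (2 + ρ) ≤ (1 / s) ^ (3:ℝ) := Real.rpow_le_rpow_of_exponent_le h (by linarith)
      rw [show (3:ℝ) = ((3:ℕ):ℝ) by norm_num, Real.rpow_natCast, one_div_pow] at this
      have : 0 ≤ (1 + x) ^ (1 + ρ) / s := by positivity
      linarith
    · have : (1 / s) ^ (2 + ρ) ≤ (1 / s) ^ (1:ℝ) := Real.rpow_le_rpow_of_exponent_ge hu h (by linarith)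
      rw [Real.rpow_one] at this
      have : 0 ≤ 1 / s ^ 3 := by positivity
      linarith

/-- pointwise Lindeberg estimate -/
lemma lind_point {ρ x X σ s z : ℝ} (h0 : 0 < ρ) (h1 : ρ ≤ 1) (hx : 0 ≤ x) (hσ : 0 ≤ σ) (hxσ : x * σ ≤ 1)
    (hs : 0 < s) :
    |Real.exp (x * X - (x * X) ^ 2 / 2) *
        (stdNormalCDF (z + (X - x / 2 * (X ^ 2 + σ ^ 2)) / s) - stdNormalCDF z)
      - phi z / s * (X + x / 2 * (X ^ 2 - σ ^ 2)) + z * phi z / (2 * s ^ 2) * X ^ 2|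
    ≤ 20000 * ((1 + x) ^ (1 + ρ) / s + 1 / s ^ 3) * (|X| ^ (2 + ρ) + σ ^ (2 + ρ)) := by
  obtain ⟨b1, b2, b3⟩ := incr_bounds (X := X) h0 h1 hx hσ hxσ
  obtain ⟨c1, c2, c3⟩ := mixed_powers h0 h1 hx hs
  set E := Real.exp (x * X - (x * X) ^ 2 / 2) with hE
  set m := X - x / 2 * (X ^ 2 + σ ^ 2) with hm
  set H := |X| ^ (2 + ρ) + σ ^ (2 + ρ) with hH
  have hE0 : 0 < E := Real.exp_pos _
  have hH0 : 0 ≤ H := by positivity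
  have ta := taylor_rho h0.le h1 z (m / s)
  set T := stdNormalCDF (z + m / s) - stdNormalCDF z - phi z * (m / s) + z * phi z * (m / s) ^ 2 / 2 with hT
  have e : E * (stdNormalCDF (z + m / s) - stdNormalCDF z)
      - phi z / s * (X + x / 2 * (X ^ 2 - σ ^ 2)) + z * phi z / (2 * s ^ 2) * X ^ 2
      = E * T + phi z * ((E * m - X - x / 2 * (X ^ 2 - σ ^ 2)) / s)
        - z * phi z * ((E * m ^ 2 - X ^ 2) / (2 * s ^ 2)) := by
    rw [hT]; field_simp; ring
  rw [e]
  have d1 : |E * T| ≤ 4800 * ((1 / s) ^ (2 + ρ) * H) := by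
    rw [abs_mul, abs_of_pos hE0]
    have : |m / s| ^ (2 + ρ) = |m| ^ (2 + ρ) * (1 / s) ^ (2 + ρ) := by
      rw [abs_div, abs_of_pos hs, div_eq_mul_one_div, Real.mul_rpow (abs_nonneg m) (by positivity)]
    rw [this] at ta
    calc E * |T| ≤ E * (2 * (|m| ^ (2 + ρ) * (1 / s) ^ (2 + ρ))) := by gcongr
      _ = 2 * (E * |m| ^ (2 + ρ)) * (1 / s) ^ (2 + ρ) := by ring
      _ ≤ 2 * (2400 * H) * (1 / s) ^ (2 + ρ) := by gcongr
      _ = _ := by ring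
  have d2 : |phi z * ((E * m - X - x / 2 * (X ^ 2 - σ ^ 2)) / s)| ≤ 60 * (x ^ (1 + ρ) / s * H) := by
    rw [abs_mul, abs_div, abs_of_pos (phi_pos z), abs_of_pos hs]
    calc _ ≤ 1 * ((60 * (x ^ (1 + ρ) * H)) / s) := by
          gcongr
          have := phi_le z; linarith
      _ = _ := by ring
  have d3 : |z * phi z * ((E * m ^ 2 - X ^ 2) / (2 * s ^ 2))| ≤ 500 * (x ^ ρ / s ^ 2 * H) := by
    rw [abs_mul, abs_div, abs_mul z, abs_of_pos (phi_pos z), abs_of_pos (by positivity : 0 < 2 * s ^ 2)]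
    calc _ ≤ 1 * ((1000 * (x ^ ρ * H)) / (2 * s ^ 2)) := by
          gcongr
          exact abs_mul_phi z
      _ = _ := by field_simp; ring
  have a1 := abs_sub (E * T + phi z * ((E * m - X - x / 2 * (X ^ 2 - σ ^ 2)) / s)) (z * phi z * ((E * m ^ 2 - X ^ 2) / (2 * s ^ 2)))
  have a2 := abs_add_le (E * T) (phi z * ((E * m - X - x / 2 * (X ^ 2 - σ ^ 2)) / s))
  have f1 := mul_le_mul_of_nonneg_right c1 hH0
  have f2 := mul_le_mul_of_nonneg_right c2 hH0
  have f3 := mul_le_mul_of_nonneg_right c3 hH0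
  have f4 : 0 ≤ 1 / s ^ 3 * H := by positivity
  have f5 : 0 ≤ (1 + x) ^ (1 + ρ) / s * H := by positivity
  have f6 : 20000 * ((1 + x) ^ (1 + ρ) / s + 1 / s ^ 3) * H = 20000 * ((1 + x) ^ (1 + ρ) / s * H) + 20000 * (1 / s ^ 3 * H) := by ring
  rw [f6]
  rw [add_mul] at f1 f2
  linarith

end Cr


namespace Cr

/-- tilting exponential -/
noncomputable def eX (x y : ℝ) : ℝ := Real.exp (x * y - (x * y) ^ 2 / 2)

lemma eX_pos (x y : ℝ) : 0 < eX x y := Real.exp_pos _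
lemma eX_le (x y : ℝ) : eX x y ≤ 2 := E_le _
lemma eX_meas (x : ℝ) : Measurable (eX x) := by
  have : Continuous (eX x) := by unfold eX; fun_prop
  exact this.measurable

/-- constant in the second order expansion -/
lemma exists_Ce : ∃ C : ℝ, 1 ≤ C ∧ ∀ ρ x y : ℝ, 0 ≤ ρ → ρ ≤ 1 → 0 ≤ x →
    |eX x y - 1 - x * y| ≤ C * x ^ (2 + ρ) * |y| ^ (2 + ρ) := by
  obtain ⟨C, h0, h⟩ := exp_quad 1 (1/2) (by norm_num)
  refine ⟨C + 1, by linarith, fun ρ x y h1 h2 hx => ?_⟩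
  have := h ρ (x * y) h1 h2
  have e : Real.exp (1 * (x * y) - 1 / 2 * (x * y) ^ 2) - 1 - 1 * (x * y) - (1 ^ 2 / 2 - 1 / 2) * (x * y) ^ 2
      = eX x y - 1 - x * y := by
    unfold eX
    rw [show 1 * (x * y) - 1 / 2 * (x * y) ^ 2 = x * y - (x * y) ^ 2 / 2 by ring]; ring
  rw [e, abs_mul, Real.mul_rpow (abs_nonneg x) (abs_nonneg y), abs_of_nonneg hx, ← mul_assoc] at this
  refine this.trans ?_
  gcongr
  linarith

noncomputable def Ce : ℝ := exists_Ce.choose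
lemma Ce_ge : 1 ≤ Ce := exists_Ce.choose_spec.1
lemma Ce_spec {ρ x : ℝ} (y : ℝ) (h0 : 0 ≤ ρ) (h1 : ρ ≤ 1) (hx : 0 ≤ x) :
    |eX x y - 1 - x * y| ≤ Ce * x ^ (2 + ρ) * |y| ^ (2 + ρ) := exists_Ce.choose_spec.2 ρ x y h0 h1 hx

/-- clipped conditional normaliser -/
noncomputable def lam {Ω : Type} [mΩ : MeasurableSpace Ω] (P : Measure Ω) (F : ℕ → MeasurableSpace Ω)
    (X : ℕ → Ω → ℝ) (x : ℝ) (i : ℕ) (ω : Ω) : ℝ :=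
  max (1 / 2) (min 2 ((P[fun ω => eX x (X i ω)|F i]) ω))

/-- tilting martingale -/
noncomputable def ZZ {Ω : Type} [mΩ : MeasurableSpace Ω] (P : Measure Ω) (F : ℕ → MeasurableSpace Ω)
    (X : ℕ → Ω → ℝ) (x : ℝ) (m : ℕ) (ω : Ω) : ℝ :=
  ∏ j ∈ Finset.range m, (eX x (X j ω) / lam P F X x j ω)

namespace Good

variable {Ω : Type} [mΩ : MeasurableSpace Ω] {P : Measure Ω} [IsProbabilityMeasure P]
  {F : ℕ → MeasurableSpace Ω} {n : ℕ} {X v : ℕ → Ω → ℝ} {ρ γ δ x : ℝ}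

lemma eXBM (g : Good P F n X v ρ γ δ) (x : ℝ) (i : ℕ) : BM (F (i + 1)) (fun ω => eX x (X i ω)) :=
  ⟨(eX_meas x).comp (g.Xm i), 2, fun ω => by rw [abs_of_pos (eX_pos _ _)]; exact eX_le _ _⟩

lemma lam_bds (_g : Good P F n X v ρ γ δ) (x : ℝ) (i : ℕ) (ω : Ω) :
    1 / 2 ≤ lam P F X x i ω ∧ lam P F X x i ω ≤ 2 := by
  unfold lam
  exact ⟨le_max_left _ _, max_le (by norm_num) (min_le_left _ _)⟩

lemma lam_pos (g : Good P F n X v ρ γ δ) (x : ℝ) (i : ℕ) (ω : Ω) : 0 < lam P F X x i ω := by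
  linarith [(g.lam_bds x i ω).1]

lemma lamBM (g : Good P F n X v ρ γ δ) (x : ℝ) (i : ℕ) : BM (F i) (lam P F X x i) := by
  refine ⟨?_, 2, fun ω => ?_⟩
  · exact measurable_const.max (measurable_const.min stronglyMeasurable_condExp.measurable)
  · rw [abs_of_pos (g.lam_pos x i ω)]; exact (g.lam_bds x i ω).2

lemma lamInvBM (g : Good P F n X v ρ γ δ) (x : ℝ) (i : ℕ) : BM (F i) (fun ω => (lam P F X x i ω)⁻¹) := by
  refine ⟨(g.lamBM x i).1.inv, 2, fun ω => ?_⟩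
  rw [abs_of_pos (inv_pos.2 (g.lam_pos x i ω))]
  have := inv_anti₀ (by norm_num) (g.lam_bds x i ω).1
  linarith

/-- integrated version of the bound on the normaliser -/
lemma eX_int (g : Good P F n X v ρ γ δ) (hx : 0 ≤ x) (i : ℕ) {Y : Ω → ℝ} (hY : BM (F i) Y) (h0 : ∀ ω, 0 ≤ Y ω) :
    |∫ ω, Y ω * (eX x (X i ω) - 1) ∂P| ≤ Ce * x ^ (2 + ρ) * γ ^ ρ * ∫ ω, Y ω * v i ω ∂P := by
  have hY' := hY.mono (g.le i)
  have i1 := hY'.mul_integrable (g.intX i)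
  have i3 := hY'.mul_integrable (g.int i)
  have ie : Integrable (fun ω => Y ω * (eX x (X i ω) - 1)) P :=
    (hY'.mul (((g.eXBM x i).mono (g.le _)).sub (BM.const 1))).integrable
  have e : ∫ ω, Y ω * (eX x (X i ω) - 1) ∂P = ∫ ω, (Y ω * (eX x (X i ω) - 1) - x * (Y ω * X i ω)) ∂P := by
    rw [integral_sub ie (i1.const_mul x), integral_const_mul, g.e1 i Y hY]; ring
  rw [e]
  have c0 : 0 ≤ Ce * x ^ (2 + ρ) := by have := Ce_ge; positivity
  calc |∫ ω, (Y ω * (eX x (X i ω) - 1) - x * (Y ω * X i ω)) ∂P|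
      ≤ ∫ ω, |Y ω * (eX x (X i ω) - 1) - x * (Y ω * X i ω)| ∂P := abs_integral_le_integral_abs
    _ ≤ ∫ ω, Ce * x ^ (2 + ρ) * (Y ω * |X i ω| ^ (2 + ρ)) ∂P := by
        have ij : Integrable (fun ω => Y ω * (eX x (X i ω) - 1) - x * (Y ω * X i ω)) P :=
          ie.sub (i1.const_mul x)
        apply integral_mono ij.abs (i3.const_mul _)
        intro ω
        show |Y ω * (eX x (X i ω) - 1) - x * (Y ω * X i ω)| ≤ Ce * x ^ (2 + ρ) * (Y ω * |X i ω| ^ (2 + ρ))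
        rw [show Y ω * (eX x (X i ω) - 1) - x * (Y ω * X i ω) = Y ω * (eX x (X i ω) - 1 - x * X i ω) by ring,
          abs_mul, abs_of_nonneg (h0 ω)]
        calc _ ≤ Y ω * (Ce * x ^ (2 + ρ) * |X i ω| ^ (2 + ρ)) :=
              mul_le_mul_of_nonneg_left (Ce_spec _ g.ρ0.le g.ρ1 hx) (h0 ω)
          _ = _ := by ring
    _ = Ce * x ^ (2 + ρ) * ∫ ω, Y ω * |X i ω| ^ (2 + ρ) ∂P := integral_const_mul _ _
    _ ≤ Ce * x ^ (2 + ρ) * (γ ^ ρ * ∫ ω, Y ω * v i ω ∂P) :=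
        mul_le_mul_of_nonneg_left (g.e3 i Y hY h0) c0
    _ = _ := by ring

lemma ce_int (g : Good P F n X v ρ γ δ) (x : ℝ) (i : ℕ) {Y : Ω → ℝ} (hY : BM (F i) Y) :
    ∫ ω, Y ω * eX x (X i ω) ∂P = ∫ ω, Y ω * (P[fun ω => eX x (X i ω)|F i]) ω ∂P := by
  have ie : Integrable (fun ω => eX x (X i ω)) P := ((g.eXBM x i).mono (g.le _)).integrable
  have iY : Integrable (fun ω => Y ω * eX x (X i ω)) P := (hY.mono (g.le i)).mul_integrable ie
  have h := condExp_mul_of_stronglyMeasurable_left (m := F i) (μ := P) hY.1.stronglyMeasurable iY ie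
  have h2 := integral_congr_ae h
  rw [integral_condExp (g.le i)] at h2
  exact h2

/-- an integral criterion for a.e. non-positivity -/
lemma ae_nonpos (g : Good P F n X v ρ γ δ) (i : ℕ) {h : Ω → ℝ} (hm : Measurable[F i] h) (hi : Integrable h P)
    (H : ∀ Y, BM (F i) Y → (∀ ω, 0 ≤ Y ω) → ∫ ω, Y ω * h ω ∂P ≤ 0) : ∀ᵐ ω ∂P, h ω ≤ 0 := by
  set S : Set Ω := {ω | 0 < h ω} with hS
  have hSm : MeasurableSet[F i] S := measurableSet_lt measurable_const hm
  have hY : BM (F i) (S.indicator fun _ => (1:ℝ)) := by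
    refine ⟨measurable_const.indicator hSm, 1, fun ω => ?_⟩
    by_cases hω : ω ∈ S <;> simp [hω]
  have h1 := H _ hY (fun ω => Set.indicator_nonneg (fun _ _ => zero_le_one) ω)
  have e : (fun ω => S.indicator (fun _ => (1:ℝ)) ω * h ω) = fun ω => max (h ω) 0 := by
    ext ω
    by_cases hω : ω ∈ S
    · have : 0 < h ω := hω
      simp [hω, max_eq_left this.le]
    · have : h ω ≤ 0 := not_lt.1 hω
      simp [hω, max_eq_right this]
  rw [e] at h1
  have h2 : ∫ ω, max (h ω) 0 ∂P = 0 := le_antisymm h1 (integral_nonneg fun ω => le_max_right _ _)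
  have h0 : (0 : Ω → ℝ) ≤ fun ω => max (h ω) 0 := fun ω => le_max_right _ _
  rw [integral_eq_zero_iff_of_nonneg (f := fun ω => max (h ω) 0) h0 hi.pos_part] at h2
  filter_upwards [h2] with ω hω
  simp only [Pi.zero_apply] at hω
  rw [← hω]; exact le_max_left _ _

lemma small_pow (g : Good P F n X v ρ γ δ) (hx : 0 ≤ x) (hxg : x * γ ≤ 1) (i : ℕ) (ω : Ω) :
    x ^ (2 + ρ) * γ ^ ρ * v i ω ≤ (x * γ) ^ 2 := by
  have h1 : x ^ (2 + ρ) * γ ^ ρ * v i ω ≤ x ^ (2 + ρ) * γ ^ ρ * γ ^ 2 := by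
    have := g.γ0
    exact mul_le_mul_of_nonneg_left (g.vle i ω) (by positivity)
  have h2 : x ^ (2 + ρ) * γ ^ ρ * γ ^ 2 = (x * γ) ^ (2 + ρ) := by
    rw [Real.mul_rpow hx g.γ0.le, mul_assoc]
    congr 1
    rw [add_comm, Real.rpow_add g.γ0]; norm_num
  rw [h2] at h1
  refine h1.trans ?_
  have := g.ρ0
  have hγ := g.γ0
  rcases (mul_nonneg hx g.γ0.le).eq_or_lt with h | h
  · rw [← h, Real.zero_rpow (by linarith)]; norm_num
  · rw [← Real.rpow_natCast]
    exact Real.rpow_le_rpow_of_exponent_ge h hxg (by push_cast; linarith)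

lemma ce_ae (g : Good P F n X v ρ γ δ) (hx : 0 ≤ x) (i : ℕ) :
    ∀ᵐ ω ∂P, |(P[fun ω => eX x (X i ω)|F i]) ω - 1| ≤ Ce * x ^ (2 + ρ) * γ ^ ρ * v i ω := by
  set c := Ce * x ^ (2 + ρ) * γ ^ ρ with hc
  set ce := P[fun ω => eX x (X i ω)|F i] with hce
  have cm : Measurable[F i] ce := stronglyMeasurable_condExp.measurable
  have ci : Integrable ce P := integrable_condExp
  have vi : Integrable (v i) P := ((g.vBM i).mono (g.le i)).integrable
  have key : ∀ Y, BM (F i) Y → (∀ ω, 0 ≤ Y ω) →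
      |∫ ω, Y ω * (ce ω - 1) ∂P| ≤ ∫ ω, Y ω * (c * v i ω) ∂P := by
    intro Y hY h0
    have hY' := hY.mono (g.le i)
    have h := g.eX_int hx i hY h0
    have ie : Integrable (fun ω => eX x (X i ω)) P := ((g.eXBM x i).mono (g.le _)).integrable
    have e1 : ∫ ω, Y ω * (eX x (X i ω) - 1) ∂P = ∫ ω, Y ω * (ce ω - 1) ∂P := by
      simp only [mul_sub, mul_one]
      rw [integral_sub (hY'.mul_integrable ie) hY'.integrable,
        integral_sub (hY'.mul_integrable ci) hY'.integrable, g.ce_int x i hY]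
    rw [e1] at h
    refine h.trans (le_of_eq ?_)
    rw [← integral_const_mul]
    congr 1; ext ω; ring
  have a1 : ∀ᵐ ω ∂P, (ce ω - 1) - c * v i ω ≤ 0 := by
    refine g.ae_nonpos i ((cm.sub measurable_const).sub ((g.vm i).const_mul c))
      ((ci.sub (integrable_const 1)).sub (vi.const_mul c)) fun Y hY h0 => ?_
    have hY' := hY.mono (g.le i)
    have i1 : Integrable (fun ω => Y ω * (ce ω - 1)) P := hY'.mul_integrable (ci.sub (integrable_const 1))
    have i2 : Integrable (fun ω => Y ω * (c * v i ω)) P := hY'.mul_integrable (vi.const_mul c)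
    have := (abs_le.1 (key Y hY h0)).2
    simp only [mul_sub (Y _) (ce _ - 1)]
    rw [integral_sub i1 i2]; linarith
  have a2 : ∀ᵐ ω ∂P, (1 - ce ω) - c * v i ω ≤ 0 := by
    refine g.ae_nonpos i ((measurable_const.sub cm).sub ((g.vm i).const_mul c))
      (((integrable_const 1).sub ci).sub (vi.const_mul c)) fun Y hY h0 => ?_
    have hY' := hY.mono (g.le i)
    have i1 : Integrable (fun ω => Y ω * (ce ω - 1)) P := hY'.mul_integrable (ci.sub (integrable_const 1))
    have i2 : Integrable (fun ω => Y ω * (c * v i ω)) P := hY'.mul_integrable (vi.const_mul c)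
    have := (abs_le.1 (key Y hY h0)).1
    have e : (fun ω => Y ω * (((1:ℝ) - ce ω) - c * v i ω)) = fun ω => -(Y ω * (ce ω - 1)) - Y ω * (c * v i ω) := by
      ext ω; ring
    have i1n : Integrable (fun ω => -(Y ω * (ce ω - 1))) P := i1.neg
    rw [e, integral_sub i1n i2, integral_neg]; linarith
  filter_upwards [a1, a2] with ω h1 h2
  rw [abs_le]; constructor <;> linarith

/-- smallness hypothesis on x -/
def SmallX (x γ : ℝ) : Prop := 0 ≤ x ∧ x * γ ≤ 1 ∧ Ce * (x * γ) ^ 2 ≤ 1 / 2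

lemma lam_eq_ae (g : Good P F n X v ρ γ δ) (hx : SmallX x γ) (i : ℕ) :
    ∀ᵐ ω ∂P, lam P F X x i ω = (P[fun ω => eX x (X i ω)|F i]) ω := by
  filter_upwards [g.ce_ae hx.1 i] with ω hω
  have h1 := g.small_pow hx.1 hx.2.1 i ω
  have h2 : Ce * x ^ (2 + ρ) * γ ^ ρ * v i ω ≤ 1 / 2 := by
    calc _ = Ce * (x ^ (2 + ρ) * γ ^ ρ * v i ω) := by ring
      _ ≤ Ce * (x * γ) ^ 2 := mul_le_mul_of_nonneg_left h1 (by linarith [Ce_ge])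
      _ ≤ _ := hx.2.2
  have h3 := abs_le.1 (hω.trans h2)
  unfold lam
  rw [min_eq_right (by linarith [h3.2]), max_eq_right (by linarith [h3.1])]

lemma lam_ae (g : Good P F n X v ρ γ δ) (hx : SmallX x γ) (i : ℕ) :
    ∀ᵐ ω ∂P, |lam P F X x i ω - 1| ≤ Ce * x ^ (2 + ρ) * γ ^ ρ * v i ω := by
  filter_upwards [g.ce_ae hx.1 i, g.lam_eq_ae hx i] with ω h1 h2
  rw [h2]; exact h1

lemma lam_int (g : Good P F n X v ρ γ δ) (hx : SmallX x γ) (i : ℕ) {Y : Ω → ℝ} (hY : BM (F i) Y) :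
    ∫ ω, Y ω * eX x (X i ω) ∂P = ∫ ω, Y ω * lam P F X x i ω ∂P := by
  rw [g.ce_int x i hY]
  apply integral_congr_ae
  filter_upwards [g.lam_eq_ae hx i] with ω h
  rw [h]

lemma ZZ_pos (g : Good P F n X v ρ γ δ) (x : ℝ) (m : ℕ) (ω : Ω) : 0 < ZZ P F X x m ω :=
  Finset.prod_pos fun j _ => div_pos (eX_pos _ _) (g.lam_pos x j ω)

lemma ZZBM (g : Good P F n X v ρ γ δ) (x : ℝ) (m : ℕ) : BM (F m) (ZZ P F X x m) := by
  induction m with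
  | zero =>
    have : ZZ P F X x 0 = fun _ => (1:ℝ) := by ext ω; simp [ZZ]
    rw [this]; exact BM.const 1
  | succ m ih =>
    have : ZZ P F X x (m + 1) = fun ω => ZZ P F X x m ω * (eX x (X m ω) * (lam P F X x m ω)⁻¹) := by
      ext ω; simp only [ZZ, Finset.prod_range_succ, div_eq_mul_inv]
    rw [this]
    exact (ih.mono (g.mono (Nat.le_succ m))).mul
      ((g.eXBM x m).mul ((g.lamInvBM x m).mono (g.mono (Nat.le_succ m))))

lemma ZZ_step (g : Good P F n X v ρ γ δ) (hx : SmallX x γ) (m : ℕ) {Y : Ω → ℝ} (hY : BM (F m) Y) :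
    ∫ ω, Y ω * ZZ P F X x (m + 1) ω ∂P = ∫ ω, Y ω * ZZ P F X x m ω ∂P := by
  have h := g.lam_int hx m ((hY.mul (g.ZZBM x m)).mul (g.lamInvBM x m))
  have e1 : ∀ ω, Y ω * ZZ P F X x (m + 1) ω = Y ω * ZZ P F X x m ω * (lam P F X x m ω)⁻¹ * eX x (X m ω) := by
    intro ω; simp only [ZZ, Finset.prod_range_succ, div_eq_mul_inv]; ring
  have e2 : ∀ ω, Y ω * ZZ P F X x m ω = Y ω * ZZ P F X x m ω * (lam P F X x m ω)⁻¹ * lam P F X x m ω := by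
    intro ω; rw [mul_assoc _ (lam P F X x m ω)⁻¹, inv_mul_cancel₀ (g.lam_pos x m ω).ne', mul_one]
  simp only [e1]
  rw [h]
  exact integral_congr_ae (Eventually.of_forall fun ω => (e2 ω).symm)

lemma ZZ_mart (g : Good P F n X v ρ γ δ) (hx : SmallX x γ) {m k : ℕ} (hmk : m ≤ k) {Y : Ω → ℝ} (hY : BM (F m) Y) :
    ∫ ω, Y ω * ZZ P F X x k ω ∂P = ∫ ω, Y ω * ZZ P F X x m ω ∂P := by
  induction k, hmk using Nat.le_induction with
  | base => rfl
  | succ k hk ih => rw [g.ZZ_step hx k (hY.mono (g.mono hk)), ih]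

lemma ZZ_one (g : Good P F n X v ρ γ δ) (hx : SmallX x γ) (m : ℕ) : ∫ ω, ZZ P F X x m ω ∂P = 1 := by
  have := g.ZZ_mart hx (Nat.zero_le m) (BM.const (m := F 0) (1:ℝ))
  simpa [ZZ] using this

/-- relation of the tilting martingale and the exponential -/
lemma ZZ_exp (g : Good P F n X v ρ γ δ) (hx : SmallX x γ) :
    ∀ᵐ ω ∂P, Real.exp (x * ∑ i ∈ Finset.range n, X i ω - x ^ 2 / 2 * ∑ i ∈ Finset.range n, X i ω ^ 2)
        ≤ Real.exp (4 * Ce * (x ^ (2 + ρ) * γ ^ ρ)) * ZZ P F X x n ω ∧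
      ZZ P F X x n ω ≤ Real.exp (4 * Ce * (x ^ (2 + ρ) * γ ^ ρ)) *
        Real.exp (x * ∑ i ∈ Finset.range n, X i ω - x ^ 2 / 2 * ∑ i ∈ Finset.range n, X i ω ^ 2) := by
  have hall : ∀ᵐ ω ∂P, ∀ i, |lam P F X x i ω - 1| ≤ Ce * x ^ (2 + ρ) * γ ^ ρ * v i ω :=
    ae_all_iff.2 fun i => g.lam_ae hx i
  filter_upwards [hall, g.sum] with ω h1 h2
  set a := Ce * x ^ (2 + ρ) * γ ^ ρ with ha
  have hx0 := hx.1
  have hγ := g.γ0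
  have ha0 : 0 ≤ a := by have := Ce_ge; positivity
  have eE : Real.exp (x * ∑ i ∈ Finset.range n, X i ω - x ^ 2 / 2 * ∑ i ∈ Finset.range n, X i ω ^ 2)
      = ∏ i ∈ Finset.range n, eX x (X i ω) := by
    unfold eX
    rw [← Real.exp_sum]
    congr 1
    rw [Finset.sum_sub_distrib, Finset.mul_sum, Finset.mul_sum]
    congr 1
    apply Finset.sum_congr rfl; intro i _; ring
  set L := ∏ i ∈ Finset.range n, lam P F X x i ω with hL
  have hL0 : 0 < L := Finset.prod_pos fun i _ => g.lam_pos x i ω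
  have eZ : ∏ i ∈ Finset.range n, eX x (X i ω) = ZZ P F X x n ω * L := by
    unfold ZZ
    rw [hL, ← Finset.prod_mul_distrib]
    apply Finset.prod_congr rfl; intro i _
    rw [div_mul_cancel₀ _ (g.lam_pos x i ω).ne']
  have hs : ∑ i ∈ Finset.range n, v i ω ≤ 2 := by
    have h3 := (abs_le.1 h2).2
    have h4 : δ ^ 2 ≤ 1 := by nlinarith [g.δ0, g.δ1]
    linarith
  have hs0 : 0 ≤ ∑ i ∈ Finset.range n, v i ω := Finset.sum_nonneg fun i _ => g.v0 i ω
  have eA : 4 * Ce * (x ^ (2 + ρ) * γ ^ ρ) = 4 * a := by rw [ha]; ring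
  have hup : L ≤ Real.exp (4 * a) := by
    calc L ≤ ∏ i ∈ Finset.range n, Real.exp (a * v i ω) := by
          apply Finset.prod_le_prod (fun i _ => (g.lam_pos x i ω).le)
          intro i _
          have h3 := (abs_le.1 (h1 i)).2
          have h4 := Real.add_one_le_exp (a * v i ω)
          linarith
      _ = Real.exp (a * ∑ i ∈ Finset.range n, v i ω) := by rw [← Real.exp_sum, Finset.mul_sum]
      _ ≤ _ := Real.exp_le_exp.2 (by nlinarith)
  have hlow : 1 ≤ Real.exp (4 * a) * L := by
    have : ∏ i ∈ Finset.range n, (1:ℝ) ≤ ∏ i ∈ Finset.range n, (Real.exp (2 * a * v i ω) * lam P F X x i ω) := by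
      apply Finset.prod_le_prod (fun i _ => zero_le_one)
      intro i _
      have h3 := (abs_le.1 (h1 i)).1
      have h5 := (g.lam_bds x i ω).1
      have h4 := Real.add_one_le_exp (2 * a * v i ω)
      have h6 := mul_nonneg ha0 (g.v0 i ω)
      have h7 : (2 * a * v i ω + 1) * lam P F X x i ω ≤ Real.exp (2 * a * v i ω) * lam P F X x i ω :=
        mul_le_mul_of_nonneg_right h4 (by linarith)
      nlinarith
    rw [Finset.prod_const_one, Finset.prod_mul_distrib, ← Real.exp_sum, ← Finset.mul_sum] at this
    refine this.trans (mul_le_mul_of_nonneg_right (Real.exp_le_exp.2 ?_) hL0.le)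
    nlinarith
  have hZ := g.ZZ_pos x n ω
  rw [eE, eZ, eA]
  constructor
  · rw [mul_comm]; exact mul_le_mul_of_nonneg_right hup hZ.le
  · calc ZZ P F X x n ω = ZZ P F X x n ω * 1 := (mul_one _).symm
      _ ≤ ZZ P F X x n ω * (Real.exp (4 * a) * L) := mul_le_mul_of_nonneg_left hlow hZ.le
      _ = _ := by ring

end Good
end Cr


namespace Cr

/-- weight in the Lindeberg step -/
noncomputable def bw (ρ x s : ℝ) : ℝ := (1 + x) ^ (1 + ρ) / s + 1 / s ^ 3

lemma bw_nonneg {ρ x s : ℝ} (hx : 0 ≤ x) (hs : 0 < s) : 0 ≤ bw ρ x s := by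
  unfold bw; positivity

lemma cdf_abs_le (z : ℝ) : |stdNormalCDF z| ≤ 1 := by
  rw [abs_of_nonneg (cdf_nonneg z)]; exact cdf_le_one z

lemma step_point {ρ γ δ' x X v s z l : ℝ} (_ : δ' = 0) (h0 : 0 < ρ) (h1 : ρ ≤ 1) (hγ : 0 < γ) (hx : 0 ≤ x) (hxg : x * γ ≤ 1)
    (hv : 0 ≤ v) (hvg : v ≤ γ ^ 2) (hs : γ ≤ s) (hl0 : 0 < l) (hl2 : l ≤ 2)
    (hl : |l - 1| ≤ Ce * x ^ (2 + ρ) * γ ^ ρ * v) :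
    |eX x X * stdNormalCDF (z + (X - x / 2 * (X ^ 2 + v)) / s) - l * stdNormalCDF (z / Real.sqrt (1 + v / s ^ 2))
      - (phi z / s * X + (phi z / s * (x / 2) - z * phi z / (2 * s ^ 2)) * (X ^ 2 - v)
        + stdNormalCDF z * (eX x X - l))|
    ≤ bw ρ x s * (20000 * |X| ^ (2 + ρ) + (20010 + Ce) * (γ ^ ρ * v)) := by
  have hs0 : 0 < s := hγ.trans_le hs
  have hCe := Ce_ge
  have hsv : Real.sqrt v ≤ γ := by
    rw [show γ = Real.sqrt (γ ^ 2) by rw [Real.sqrt_sq hγ.le]]; exact Real.sqrt_le_sqrt hvg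
  have hsv0 := Real.sqrt_nonneg v
  have hsq : Real.sqrt v ^ 2 = v := Real.sq_sqrt hv
  have hgp : 0 < γ ^ ρ := Real.rpow_pos_of_pos hγ _
  have hb := bw_nonneg (ρ := ρ) hx hs0
  -- R1
  have r1 := lind_point (X := X) (z := z) h0 h1 hx hsv0 (by nlinarith) hs0
  rw [hsq] at r1
  have hsig : Real.sqrt v ^ (2 + ρ) ≤ γ ^ ρ * v := by
    rcases hsv0.eq_or_lt with h | h
    · rw [← h, Real.zero_rpow (by linarith)]; positivity
    · rw [add_comm, Real.rpow_add h]
      have : Real.sqrt v ^ (2:ℝ) = v := by rw [← hsq]; norm_num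
      rw [this]
      exact mul_le_mul_of_nonneg_right (Real.rpow_le_rpow hsv0 hsv h0.le) hv
  have r1' : |eX x X * (stdNormalCDF (z + (X - x / 2 * (X ^ 2 + v)) / s) - stdNormalCDF z)
      - phi z / s * (X + x / 2 * (X ^ 2 - v)) + z * phi z / (2 * s ^ 2) * X ^ 2|
      ≤ bw ρ x s * (20000 * |X| ^ (2 + ρ) + 20000 * (γ ^ ρ * v)) := by
    refine r1.trans ?_
    have e : 20000 * ((1 + x) ^ (1 + ρ) / s + 1 / s ^ 3) * (|X| ^ (2 + ρ) + Real.sqrt v ^ (2 + ρ))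
      = bw ρ x s * (20000 * |X| ^ (2 + ρ) + 20000 * Real.sqrt v ^ (2 + ρ)) := by unfold bw; ring
    rw [e]
    apply mul_le_mul_of_nonneg_left _ hb
    linarith
  -- R2
  have hτ0 : 0 ≤ v / s ^ 2 := by positivity
  have r2 := heat z (v / s ^ 2) hτ0
  obtain ⟨m1, m2, m3⟩ := mixed_powers (x := x) h0 h1 hx hs0
  have hgs : γ / s ≤ 1 := (div_le_one hs0).2 hs
  have t2 : (v / s ^ 2) ^ 2 ≤ bw ρ x s * (γ ^ ρ * v) := by
    have a1 : (γ / s) ^ 2 ≤ (γ / s) ^ ρ := by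
      rw [← Real.rpow_natCast]
      exact Real.rpow_le_rpow_of_exponent_ge (by positivity) hgs (by push_cast; linarith)
    have a2 : (γ / s) ^ ρ * (1 / s) ^ 2 = γ ^ ρ * (1 / s) ^ (2 + ρ) := by
      rw [Real.div_rpow hγ.le hs0.le, add_comm, Real.rpow_add (by positivity), Real.div_rpow zero_le_one hs0.le, Real.one_rpow]
      norm_num
      ring
    calc (v / s ^ 2) ^ 2 = v * (v * (1 / s) ^ 2 * (1 / s) ^ 2) := by field_simp
      _ ≤ v * (γ ^ 2 * (1 / s) ^ 2 * (1 / s) ^ 2) := by gcongr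
      _ = v * ((γ / s) ^ 2 * (1 / s) ^ 2) := by field_simp
      _ ≤ v * ((γ / s) ^ ρ * (1 / s) ^ 2) := by gcongr
      _ = v * (γ ^ ρ * (1 / s) ^ (2 + ρ)) := by rw [a2]
      _ ≤ v * (γ ^ ρ * bw ρ x s) := by unfold bw; gcongr
      _ = _ := by ring
  have r2' : |l * (stdNormalCDF z - stdNormalCDF (z / Real.sqrt (1 + v / s ^ 2)) - z * phi z * (v / s ^ 2) / 2)|
      ≤ bw ρ x s * (10 * (γ ^ ρ * v)) := by
    rw [abs_mul, abs_of_pos hl0, ← abs_neg]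
    rw [show -(stdNormalCDF z - stdNormalCDF (z / Real.sqrt (1 + v / s ^ 2)) - z * phi z * (v / s ^ 2) / 2)
      = stdNormalCDF (z / Real.sqrt (1 + v / s ^ 2)) - stdNormalCDF z + z * phi z * (v / s ^ 2) / 2 by ring]
    calc _ ≤ 2 * (5 * (v / s ^ 2) ^ 2) := mul_le_mul hl2 r2 (abs_nonneg _) (by norm_num)
      _ ≤ _ := by linarith
  -- cross
  have r3 : |(l - 1) * (z * phi z / (2 * s ^ 2) * v)| ≤ bw ρ x s * (Ce * (γ ^ ρ * v)) := by
    have a1 : |z * phi z / (2 * s ^ 2) * v| ≤ v / s ^ 2 := by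
      rw [show z * phi z / (2 * s ^ 2) * v = (z * phi z) * (v / s ^ 2 / 2) by field_simp, abs_mul]
      rw [abs_of_nonneg (by positivity : 0 ≤ v / s ^ 2 / 2)]
      have : |z * phi z| ≤ 1 := by rw [abs_mul, abs_of_pos (phi_pos z)]; exact abs_mul_phi z
      calc _ ≤ 1 * (v / s ^ 2 / 2) := mul_le_mul_of_nonneg_right this (by positivity)
        _ ≤ _ := by linarith
    have a2 : x * v / s ≤ 1 := by
      rw [div_le_one hs0]
      calc x * v ≤ x * γ ^ 2 := by gcongr
        _ = (x * γ) * γ := by ring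
        _ ≤ 1 * γ := by gcongr
        _ ≤ s := by linarith
    have a3 : x ^ (2 + ρ) = x ^ (1 + ρ) * x := by
      rw [show 2 + ρ = (1 + ρ) + 1 by ring, Real.rpow_add_one' hx (by linarith)]
    rw [abs_mul]
    calc _ ≤ (Ce * x ^ (2 + ρ) * γ ^ ρ * v) * (v / s ^ 2) := mul_le_mul hl a1 (abs_nonneg _) (by positivity)
      _ = (x ^ (1 + ρ) / s) * (Ce * γ ^ ρ * v) * (x * v / s) := by rw [a3]; field_simp
      _ ≤ (x ^ (1 + ρ) / s) * (Ce * γ ^ ρ * v) * 1 := by gcongr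
      _ ≤ ((1 + x) ^ (1 + ρ) / s) * (Ce * γ ^ ρ * v) := by rw [mul_one]; gcongr
      _ ≤ bw ρ x s * (Ce * γ ^ ρ * v) := by
          gcongr; unfold bw; have : 0 ≤ 1 / s ^ 3 := by positivity
          linarith
      _ = _ := by ring
  have tri : ∀ a b c A B C : ℝ, |a| ≤ A → |b| ≤ B → |c| ≤ C → |a + b + c| ≤ A + B + C := by
    intro a b c A B C ha hb hc
    exact (abs_add_le _ _).trans (add_le_add ((abs_add_le _ _).trans (add_le_add ha hb)) hc)
  have := tri _ _ _ _ _ _ r1' r2' r3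
  refine le_trans (le_of_eq ?_) (this.trans (le_of_eq ?_))
  · congr 1; field_simp; ring
  · ring

namespace Good

variable {Ω : Type} [mΩ : MeasurableSpace Ω] {P : Measure Ω} [IsProbabilityMeasure P]
  {F : ℕ → MeasurableSpace Ω} {n : ℕ} {X v : ℕ → Ω → ℝ} {ρ γ δ x : ℝ}

lemma lind_step (g : Good P F n X v ρ γ δ) (hx : SmallX x γ) (i : ℕ) {Y z s : Ω → ℝ} (hY : BM (F i) Y)
    (hY0 : ∀ ω, 0 ≤ Y ω) (hz : Measurable[F i] z) (hs : Measurable[F i] s) (hsg : ∀ ω, γ ≤ s ω) :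
    |∫ ω, Y ω * (eX x (X i ω) * stdNormalCDF (z ω + (X i ω - x / 2 * (X i ω ^ 2 + v i ω)) / s ω)) ∂P
      - ∫ ω, Y ω * (lam P F X x i ω * stdNormalCDF (z ω / Real.sqrt (1 + v i ω / s ω ^ 2))) ∂P|
      ≤ (40010 + Ce) * γ ^ ρ * ∫ ω, Y ω * (v i ω * bw ρ x (s ω)) ∂P := by
  have hx0 := hx.1
  have hγ := g.γ0
  have hs0 : ∀ ω, 0 < s ω := fun ω => hγ.trans_le (hsg ω)
  have hY' := hY.mono (g.le i)
  have Xm := g.Xmeas i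
  have Pm : Measurable stdNormalCDF := cdf_cont.measurable
  have phm : Measurable phi := phi_cont.measurable
  have zm : Measurable z := hz.mono (g.le i) le_rfl
  have sm : Measurable s := hs.mono (g.le i) le_rfl
  have vm : Measurable (v i) := (g.vm i).mono (g.le i) le_rfl
  -- bounded functions
  have isb : BM (F i) (fun ω => (s ω)⁻¹) := by
    refine ⟨hs.inv, γ⁻¹, fun ω => ?_⟩
    rw [abs_of_pos (inv_pos.2 (hs0 ω))]; exact inv_anti₀ hγ (hsg ω)
  have phb : BM (F i) (fun ω => phi (z ω)) := by
    refine ⟨phm.comp hz, 1, fun ω => ?_⟩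
    rw [abs_of_pos (phi_pos _)]; linarith [phi_le (z ω)]
  have zphb : BM (F i) (fun ω => z ω * phi (z ω)) := by
    refine ⟨hz.mul (phm.comp hz), 1, fun ω => ?_⟩
    rw [abs_mul, abs_of_pos (phi_pos _)]; exact abs_mul_phi _
  have Pb : BM (F i) (fun ω => stdNormalCDF (z ω)) := ⟨Pm.comp hz, 1, fun ω => cdf_abs_le _⟩
  have c1 : BM (F i) (fun ω => Y ω * (phi (z ω) * (s ω)⁻¹)) := hY.mul (phb.mul isb)
  have c2 : BM (F i) (fun ω => Y ω * (phi (z ω) * (s ω)⁻¹ * (x / 2) - (z ω * phi (z ω)) * (1 / 2) * ((s ω)⁻¹ * (s ω)⁻¹))) :=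
    hY.mul (((phb.mul isb).mul (BM.const (x / 2))).sub ((zphb.mul (BM.const (1/2))).mul (isb.mul isb)))
  have c3 : BM (F i) (fun ω => Y ω * stdNormalCDF (z ω)) := hY.mul Pb
  have bwb : BM (F i) (fun ω => bw ρ x (s ω)) := by
    have : (fun ω => bw ρ x (s ω)) = fun ω => (1 + x) ^ (1 + ρ) * (s ω)⁻¹ + (s ω)⁻¹ * ((s ω)⁻¹ * (s ω)⁻¹) := by
      ext ω; unfold bw; have := hs0 ω; field_simp
    rw [this]; exact ((BM.const _).mul isb).add (isb.mul (isb.mul isb))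
  -- integrability
  have iA : Integrable (fun ω => Y ω * (eX x (X i ω) * stdNormalCDF (z ω + (X i ω - x / 2 * (X i ω ^ 2 + v i ω)) / s ω))) P := by
    apply BM.integrable
    refine hY'.mul (((g.eXBM x i).mono (g.le _)).mul ⟨Pm.comp ?_, 1, fun ω => cdf_abs_le _⟩)
    exact zm.add ((Xm.sub (((Xm.pow_const 2).add vm).const_mul _)).div sm)
  have iB : Integrable (fun ω => Y ω * (lam P F X x i ω * stdNormalCDF (z ω / Real.sqrt (1 + v i ω / s ω ^ 2)))) P := by
    apply BM.integrable
    refine hY'.mul (((g.lamBM x i).mono (g.le _)).mul ⟨Pm.comp ?_, 1, fun ω => cdf_abs_le _⟩)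
    exact zm.div ((measurable_const.add (vm.div (sm.pow_const 2))).sqrt)
  have i1 := (c1.mono (g.le i)).mul_integrable (g.intX i)
  have i2 := (c2.mono (g.le i)).mul_integrable (g.intX2 i)
  have i2v := ((c2.mul (g.vBM i)).mono (g.le i)).integrable (P := P)
  have i3 := ((c3.mono (g.le i)).mul ((g.eXBM x i).mono (g.le _))).integrable (P := P)
  have i3l := ((c3.mul (g.lamBM x i)).mono (g.le i)).integrable (P := P)
  set C : Ω → ℝ := fun ω => (Y ω * (phi (z ω) * (s ω)⁻¹)) * X i ω
    + ((Y ω * (phi (z ω) * (s ω)⁻¹ * (x / 2) - (z ω * phi (z ω)) * (1 / 2) * ((s ω)⁻¹ * (s ω)⁻¹))) * X i ω ^ 2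
      - (Y ω * (phi (z ω) * (s ω)⁻¹ * (x / 2) - (z ω * phi (z ω)) * (1 / 2) * ((s ω)⁻¹ * (s ω)⁻¹))) * v i ω)
    + ((Y ω * stdNormalCDF (z ω)) * eX x (X i ω) - (Y ω * stdNormalCDF (z ω)) * lam P F X x i ω) with hC
  have iC : Integrable C P := (i1.add (i2.sub i2v)).add (i3.sub i3l)
  have zC : ∫ ω, C ω ∂P = 0 := by
    have k12 : Integrable (fun ω => (Y ω * (phi (z ω) * (s ω)⁻¹)) * X i ω
    + ((Y ω * (phi (z ω) * (s ω)⁻¹ * (x / 2) - (z ω * phi (z ω)) * (1 / 2) * ((s ω)⁻¹ * (s ω)⁻¹))) * X i ω ^ 2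
      - (Y ω * (phi (z ω) * (s ω)⁻¹ * (x / 2) - (z ω * phi (z ω)) * (1 / 2) * ((s ω)⁻¹ * (s ω)⁻¹))) * v i ω)) P :=
      i1.add (i2.sub i2v)
    have k2 : Integrable (fun ω => ((Y ω * (phi (z ω) * (s ω)⁻¹ * (x / 2) - (z ω * phi (z ω)) * (1 / 2) * ((s ω)⁻¹ * (s ω)⁻¹))) * X i ω ^ 2
      - (Y ω * (phi (z ω) * (s ω)⁻¹ * (x / 2) - (z ω * phi (z ω)) * (1 / 2) * ((s ω)⁻¹ * (s ω)⁻¹))) * v i ω)) P :=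
      i2.sub i2v
    have k3 : Integrable (fun ω => (Y ω * stdNormalCDF (z ω)) * eX x (X i ω) - (Y ω * stdNormalCDF (z ω)) * lam P F X x i ω) P :=
      i3.sub i3l
    rw [hC, integral_add k12 k3, integral_add i1 k2, integral_sub i2 i2v, integral_sub i3 i3l,
      g.e1 i _ c1, g.e2 i _ c2, g.lam_int hx i c3]
    ring
  have iAB : Integrable (fun ω => Y ω * (eX x (X i ω) * stdNormalCDF (z ω + (X i ω - x / 2 * (X i ω ^ 2 + v i ω)) / s ω))
      - Y ω * (lam P F X x i ω * stdNormalCDF (z ω / Real.sqrt (1 + v i ω / s ω ^ 2)))) P := iA.sub iB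
  have iABC : Integrable (fun ω => (Y ω * (eX x (X i ω) * stdNormalCDF (z ω + (X i ω - x / 2 * (X i ω ^ 2 + v i ω)) / s ω))
      - Y ω * (lam P F X x i ω * stdNormalCDF (z ω / Real.sqrt (1 + v i ω / s ω ^ 2)))) - C ω) P := iAB.sub iC
  have eAB : ∫ ω, Y ω * (eX x (X i ω) * stdNormalCDF (z ω + (X i ω - x / 2 * (X i ω ^ 2 + v i ω)) / s ω)) ∂P
      - ∫ ω, Y ω * (lam P F X x i ω * stdNormalCDF (z ω / Real.sqrt (1 + v i ω / s ω ^ 2))) ∂P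
      = ∫ ω, ((Y ω * (eX x (X i ω) * stdNormalCDF (z ω + (X i ω - x / 2 * (X i ω ^ 2 + v i ω)) / s ω))
      - Y ω * (lam P F X x i ω * stdNormalCDF (z ω / Real.sqrt (1 + v i ω / s ω ^ 2)))) - C ω) ∂P := by
    rw [integral_sub iAB iC, integral_sub iA iB, zC, sub_zero]
  rw [eAB]
  have b1 : BM (F i) (fun ω => Y ω * bw ρ x (s ω)) := hY.mul bwb
  have j1 := (b1.mono (g.le i)).mul_integrable (g.int i)
  have j2 := ((b1.mul (g.vBM i)).mono (g.le i)).integrable (P := P)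
  have jj : Integrable (fun ω => 20000 * ((Y ω * bw ρ x (s ω)) * |X i ω| ^ (2 + ρ))
      + ((20010 + Ce) * γ ^ ρ) * ((Y ω * bw ρ x (s ω)) * v i ω)) P := (j1.const_mul _).add (j2.const_mul _)
  have hb0 : ∀ ω, 0 ≤ Y ω * bw ρ x (s ω) := fun ω => mul_nonneg (hY0 ω) (bw_nonneg hx0 (hs0 ω))
  have fin : ∫ ω, |(Y ω * (eX x (X i ω) * stdNormalCDF (z ω + (X i ω - x / 2 * (X i ω ^ 2 + v i ω)) / s ω))
      - Y ω * (lam P F X x i ω * stdNormalCDF (z ω / Real.sqrt (1 + v i ω / s ω ^ 2)))) - C ω| ∂P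
      ≤ ∫ ω, (20000 * ((Y ω * bw ρ x (s ω)) * |X i ω| ^ (2 + ρ))
      + ((20010 + Ce) * γ ^ ρ) * ((Y ω * bw ρ x (s ω)) * v i ω)) ∂P := by
    apply integral_mono_ae iABC.abs jj
    filter_upwards [g.lam_ae hx i] with ω hl
    have sp := step_point (δ' := 0) (X := X i ω) (z := z ω) rfl g.ρ0 g.ρ1 hγ hx0 hx.2.1 (g.v0 i ω) (g.vle i ω) (hsg ω)
      (g.lam_pos x i ω) (g.lam_bds x i ω).2 hl
    have := mul_le_mul_of_nonneg_left sp (hY0 ω)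
    rw [← abs_of_nonneg (hY0 ω), ← abs_mul, abs_of_nonneg (hY0 ω)] at this
    refine le_trans (le_of_eq ?_) (this.trans (le_of_eq ?_))
    · congr 1
      simp only [hC]
      have := hs0 ω
      field_simp
    · ring
  refine abs_integral_le_integral_abs.trans (fin.trans ?_)
  rw [integral_add (j1.const_mul _) (j2.const_mul _), integral_const_mul, integral_const_mul]
  have e3 := g.e3 i _ b1 hb0
  have ee : ∫ ω, Y ω * (v i ω * bw ρ x (s ω)) ∂P = ∫ ω, Y ω * bw ρ x (s ω) * v i ω ∂P := by
    congr 1; ext ω; ring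
  rw [ee]
  linarith

end Good
end Cr


namespace Cr

noncomputable def sS {Ω : Type} (v : ℕ → Ω → ℝ) (δ η : ℝ) (m : ℕ) (ω : Ω) : ℝ :=
  Real.sqrt (η ^ 2 + max 0 (1 + δ ^ 2 - ∑ j ∈ Finset.range m, v j ω))

noncomputable def MM {Ω : Type} (X v : ℕ → Ω → ℝ) (x : ℝ) (m : ℕ) (ω : Ω) : ℝ :=
  ∑ j ∈ Finset.range m, (X j ω - x / 2 * (X j ω ^ 2 + v j ω))

noncomputable def qq {Ω : Type} (X v : ℕ → Ω → ℝ) (δ η x a : ℝ) (m : ℕ) (ω : Ω) : ℝ :=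
  stdNormalCDF ((MM X v x m ω - a) / sS v δ η m ω)

lemma sq_le_imp {a b : ℝ} (h : a ^ 2 ≤ b ^ 2) (hb : 0 ≤ b) : a ≤ b := le_of_abs_le (by
  rw [← abs_of_nonneg hb]; exact sq_le_sq.1 h)

/-- Lindeberg constant -/
noncomputable def K0 : ℝ := 2 * (40010 + Ce)
lemma K0_ge : 1 ≤ K0 := by unfold K0; linarith [Ce_ge]

namespace Good

variable {Ω : Type} [mΩ : MeasurableSpace Ω] {P : Measure Ω} [IsProbabilityMeasure P]
  {F : ℕ → MeasurableSpace Ω} {n : ℕ} {X v : ℕ → Ω → ℝ} {ρ γ δ x η a : ℝ}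

lemma sS_ge (_g : Good P F n X v ρ γ δ) (hη : 0 < η) (m : ℕ) (ω : Ω) : η ≤ sS v δ η m ω := by
  unfold sS
  apply Real.le_sqrt_of_sq_le
  linarith [le_max_left 0 (1 + δ ^ 2 - ∑ j ∈ Finset.range m, v j ω)]

lemma sS_meas (g : Good P F n X v ρ γ δ) (η : ℝ) (m : ℕ) : Measurable[F m] (sS v δ η (m + 1)) := by
  unfold sS
  have h : Measurable[F m] (fun ω => ∑ j ∈ Finset.range (m + 1), v j ω) :=
    Finset.measurable_fun_sum _ fun j hj => (g.vm j).mono (g.mono (Nat.lt_succ_iff.1 (Finset.mem_range.1 hj))) le_rfl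
  exact (measurable_const.add (measurable_const.max (measurable_const.sub h))).sqrt

lemma MM_meas (g : Good P F n X v ρ γ δ) (x : ℝ) (m : ℕ) : Measurable[F m] (MM X v x m) := by
  unfold MM
  refine Finset.measurable_fun_sum _ fun j hj => ?_
  have hj' : j + 1 ≤ m := Finset.mem_range.1 hj
  have h1 : Measurable[F m] (X j) := (g.Xm j).mono (g.mono hj') le_rfl
  have h2 : Measurable[F m] (v j) := (g.vm j).mono (g.mono (by omega)) le_rfl
  exact h1.sub (((h1.pow_const 2).add h2).const_mul _)

lemma sum_le_ae (g : Good P F n X v ρ γ δ) : ∀ᵐ ω ∂P, ∀ m, m ≤ n → ∑ j ∈ Finset.range m, v j ω ≤ 1 + δ ^ 2 := by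
  filter_upwards [g.sum] with ω h m hm
  have h1 := (abs_le.1 h).2
  have h2 : ∑ j ∈ Finset.range m, v j ω ≤ ∑ j ∈ Finset.range n, v j ω :=
    Finset.sum_le_sum_of_subset_of_nonneg (by simpa using hm) fun i _ _ => g.v0 i ω
  linarith

lemma sS_rec (_g : Good P F n X v ρ γ δ) (η : ℝ) {ω : Ω} (h : ∀ m, m ≤ n → ∑ j ∈ Finset.range m, v j ω ≤ 1 + δ ^ 2)
    {m : ℕ} (hm : m < n) : sS v δ η m ω ^ 2 = sS v δ η (m + 1) ω ^ 2 + v m ω := by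
  unfold sS
  have h1 := h m hm.le
  have h2 := h (m + 1) hm
  rw [max_eq_right (by linarith), max_eq_right (by linarith), Real.sq_sqrt, Real.sq_sqrt,
    Finset.sum_range_succ]
  · ring
  · nlinarith
  · nlinarith

lemma lind_one (g : Good P F n X v ρ γ δ) (hx : SmallX x γ) (hη : γ ≤ η) (a : ℝ) {m : ℕ} (hm : m < n) :
    |∫ ω, ZZ P F X x (m + 1) ω * qq X v δ η x a (m + 1) ω ∂P - ∫ ω, ZZ P F X x m ω * qq X v δ η x a m ω ∂P|
      ≤ K0 * γ ^ ρ * ∫ ω, (v m ω * bw ρ x (sS v δ η (m + 1) ω)) * ZZ P F X x n ω ∂P := by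
  have hη0 : 0 < η := g.γ0.trans_le hη
  have hsg : ∀ ω, γ ≤ sS v δ η (m + 1) ω := fun ω => hη.trans (g.sS_ge hη0 _ ω)
  have hs0 : ∀ ω, 0 < sS v δ η (m + 1) ω := fun ω => g.γ0.trans_le (hsg ω)
  have hY : BM (F m) (fun ω => ZZ P F X x m ω * (lam P F X x m ω)⁻¹) := (g.ZZBM x m).mul (g.lamInvBM x m)
  have hY0 : ∀ ω, 0 ≤ ZZ P F X x m ω * (lam P F X x m ω)⁻¹ := fun ω =>
    mul_nonneg (g.ZZ_pos x m ω).le (inv_nonneg.2 (g.lam_pos x m ω).le)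
  have hz : Measurable[F m] (fun ω => (MM X v x m ω - a) / sS v δ η (m + 1) ω) :=
    ((g.MM_meas x m).sub measurable_const).div (g.sS_meas η m)
  have key := g.lind_step hx m hY hY0 hz (g.sS_meas η m) hsg
  have e1 : ∫ ω, ZZ P F X x (m + 1) ω * qq X v δ η x a (m + 1) ω ∂P
      = ∫ ω, ZZ P F X x m ω * (lam P F X x m ω)⁻¹ * (eX x (X m ω) * stdNormalCDF ((MM X v x m ω - a) / sS v δ η (m + 1) ω
        + (X m ω - x / 2 * (X m ω ^ 2 + v m ω)) / sS v δ η (m + 1) ω)) ∂P := by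
    congr 1; ext ω
    unfold qq
    have : (MM X v x (m + 1) ω - a) / sS v δ η (m + 1) ω = (MM X v x m ω - a) / sS v δ η (m + 1) ω
        + (X m ω - x / 2 * (X m ω ^ 2 + v m ω)) / sS v δ η (m + 1) ω := by
      rw [← add_div]; congr 1
      unfold MM; rw [Finset.sum_range_succ]; ring
    rw [this]
    simp only [ZZ, Finset.prod_range_succ, div_eq_mul_inv]; ring
  have e2 : ∫ ω, ZZ P F X x m ω * qq X v δ η x a m ω ∂P
      = ∫ ω, ZZ P F X x m ω * (lam P F X x m ω)⁻¹ * (lam P F X x m ω * stdNormalCDF ((MM X v x m ω - a) / sS v δ η (m + 1) ω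
        / Real.sqrt (1 + v m ω / sS v δ η (m + 1) ω ^ 2))) ∂P := by
    apply integral_congr_ae
    filter_upwards [g.sum_le_ae] with ω hω
    have hr := g.sS_rec η hω hm
    have hl := (g.lam_pos x m ω).ne'
    have hs := hs0 ω
    have : sS v δ η m ω = sS v δ η (m + 1) ω * Real.sqrt (1 + v m ω / sS v δ η (m + 1) ω ^ 2) := by
      rw [← Real.sqrt_sq (g.γ0.le.trans (hη.trans (g.sS_ge hη0 m ω))), hr]
      nth_rewrite 2 [← Real.sqrt_sq hs.le]
      rw [← Real.sqrt_mul (by positivity)]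
      congr 1; field_simp
    unfold qq
    rw [div_div, ← this]
    field_simp
  have isb : BM (F m) (fun ω => (sS v δ η (m + 1) ω)⁻¹) := by
    refine ⟨(g.sS_meas η m).inv, γ⁻¹, fun ω => ?_⟩
    rw [abs_of_pos (inv_pos.2 (hs0 ω))]; exact inv_anti₀ g.γ0 (hsg ω)
  have bwb : BM (F m) (fun ω => bw ρ x (sS v δ η (m + 1) ω)) := by
    have : (fun ω => bw ρ x (sS v δ η (m + 1) ω)) = fun ω => (1 + x) ^ (1 + ρ) * (sS v δ η (m + 1) ω)⁻¹
      + (sS v δ η (m + 1) ω)⁻¹ * ((sS v δ η (m + 1) ω)⁻¹ * (sS v δ η (m + 1) ω)⁻¹) := by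
      ext ω; unfold bw; have := hs0 ω; field_simp
    rw [this]; exact ((BM.const _).mul isb).add (isb.mul (isb.mul isb))
  have vb := (g.vBM m).mul bwb
  have e3 : ∫ ω, (v m ω * bw ρ x (sS v δ η (m + 1) ω)) * ZZ P F X x n ω ∂P
      = ∫ ω, (v m ω * bw ρ x (sS v δ η (m + 1) ω)) * ZZ P F X x m ω ∂P :=
    g.ZZ_mart hx hm.le vb
  have k1 : Integrable (fun ω => ZZ P F X x m ω * (lam P F X x m ω)⁻¹ * (v m ω * bw ρ x (sS v δ η (m + 1) ω))) P :=
    ((hY.mul vb).mono (g.le m)).integrable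
  have k2 : Integrable (fun ω => 2 * ((v m ω * bw ρ x (sS v δ η (m + 1) ω)) * ZZ P F X x m ω)) P :=
    (((vb.mul (g.ZZBM x m)).mono (g.le m)).integrable (P := P)).const_mul 2
  have e4 : ∫ ω, ZZ P F X x m ω * (lam P F X x m ω)⁻¹ * (v m ω * bw ρ x (sS v δ η (m + 1) ω)) ∂P
      ≤ ∫ ω, 2 * ((v m ω * bw ρ x (sS v δ η (m + 1) ω)) * ZZ P F X x m ω) ∂P := by
    apply integral_mono k1 k2
    intro ω
    show ZZ P F X x m ω * (lam P F X x m ω)⁻¹ * (v m ω * bw ρ x (sS v δ η (m + 1) ω))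
      ≤ 2 * ((v m ω * bw ρ x (sS v δ η (m + 1) ω)) * ZZ P F X x m ω)
    have h1 : (lam P F X x m ω)⁻¹ ≤ 2 := by
      have := inv_anti₀ (by norm_num) (g.lam_bds x m ω).1
      linarith
    have h2 : 0 ≤ (v m ω * bw ρ x (sS v δ η (m + 1) ω)) * ZZ P F X x m ω :=
      mul_nonneg (mul_nonneg (g.v0 m ω) (bw_nonneg hx.1 (hs0 ω))) (g.ZZ_pos x m ω).le
    have := mul_le_mul_of_nonneg_right h1 h2
    linarith
  rw [integral_const_mul] at e4
  rw [e1, e2, e3]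
  refine key.trans ?_
  unfold K0
  have c0 : 0 ≤ (40010 + Ce) * γ ^ ρ := by have := Ce_ge; have := g.gr_pos; positivity
  have := mul_le_mul_of_nonneg_left e4 c0
  linarith

lemma sum_bd (g : Good P F n X v ρ γ δ) (hη : γ ≤ η) {ω : Ω}
    (h : ∀ m, m ≤ n → ∑ j ∈ Finset.range m, v j ω ≤ 1 + δ ^ 2) :
    ∑ m ∈ Finset.range n, v m ω / sS v δ η (m + 1) ω ≤ 3 * sS v δ η 0 ω ∧
    ∑ m ∈ Finset.range n, v m ω / sS v δ η (m + 1) ω ≤ 2 / η ∧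
    ∑ m ∈ Finset.range n, v m ω / sS v δ η (m + 1) ω ^ 3 ≤ 6 / η := by
  have hη0 : 0 < η := g.γ0.trans_le hη
  have hge : ∀ m, η ≤ sS v δ η m ω := fun m => g.sS_ge hη0 m ω
  have hs : ∀ m, 0 < sS v δ η m ω := fun m => hη0.trans_le (hge m)
  have basic : ∀ m < n, v m ω = (sS v δ η m ω - sS v δ η (m + 1) ω) * (sS v δ η m ω + sS v δ η (m + 1) ω)
      ∧ sS v δ η (m + 1) ω ≤ sS v δ η m ω ∧ sS v δ η m ω ≤ 2 * sS v δ η (m + 1) ω := by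
    intro m hm
    have hr := g.sS_rec η h hm
    refine ⟨by linarith [hr], ?_, ?_⟩
    · apply sq_le_imp (by linarith [g.v0 m ω]) (hs m).le
    · apply sq_le_imp _ (by linarith [hs (m + 1)])
      have h1 := g.vle m ω
      have h2 : γ ^ 2 ≤ sS v δ η (m + 1) ω ^ 2 := pow_le_pow_left₀ g.γ0.le (hη.trans (hge _)) 2
      nlinarith
  refine ⟨?_, ?_, ?_⟩
  · calc _ ≤ ∑ m ∈ Finset.range n, (3 * sS v δ η m ω - 3 * sS v δ η (m + 1) ω) := by
          apply Finset.sum_le_sum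
          intro m hm
          obtain ⟨b1, b2, b3⟩ := basic m (Finset.mem_range.1 hm)
          rw [div_le_iff₀ (hs _), b1]
          have : 0 ≤ sS v δ η m ω - sS v δ η (m + 1) ω := by linarith
          nlinarith
      _ = 3 * sS v δ η 0 ω - 3 * sS v δ η n ω := Finset.sum_range_sub' (fun m => 3 * sS v δ η m ω) n
      _ ≤ _ := by linarith [hs n]
  · calc _ ≤ ∑ m ∈ Finset.range n, v m ω / η := by
          apply Finset.sum_le_sum
          intro m _
          exact div_le_div_of_nonneg_left (g.v0 m ω) hη0 (hge _)
      _ = (∑ m ∈ Finset.range n, v m ω) / η := (Finset.sum_div _ _ _).symm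
      _ ≤ 2 / η := by
          gcongr
          have := h n le_rfl
          nlinarith [g.δ0, g.δ1]
  · calc _ ≤ ∑ m ∈ Finset.range n, (6 / sS v δ η (m + 1) ω - 6 / sS v δ η m ω) := by
          apply Finset.sum_le_sum
          intro m hm
          obtain ⟨b1, b2, b3⟩ := basic m (Finset.mem_range.1 hm)
          have s1 := hs m
          have s2 := hs (m + 1)
          rw [b1]
          set s := sS v δ η m ω
          set s' := sS v δ η (m + 1) ω
          have hd : 0 ≤ s - s' := by linarith
          rw [show 6 / s' - 6 / s = (6 * (s - s') * s' ^ 2 / s) / s' ^ 3 by field_simp]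
          apply div_le_div_of_nonneg_right _ (by positivity)
          rw [le_div_iff₀ s1]
          have : (s + s') * s ≤ 6 * s' ^ 2 := by nlinarith
          nlinarith [mul_le_mul_of_nonneg_left this hd]
      _ = 6 / sS v δ η n ω - 6 / sS v δ η 0 ω := Finset.sum_range_sub (fun m => 6 / sS v δ η m ω) n
      _ ≤ 6 / sS v δ η n ω := by have := hs 0; have : 0 ≤ 6 / sS v δ η 0 ω := by positivity
                                 linarith
      _ ≤ 6 / η := div_le_div_of_nonneg_left (by norm_num) hη0 (hge n)

lemma lindeberg (g : Good P F n X v ρ γ δ) (hx : SmallX x γ) (hη : γ ≤ η) {B : ℝ}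
    (hB : (η ≤ 1 ∧ B = 6) ∨ B = 2 / η) (a : ℝ) :
    |∫ ω, ZZ P F X x n ω * qq X v δ η x a n ω ∂P - stdNormalCDF (-a / Real.sqrt (η ^ 2 + (1 + δ ^ 2)))|
      ≤ K0 * γ ^ ρ * ((1 + x) ^ (1 + ρ) * B + 6 / η) := by
  have hη0 : 0 < η := g.γ0.trans_le hη
  have hx0 := hx.1
  have tel : ∀ k ≤ n, |∫ ω, ZZ P F X x k ω * qq X v δ η x a k ω ∂P - stdNormalCDF (-a / Real.sqrt (η ^ 2 + (1 + δ ^ 2)))|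
      ≤ ∑ m ∈ Finset.range k, K0 * γ ^ ρ * ∫ ω, (v m ω * bw ρ x (sS v δ η (m + 1) ω)) * ZZ P F X x n ω ∂P := by
    intro k hk
    induction k with
    | zero =>
      have : ∀ ω, ZZ P F X x 0 ω * qq X v δ η x a 0 ω = stdNormalCDF (-a / Real.sqrt (η ^ 2 + (1 + δ ^ 2))) := by
        intro ω
        simp only [ZZ, qq, MM, sS, Finset.range_zero, Finset.prod_empty, Finset.sum_empty, one_mul, zero_sub, sub_zero]
        rw [max_eq_right (by positivity)]
      simp only [this]
      simp
    | succ k ih =>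
      rw [Finset.sum_range_succ]
      have h1 := ih (by omega)
      have h2 := g.lind_one hx hη a (m := k) (by omega)
      have h3 := abs_add_le (∫ ω, ZZ P F X x (k + 1) ω * qq X v δ η x a (k + 1) ω ∂P - ∫ ω, ZZ P F X x k ω * qq X v δ η x a k ω ∂P)
        (∫ ω, ZZ P F X x k ω * qq X v δ η x a k ω ∂P - stdNormalCDF (-a / Real.sqrt (η ^ 2 + (1 + δ ^ 2))))
      rw [sub_add_sub_cancel] at h3
      linarith
  refine (tel n le_rfl).trans ?_
  rw [← Finset.mul_sum]
  have c0 : 0 ≤ K0 * γ ^ ρ := by have := K0_ge; have := g.gr_pos; positivity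
  apply mul_le_mul_of_nonneg_left _ c0
  have hs0 : ∀ m ω, 0 < sS v δ η m ω := fun m ω => hη0.trans_le (g.sS_ge hη0 m ω)
  have ZB := (g.ZZBM x n).mono (g.le n)
  have ib : ∀ m, Integrable (fun ω => (v m ω * bw ρ x (sS v δ η (m + 1) ω)) * ZZ P F X x n ω) P := by
    intro m
    have isb : BM (F m) (fun ω => (sS v δ η (m + 1) ω)⁻¹) := by
      refine ⟨(g.sS_meas η m).inv, η⁻¹, fun ω => ?_⟩
      rw [abs_of_pos (inv_pos.2 (hs0 _ ω))]; exact inv_anti₀ hη0 (g.sS_ge hη0 _ _)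
    have bwb : BM (F m) (fun ω => bw ρ x (sS v δ η (m + 1) ω)) := by
      have : (fun ω => bw ρ x (sS v δ η (m + 1) ω)) = fun ω => (1 + x) ^ (1 + ρ) * (sS v δ η (m + 1) ω)⁻¹
        + (sS v δ η (m + 1) ω)⁻¹ * ((sS v δ η (m + 1) ω)⁻¹ * (sS v δ η (m + 1) ω)⁻¹) := by
        ext ω; unfold bw; have := hs0 (m + 1) ω; field_simp
      rw [this]; exact ((BM.const _).mul isb).add (isb.mul (isb.mul isb))
    exact ((((g.vBM m).mul bwb).mono (g.le m)).mul ZB).integrable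
  rw [← integral_finset_sum _ fun m _ => ib m]
  set T := (1 + x) ^ (1 + ρ) * B + 6 / η with hT
  have : ∫ ω, ∑ m ∈ Finset.range n, (v m ω * bw ρ x (sS v δ η (m + 1) ω)) * ZZ P F X x n ω ∂P
      ≤ ∫ ω, T * ZZ P F X x n ω ∂P := by
    apply integral_mono_ae (integrable_finset_sum _ fun m _ => ib m) (ZB.integrable.const_mul T)
    filter_upwards [g.sum_le_ae] with ω hω
    obtain ⟨s1, s2, s3⟩ := g.sum_bd hη hω
    rw [← Finset.sum_mul]
    apply mul_le_mul_of_nonneg_right _ (g.ZZ_pos x n ω).le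
    have e : ∑ m ∈ Finset.range n, v m ω * bw ρ x (sS v δ η (m + 1) ω)
        = (1 + x) ^ (1 + ρ) * ∑ m ∈ Finset.range n, v m ω / sS v δ η (m + 1) ω
          + ∑ m ∈ Finset.range n, v m ω / sS v δ η (m + 1) ω ^ 3 := by
      rw [Finset.mul_sum, ← Finset.sum_add_distrib]
      apply Finset.sum_congr rfl; intro m _
      unfold bw; ring
    rw [e, hT]
    refine add_le_add (mul_le_mul_of_nonneg_left ?_ (by positivity)) s3
    rcases hB with ⟨h1, h2⟩ | h2
    · rw [h2]
      refine s1.trans ?_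
      have : sS v δ η 0 ω ≤ 2 := by
        unfold sS
        rw [Real.sqrt_le_left (by norm_num)]
        simp only [Finset.range_zero, Finset.sum_empty, sub_zero]
        rw [max_eq_right (by positivity)]
        nlinarith [g.δ0, g.δ1]
      linarith
    · rw [h2]; exact s2
  rw [integral_const_mul, g.ZZ_one hx, mul_one] at this
  exact this

end Good
end Cr


namespace Cr

/-- error of the normal approximation under the tilted measure -/
noncomputable def E0 (ρ γ δ x : ℝ) : ℝ := γ ^ ρ * (1 + x) ^ (1 + ρ) + γ ^ (ρ / 2) + δ + x * δ ^ 2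

/-- centred statistic -/
noncomputable def TT {Ω : Type} (X : ℕ → Ω → ℝ) (n : ℕ) (x : ℝ) (ω : Ω) : ℝ :=
  ∑ i ∈ Finset.range n, X i ω - x / 2 * ∑ i ∈ Finset.range n, X i ω ^ 2 - x / 2

noncomputable def K1 : ℝ := 46 + 300 * K0
lemma K1_ge : 1 ≤ K1 := by unfold K1; linarith [K0_ge]

/-- indicator of `a ≤ t` -/
noncomputable def ii (a t : ℝ) : ℝ := if a ≤ t then 1 else 0
lemma ii_nonneg (a t : ℝ) : 0 ≤ ii a t := by unfold ii; split_ifs <;> norm_num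
lemma ii_le (a t : ℝ) : ii a t ≤ 1 := by unfold ii; split_ifs <;> norm_num
lemma ii_mono {a b s t : ℝ} (h : a ≤ s → b ≤ t) : ii a s ≤ ii b t := by
  unfold ii; split_ifs with h1 h2 <;> first | exact absurd (h h1) h2 | norm_num

lemma iiBM {Ω : Type} {m : MeasurableSpace Ω} {f : Ω → ℝ} (hf : Measurable f) (a : ℝ) : BM m (fun ω => ii a (f ω)) := by
  refine ⟨?_, 1, fun ω => by rw [abs_of_nonneg (ii_nonneg _ _)]; exact ii_le _ _⟩
  exact Measurable.ite (measurableSet_le measurable_const hf) measurable_const measurable_const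

namespace Good

variable {Ω : Type} [mΩ : MeasurableSpace Ω] {P : Measure Ω} [IsProbabilityMeasure P]
  {F : ℕ → MeasurableSpace Ω} {n : ℕ} {X v : ℕ → Ω → ℝ} {ρ γ δ x η a : ℝ}

lemma MM_meas' (g : Good P F n X v ρ γ δ) (x : ℝ) (m : ℕ) : Measurable (MM X v x m) :=
  (g.MM_meas x m).mono (g.le m) le_rfl

lemma TT_meas (g : Good P F n X v ρ γ δ) (x : ℝ) : Measurable (TT X n x) := by
  unfold TT
  have h1 : Measurable (fun ω => ∑ i ∈ Finset.range n, X i ω) := Finset.measurable_fun_sum _ fun i _ => g.Xmeas i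
  have h2 : Measurable (fun ω => ∑ i ∈ Finset.range n, X i ω ^ 2) :=
    Finset.measurable_fun_sum _ fun i _ => (g.Xmeas i).pow_const 2
  exact (h1.sub (h2.const_mul _)).sub measurable_const

lemma qqBM (g : Good P F n X v ρ γ δ) (x η a : ℝ) (m : ℕ) : BM mΩ (qq X v δ η x a m) := by
  refine ⟨cdf_cont.measurable.comp (((g.MM_meas' x m).sub measurable_const).div ?_), 1, fun ω => cdf_abs_le _⟩
  unfold sS
  have h : Measurable (fun ω => ∑ j ∈ Finset.range m, v j ω) :=
    Finset.measurable_fun_sum _ fun j _ => (g.vm j).mono (g.le _) le_rfl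
  exact (measurable_const.add (measurable_const.max (measurable_const.sub h))).sqrt

lemma ZB (g : Good P F n X v ρ γ δ) (x : ℝ) : BM mΩ (ZZ P F X x n) := (g.ZZBM x n).mono (g.le n)

lemma Zint_le_one (g : Good P F n X v ρ γ δ) (hx : SmallX x γ) {f : Ω → ℝ} (hf : BM mΩ f) (h : ∀ ω, f ω ≤ 1) :
    ∫ ω, ZZ P F X x n ω * f ω ∂P ≤ 1 := by
  rw [← g.ZZ_one hx n]
  apply integral_mono ((g.ZB x).mul hf).integrable (g.ZB x).integrable
  intro ω
  have := mul_le_mul_of_nonneg_left (h ω) (g.ZZ_pos x n ω).le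
  show ZZ P F X x n ω * f ω ≤ ZZ P F X x n ω
  linarith

lemma Zint_nonneg (g : Good P F n X v ρ γ δ) {f : Ω → ℝ} (h : ∀ ω, 0 ≤ f ω) :
    0 ≤ ∫ ω, ZZ P F X x n ω * f ω ∂P :=
  integral_nonneg fun ω => mul_nonneg (g.ZZ_pos x n ω).le (h ω)

lemma Zint_mono (g : Good P F n X v ρ γ δ) {f f' : Ω → ℝ} (hf : BM mΩ f) (hf' : BM mΩ f') (h : ∀ᵐ ω ∂P, f ω ≤ f' ω) :
    ∫ ω, ZZ P F X x n ω * f ω ∂P ≤ ∫ ω, ZZ P F X x n ω * f' ω ∂P := by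
  apply integral_mono_ae ((g.ZB x).mul hf).integrable ((g.ZB x).mul hf').integrable
  filter_upwards [h] with ω hω
  exact mul_le_mul_of_nonneg_left hω (g.ZZ_pos x n ω).le

lemma gam_half (g : Good P F n X v ρ γ δ) : γ ≤ γ ^ (ρ / 2) ∧ γ ^ ρ = γ ^ (ρ / 2) * γ ^ (ρ / 2) ∧ γ ^ (ρ / 2) ≤ 1 ∧ 0 < γ ^ (ρ / 2) := by
  have h0 := g.ρ0
  have h1 := g.ρ1
  have h2 := g.γ1
  refine ⟨?_, ?_, ?_, Real.rpow_pos_of_pos g.γ0 _⟩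
  · have := Real.rpow_le_rpow_of_exponent_ge g.γ0 (by linarith) (by linarith : ρ / 2 ≤ 1)
    rwa [Real.rpow_one] at this
  · rw [← Real.rpow_add g.γ0]; congr 1; ring
  · exact Real.rpow_le_one g.γ0.le (by linarith) (by linarith)

lemma E0_pos (g : Good P F n X v ρ γ δ) (hx : 0 ≤ x) : 0 < E0 ρ γ δ x := by
  unfold E0
  have := g.gam_half.2.2.2
  have := g.gr_pos
  have := g.δ0
  positivity

lemma kl_M (g : Good P F n X v ρ γ δ) (hx : SmallX x γ) (hη1 : γ ^ (ρ / 2) + δ ≤ 1) (a : ℝ) :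
    |∫ ω, ZZ P F X x n ω * ii a (MM X v x n ω) ∂P - (1 - stdNormalCDF a)|
      ≤ 45 * (γ ^ (ρ / 2) + δ) + 25 * (12 * K0 * (γ ^ ρ * (1 + x) ^ (1 + ρ) + γ ^ (ρ / 2))) := by
  obtain ⟨q1, q2, q3, q4⟩ := g.gam_half
  have hδ := g.δ0
  have hδ1 := g.δ1
  set η := γ ^ (ρ / 2) + δ with hη
  have hgη : γ ≤ η := by linarith
  have hη0 : 0 < η := by linarith
  have hK0 := K0_ge
  have hx0 := hx.1
  set s0 := Real.sqrt (η ^ 2 + (1 + δ ^ 2)) with hs0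
  have hs1 : 1 ≤ s0 := by
    rw [hs0]; apply Real.le_sqrt_of_sq_le; nlinarith
  set L := 6 * K0 * (γ ^ ρ * (1 + x) ^ (1 + ρ) + γ ^ (ρ / 2)) with hL
  have lin : ∀ a, |∫ ω, ZZ P F X x n ω * qq X v δ η x a n ω ∂P - stdNormalCDF (-a / s0)| ≤ L := by
    intro a
    refine (g.lindeberg hx hgη (Or.inl ⟨hη1, rfl⟩) a).trans ?_
    have : γ ^ ρ / η ≤ γ ^ (ρ / 2) := by
      rw [div_le_iff₀ hη0, q2]
      exact mul_le_mul_of_nonneg_left (by linarith) q4.le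
    have e : K0 * γ ^ ρ * ((1 + x) ^ (1 + ρ) * 6 + 6 / η) = 6 * K0 * (γ ^ ρ * (1 + x) ^ (1 + ρ) + γ ^ ρ / η) := by
      field_simp
    rw [e, hL]
    gcongr
  have hL0 : 0 ≤ L := (abs_nonneg _).trans (lin 0)
  -- smoothing
  have sm : |∫ ω, ZZ P F X x n ω * ii a (MM X v x n ω) ∂P - ∫ ω, ZZ P F X x n ω * qq X v δ η x a n ω ∂P|
      ≤ 12 * (∫ ω, ZZ P F X x n ω * qq X v δ η x (a - η) n ω ∂P - ∫ ω, ZZ P F X x n ω * qq X v δ η x (a + η) n ω ∂P) := by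
    have i1 : Integrable (fun ω => ZZ P F X x n ω * ii a (MM X v x n ω)) P := ((g.ZB x).mul (iiBM (g.MM_meas' x n) a)).integrable
    have i2 : ∀ a, Integrable (fun ω => ZZ P F X x n ω * qq X v δ η x a n ω) P := fun a => ((g.ZB x).mul (g.qqBM x η a n)).integrable
    have i12 : Integrable (fun ω => ZZ P F X x n ω * ii a (MM X v x n ω) - ZZ P F X x n ω * qq X v δ η x a n ω) P := i1.sub (i2 a)
    have i34 : Integrable (fun ω => 12 * (ZZ P F X x n ω * qq X v δ η x (a - η) n ω - ZZ P F X x n ω * qq X v δ η x (a + η) n ω)) P :=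
      ((i2 _).sub (i2 _)).const_mul 12
    rw [← integral_sub i1 (i2 a), ← integral_sub (i2 _) (i2 _), ← integral_const_mul]
    refine abs_integral_le_integral_abs.trans ?_
    apply integral_mono_ae i12.abs i34
    filter_upwards [g.sum] with ω hω
    set s := sS v δ η n ω with hs
    have s1 : η ≤ s := g.sS_ge hη0 n ω
    have s2 : s ≤ 2 * η := by
      rw [hs]; unfold sS
      rw [Real.sqrt_le_left (by linarith)]
      have h1 := (abs_le.1 hω).1
      have : max 0 (1 + δ ^ 2 - ∑ j ∈ Finset.range n, v j ω) ≤ 2 * δ ^ 2 := max_le (by positivity) (by linarith)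
      nlinarith
    have hs' : 0 < s := by linarith
    have hsm := smooth (z := (MM X v x n ω - a) / s) (h := η / s) (by rw [div_le_div_iff₀ (by norm_num) hs']; linarith)
    have e1 : (if 0 ≤ (MM X v x n ω - a) / s then (1:ℝ) else 0) = ii a (MM X v x n ω) := by
      unfold ii
      have : 0 ≤ (MM X v x n ω - a) / s ↔ a ≤ MM X v x n ω := by
        rw [le_div_iff₀ hs', zero_mul, sub_nonneg]
      simp only [this]
    rw [e1, ← add_div, ← sub_div] at hsm
    rw [show MM X v x n ω - a + η = MM X v x n ω - (a - η) by ring,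
      show MM X v x n ω - a - η = MM X v x n ω - (a + η) by ring] at hsm
    have := mul_le_mul_of_nonneg_left hsm (g.ZZ_pos x n ω).le
    rw [← abs_of_pos (g.ZZ_pos x n ω), ← abs_mul, abs_of_pos (g.ZZ_pos x n ω)] at this
    simp only [qq]
    rw [← mul_sub]
    refine this.trans (le_of_eq ?_)
    ring
  have l1 := abs_le.1 (lin (a - η))
  have l2 := abs_le.1 (lin (a + η))
  have l3 := abs_le.1 (lin a)
  have lip : stdNormalCDF (-(a - η) / s0) - stdNormalCDF (-(a + η) / s0) ≤ 2 * η := by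
    refine (le_abs_self _).trans ((cdf_lip _ _).trans ?_)
    rw [← sub_div, show -(a - η) - -(a + η) = 2 * η by ring, abs_of_nonneg (by positivity)]
    exact div_le_self (by linarith) hs1
  have ht : |stdNormalCDF (-a / s0) - (1 - stdNormalCDF a)| ≤ 21 * η := by
    set τ := η ^ 2 + δ ^ 2 with hτ
    have e : s0 = Real.sqrt (1 + τ) := by rw [hs0, hτ]; congr 1; ring
    have h := heat (-a) τ (by positivity)
    rw [← e, cdf_neg a] at h
    have h2 : |(-a) * phi (-a)| ≤ 1 := by rw [abs_mul, abs_of_pos (phi_pos _)]; exact abs_mul_phi _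
    have hτ1 : τ ≤ 2 * η ^ 2 := by rw [hτ]; nlinarith
    have hη2 : η ^ 2 ≤ η := by nlinarith
    have hτ0 : 0 ≤ τ := by positivity
    have hτ2 : τ ^ 2 ≤ 4 * η := by
      have : τ ^ 2 ≤ (2 * η ^ 2) ^ 2 := pow_le_pow_left₀ hτ0 hτ1 2
      nlinarith
    have h3 : |(-a) * phi (-a) * τ / 2| ≤ η := by
      rw [mul_div_assoc, abs_mul, abs_of_nonneg (by positivity : 0 ≤ τ / 2)]
      calc _ ≤ 1 * (τ / 2) := mul_le_mul_of_nonneg_right h2 (by positivity)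
        _ ≤ _ := by linarith
    have h4 := abs_le.1 h
    have h5 := abs_le.1 h3
    rw [abs_le]; constructor <;> linarith
  have ht' := abs_le.1 ht
  have sm' := abs_le.1 sm
  have e : 25 * (12 * K0 * (γ ^ ρ * (1 + x) ^ (1 + ρ) + γ ^ (ρ / 2))) = 50 * L := by rw [hL]; ring
  rw [e]
  rw [abs_le]; constructor <;> linarith

lemma MM_TT (g : Good P F n X v ρ γ δ) (hx : 0 ≤ x) : ∀ᵐ ω ∂P, |MM X v x n ω - TT X n x ω| ≤ x / 2 * δ ^ 2 := by
  filter_upwards [g.sum] with ω hω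
  have : MM X v x n ω - TT X n x ω = - (x / 2 * (∑ i ∈ Finset.range n, v i ω - 1)) := by
    unfold MM TT
    rw [Finset.sum_sub_distrib, ← Finset.mul_sum, Finset.sum_add_distrib]; ring
  rw [this, abs_neg, abs_mul, abs_of_nonneg (by positivity)]
  gcongr

/-- normal approximation under the tilted measure -/
lemma kl (g : Good P F n X v ρ γ δ) (hx : SmallX x γ) (a : ℝ) :
    |∫ ω, ZZ P F X x n ω * ii a (TT X n x ω) ∂P - (1 - stdNormalCDF a)| ≤ K1 * E0 ρ γ δ x := by
  obtain ⟨q1, q2, q3, q4⟩ := g.gam_half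
  have hδ := g.δ0
  have hx0 := hx.1
  have hK0 := K0_ge
  have hgr := g.gr_pos
  have hE := g.E0_pos hx0
  have hA : 0 ≤ γ ^ ρ * (1 + x) ^ (1 + ρ) := by positivity
  have hxd : 0 ≤ x * δ ^ 2 := by positivity
  by_cases hη : γ ^ (ρ / 2) + δ ≤ 1
  · set L := 45 * (γ ^ (ρ / 2) + δ) + 25 * (12 * K0 * (γ ^ ρ * (1 + x) ^ (1 + ρ) + γ ^ (ρ / 2))) with hL
    have h1 := abs_le.1 (g.kl_M hx hη (a - x / 2 * δ ^ 2))
    have h2 := abs_le.1 (g.kl_M hx hη (a + x / 2 * δ ^ 2))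
    have m1 : ∫ ω, ZZ P F X x n ω * ii a (TT X n x ω) ∂P ≤ ∫ ω, ZZ P F X x n ω * ii (a - x / 2 * δ ^ 2) (MM X v x n ω) ∂P := by
      apply g.Zint_mono (iiBM (g.TT_meas x) _) (iiBM (g.MM_meas' x n) _)
      filter_upwards [g.MM_TT hx0] with ω hω
      have := abs_le.1 hω
      exact ii_mono fun h => by linarith
    have m2 : ∫ ω, ZZ P F X x n ω * ii (a + x / 2 * δ ^ 2) (MM X v x n ω) ∂P ≤ ∫ ω, ZZ P F X x n ω * ii a (TT X n x ω) ∂P := by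
      apply g.Zint_mono (iiBM (g.MM_meas' x n) _) (iiBM (g.TT_meas x) _)
      filter_upwards [g.MM_TT hx0] with ω hω
      have := abs_le.1 hω
      exact ii_mono fun h => by linarith
    have l1 := abs_le.1 (cdf_lip (a - x / 2 * δ ^ 2) a)
    have l2 := abs_le.1 (cdf_lip (a + x / 2 * δ ^ 2) a)
    have e1 : |a - x / 2 * δ ^ 2 - a| = x * δ ^ 2 / 2 := by
      rw [show a - x / 2 * δ ^ 2 - a = -(x * δ ^ 2 / 2) by ring, abs_neg, abs_of_nonneg (by positivity)]
    have e2 : |a + x / 2 * δ ^ 2 - a| = x * δ ^ 2 / 2 := by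
      rw [show a + x / 2 * δ ^ 2 - a = x * δ ^ 2 / 2 by ring, abs_of_nonneg (by positivity)]
    rw [e1] at l1
    rw [e2] at l2
    have fin : L + x * δ ^ 2 / 2 ≤ K1 * E0 ρ γ δ x := by
      rw [hL]; unfold K1 E0
      have t1 := mul_nonneg (by linarith : 0 ≤ K0) hA
      have t2 := mul_nonneg (by linarith : 0 ≤ K0) q4.le
      have t3 := mul_nonneg (by linarith : 0 ≤ K0) hδ
      have t4 := mul_nonneg (by linarith : 0 ≤ K0) hxd
      linarith
    rw [abs_le]; constructor <;> linarith
  · push Not at hη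
    have h1 := g.Zint_le_one hx (iiBM (g.TT_meas x) a) (fun ω => ii_le _ _)
    have h2 := g.Zint_nonneg (x := x) (f := fun ω => ii a (TT X n x ω)) (fun ω => ii_nonneg _ _)
    have h3 := cdf_nonneg a
    have h4 := cdf_le_one a
    have h5 : 1 ≤ E0 ρ γ δ x := by unfold E0; linarith
    have h6 := K1_ge
    have h7 : 1 ≤ K1 * E0 ρ γ δ x := by nlinarith
    rw [abs_le]; constructor <;> linarith

end Good
end Cr


namespace Cr

lemma exp_tail_int {x : ℝ} (hx : 0 < x) : IntegrableOn (fun t => x * Real.exp (-(x * t))) (Set.Ioi 0) ∧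
    ∀ w, ∫ t in Set.Ioi w, x * Real.exp (-(x * t)) = Real.exp (-(x * w)) := by
  constructor
  · have := (exp_neg_integrableOn_Ioi 0 hx).const_mul x
    simp only [neg_mul] at this
    exact this
  · intro w
    have := integral_exp_mul_Ioi (a := -x) (by linarith) w
    rw [integral_const_mul]
    simp only [neg_mul] at this
    rw [this]; field_simp

lemma layer_point {x : ℝ} (hx : 0 < x) (w : ℝ) :
    ∫ t in Set.Ioi (0:ℝ), x * Real.exp (-(x * t)) * (ii 0 w - ii t w) = Real.exp (-(x * w)) * ii 0 w := by
  by_cases hw : 0 ≤ w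
  · have e : ∀ t, x * Real.exp (-(x * t)) * (ii 0 w - ii t w)
        = (Set.Ioi w).indicator (fun t => x * Real.exp (-(x * t))) t := by
      intro t
      unfold ii
      by_cases h : t ≤ w
      · simp [h, hw]
      · have h' : w < t := not_le.1 h
        simp [h', h, hw]
    simp only [e]
    rw [setIntegral_indicator measurableSet_Ioi, Set.Ioi_inter_Ioi, max_eq_right hw, (exp_tail_int hx).2]
    simp [ii, hw]
  · have e : ∀ t ∈ Set.Ioi (0:ℝ), x * Real.exp (-(x * t)) * (ii 0 w - ii t w) = 0 := by
      intro t ht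
      have ht' : (0:ℝ) < t := ht
      unfold ii
      rw [if_neg hw, if_neg (by linarith)]; ring
    rw [setIntegral_congr_fun measurableSet_Ioi e]
    simp [ii, hw]

lemma layer {α : Type} [MeasurableSpace α] {ν : Measure α} [SFinite ν] {Z f : α → ℝ} (hZ : Integrable Z ν)
    (hf : Measurable f) {x : ℝ} (hx : 0 < x) :
    ∫ a, Z a * (Real.exp (-(x * f a)) * ii 0 (f a)) ∂ν
      = ∫ t in Set.Ioi (0:ℝ), x * Real.exp (-(x * t)) * (∫ a, Z a * ii 0 (f a) ∂ν - ∫ a, Z a * ii t (f a) ∂ν) := by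
  have iZ : ∀ t, Integrable (fun a => Z a * ii t (f a)) ν := fun t => by
    have := (iiBM (m := _) hf t).mul_integrable hZ
    simpa [mul_comm] using this
  have jm : Measurable (fun p : α × ℝ => ii 0 (f p.1) - ii p.2 (f p.1)) := by
    have h1 : Measurable (fun p : α × ℝ => f p.1) := hf.comp measurable_fst
    refine Measurable.sub ?_ ?_
    · exact Measurable.ite (measurableSet_le measurable_const h1) measurable_const measurable_const
    · exact Measurable.ite (measurableSet_le measurable_snd h1) measurable_const measurable_const
  have base : Integrable (fun p : α × ℝ => Z p.1 * (x * Real.exp (-(x * p.2)))) (ν.prod (volume.restrict (Set.Ioi 0))) :=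
    hZ.mul_prod (exp_tail_int hx).1
  have jint : Integrable (fun p : α × ℝ => (ii 0 (f p.1) - ii p.2 (f p.1)) * (Z p.1 * (x * Real.exp (-(x * p.2)))))
      (ν.prod (volume.restrict (Set.Ioi 0))) := by
    refine base.bdd_mul jm.aestronglyMeasurable (c := 1) (Eventually.of_forall fun p => ?_)
    rw [Real.norm_eq_abs, abs_le]
    have := ii_nonneg 0 (f p.1); have := ii_le 0 (f p.1)
    have := ii_nonneg p.2 (f p.1); have := ii_le p.2 (f p.1)
    constructor <;> linarith
  have sw := integral_integral_swap (f := fun a t => (ii 0 (f a) - ii t (f a)) * (Z a * (x * Real.exp (-(x * t))))) jint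
  have e1 : ∀ a, ∫ t in Set.Ioi (0:ℝ), (ii 0 (f a) - ii t (f a)) * (Z a * (x * Real.exp (-(x * t))))
      = Z a * (Real.exp (-(x * f a)) * ii 0 (f a)) := by
    intro a
    rw [← layer_point hx, ← integral_const_mul]
    congr 1; ext t; ring
  have e2 : ∀ t, ∫ a, (ii 0 (f a) - ii t (f a)) * (Z a * (x * Real.exp (-(x * t)))) ∂ν
      = x * Real.exp (-(x * t)) * (∫ a, Z a * ii 0 (f a) ∂ν - ∫ a, Z a * ii t (f a) ∂ν) := by
    intro t
    rw [← integral_sub (iZ 0) (iZ t), ← integral_const_mul]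
    congr 1; ext a; ring
  simp only [e1, e2] at sw
  exact sw

lemma phi_ii (t : ℝ) : ∫ w, phi w * ii t w = 1 - stdNormalCDF t := by
  rw [cdf_compl]
  have : ∀ w, phi w * ii t w = (Set.Ici t).indicator phi w := by
    intro w; unfold ii
    by_cases h : t ≤ w <;> simp [h]
  simp only [this]
  rw [integral_indicator measurableSet_Ici, integral_Ici_eq_integral_Ioi]

/-- Laplace functional of the half line for the Gaussian law -/
noncomputable def JJ (x : ℝ) : ℝ := Real.exp (x ^ 2 / 2) * (1 - stdNormalCDF x)

lemma JJ_eq (x : ℝ) : ∫ w, phi w * (Real.exp (-(x * w)) * ii 0 w) = JJ x := by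
  unfold JJ
  rw [← J_identity]
  have : ∀ w, phi w * (Real.exp (-(x * w)) * ii 0 w) = (Set.Ici (0:ℝ)).indicator (fun w => Real.exp (-(x * w)) * phi w) w := by
    intro w; unfold ii
    by_cases h : 0 ≤ w <;> simp [h, mul_comm]
  simp only [this]
  rw [integral_indicator measurableSet_Ici, integral_Ici_eq_integral_Ioi]

lemma transfer {α : Type} [MeasurableSpace α] {ν : Measure α} [SFinite ν] {Z f : α → ℝ} (hZ : Integrable Z ν)
    (hZ0 : ∀ a, 0 ≤ Z a)
    (hf : Measurable f) {x E : ℝ} (hx : 0 ≤ x) (h : ∀ t, |∫ a, Z a * ii t (f a) ∂ν - (1 - stdNormalCDF t)| ≤ E) :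
    |∫ a, Z a * (Real.exp (-(x * f a)) * ii 0 (f a)) ∂ν - JJ x| ≤ 2 * E := by
  have hE : 0 ≤ E := (abs_nonneg _).trans (h 0)
  rcases hx.eq_or_lt with h0 | h0
  · rw [← h0]
    simp only [zero_mul, neg_zero, Real.exp_zero, one_mul, JJ]
    have := h 0
    norm_num
    linarith
  · rw [layer hZ hf h0, ← JJ_eq, layer (f := fun w => w) phi_int measurable_id' h0]
    simp only [phi_ii]
    obtain ⟨ex, ev⟩ := exp_tail_int h0
    set A := fun t => ∫ a, Z a * ii t (f a) ∂ν with hA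
    have iZ : ∀ t, Integrable (fun a => Z a * ii t (f a)) ν := fun t => by
      have := (iiBM (m := _) hf t).mul_integrable hZ
      simpa [mul_comm] using this
    have Am : Measurable A := by
      have : Antitone A := by
        intro s t hst
        apply integral_mono (iZ t) (iZ s)
        intro a
        exact mul_le_mul_of_nonneg_left (ii_mono fun h => hst.trans h) (hZ0 a)
      exact this.measurable
    have Ab : ∀ t, |A t| ≤ 1 + E := by
      intro t
      have h1 := abs_le.1 (h t)
      have h2 := cdf_nonneg t
      have h3 := cdf_le_one t
      rw [abs_le]; constructor <;> linarith
    have i1 : IntegrableOn (fun t => x * Real.exp (-(x * t)) * (A 0 - A t)) (Set.Ioi 0) := by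
      have : IntegrableOn (fun t => (A 0 - A t) * (x * Real.exp (-(x * t)))) (Set.Ioi 0) := by
        refine ex.bdd_mul (c := 2 * (1 + E)) ((measurable_const.sub Am).aestronglyMeasurable) (Eventually.of_forall fun t => ?_)
        rw [Real.norm_eq_abs]
        have := abs_le.1 (Ab 0)
        have := abs_le.1 (Ab t)
        rw [abs_le]; constructor <;> linarith
      exact this.congr_fun (fun t _ => mul_comm _ _) measurableSet_Ioi
    have i2 : IntegrableOn (fun t => x * Real.exp (-(x * t)) * (1 - stdNormalCDF 0 - (1 - stdNormalCDF t))) (Set.Ioi 0) := by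
      have : IntegrableOn (fun t => (1 - stdNormalCDF 0 - (1 - stdNormalCDF t)) * (x * Real.exp (-(x * t)))) (Set.Ioi 0) := by
        refine ex.bdd_mul (c := 2) (Continuous.aestronglyMeasurable (by have := cdf_cont; fun_prop)) (Eventually.of_forall fun t => ?_)
        rw [Real.norm_eq_abs]
        have := cdf_nonneg t
        have := cdf_le_one t
        have := cdf_nonneg 0
        have := cdf_le_one 0
        rw [abs_le]; constructor <;> linarith
      exact this.congr_fun (fun t _ => mul_comm _ _) measurableSet_Ioi
    rw [← integral_sub i1 i2]
    have i12 : IntegrableOn (fun t => x * Real.exp (-(x * t)) * (A 0 - A t)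
      - x * Real.exp (-(x * t)) * (1 - stdNormalCDF 0 - (1 - stdNormalCDF t))) (Set.Ioi 0) := i1.sub i2
    calc _ ≤ ∫ t in Set.Ioi 0, |x * Real.exp (-(x * t)) * (A 0 - A t)
          - x * Real.exp (-(x * t)) * (1 - stdNormalCDF 0 - (1 - stdNormalCDF t))| := abs_integral_le_integral_abs
      _ ≤ ∫ t in Set.Ioi 0, (2 * E) * (x * Real.exp (-(x * t))) := by
          apply integral_mono i12.abs (ex.const_mul _)
          intro t
          show |x * Real.exp (-(x * t)) * (A 0 - A t)
            - x * Real.exp (-(x * t)) * (1 - stdNormalCDF 0 - (1 - stdNormalCDF t))| ≤ (2 * E) * (x * Real.exp (-(x * t)))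
          have hp : 0 < x * Real.exp (-(x * t)) := by positivity
          rw [← mul_sub, abs_mul, abs_of_pos hp, mul_comm]
          apply mul_le_mul_of_nonneg_right _ hp.le
          have h1 := abs_le.1 (h 0)
          have h2 := abs_le.1 (h t)
          rw [abs_le]; constructor <;> linarith
      _ = 2 * E := by
          rw [integral_const_mul, ev 0]; simp

lemma JJ_lower {x : ℝ} (hx : 0 ≤ x) : 1 / (27 * (1 + x)) ≤ JJ x := by
  have h := mills hx
  unfold JJ
  have h2 := mul_le_mul_of_nonneg_left h (Real.exp_pos (x ^ 2 / 2)).le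
  refine le_trans (le_of_eq ?_) h2
  rw [← mul_div_assoc, ← Real.exp_add]
  rw [show x ^ 2 / 2 + -(x ^ 2) / 2 = 0 by ring, Real.exp_zero]

lemma JJ_tail (x : ℝ) : 1 - stdNormalCDF x = Real.exp (-(x ^ 2) / 2) * JJ x := by
  unfold JJ
  rw [← mul_assoc, ← Real.exp_add, show -(x ^ 2) / 2 + x ^ 2 / 2 = 0 by ring, Real.exp_zero, one_mul]

end Cr


namespace Cr

/-- relative error bound -/
noncomputable def R0 (ρ γ δ x : ℝ) : ℝ := x ^ (2 + ρ) * γ ^ ρ + x ^ 2 * δ ^ 2 + (1 + x) * (δ + γ ^ (ρ / 2))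

/-- self-normalised sum -/
noncomputable def WW {Ω : Type} (X : ℕ → Ω → ℝ) (n : ℕ) (ω : Ω) : ℝ :=
  (∑ i ∈ Finset.range n, X i ω) / Real.sqrt (∑ i ∈ Finset.range n, X i ω ^ 2)

noncomputable def pW {Ω : Type} [MeasurableSpace Ω] (P : Measure Ω) (X : ℕ → Ω → ℝ) (n : ℕ) (x : ℝ) : ℝ :=
  ∫ ω, ii x (WW X n ω) ∂P

lemma one_add_rpow {ρ x : ℝ} (h0 : 0 < ρ) (h1 : ρ ≤ 1) (hx : 0 ≤ x) : (1 + x) ^ (2 + ρ) ≤ 8 * (1 + x ^ (2 + ρ)) := by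
  have hm : 0 ≤ max 1 x := le_max_of_le_left zero_le_one
  have h2 : (1 + x) ^ (2 + ρ) ≤ (2 * max 1 x) ^ (2 + ρ) :=
    Real.rpow_le_rpow (by linarith) (by linarith [le_max_left 1 x, le_max_right 1 x]) (by linarith)
  have h3 : (2 * max 1 x) ^ (2 + ρ) = 2 ^ (2 + ρ) * (max 1 x) ^ (2 + ρ) := Real.mul_rpow (by norm_num) hm
  have h4 : (2:ℝ) ^ (2 + ρ) ≤ 8 := by
    have := Real.rpow_le_rpow_of_exponent_le (by norm_num : (1:ℝ) ≤ 2) (by linarith : 2 + ρ ≤ 3)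
    have e : (2:ℝ) ^ (3:ℝ) = 8 := by norm_num
    linarith
  have h5 : (max 1 x) ^ (2 + ρ) ≤ 1 + x ^ (2 + ρ) := by
    have hp : 0 ≤ x ^ (2 + ρ) := Real.rpow_nonneg hx _
    rcases le_total x 1 with h | h
    · rw [max_eq_left h, Real.one_rpow]; linarith
    · rw [max_eq_right h]; linarith
  have h6 : 0 ≤ (max 1 x) ^ (2 + ρ) := Real.rpow_nonneg hm _
  calc _ ≤ _ := h2
    _ = _ := h3
    _ ≤ 8 * (max 1 x) ^ (2 + ρ) := mul_le_mul_of_nonneg_right h4 h6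
    _ ≤ _ := by linarith

lemma exp_neg_two_le {u : ℝ} (h0 : 0 ≤ u) (h1 : u ≤ 1 / 2) : Real.exp (-(2 * u)) ≤ 1 - u := by
  have h2 : 1 + 2 * u ≤ Real.exp (2 * u) := by linarith [Real.add_one_le_exp (2 * u)]
  rw [Real.exp_neg]
  have h3 : (Real.exp (2 * u))⁻¹ ≤ (1 + 2 * u)⁻¹ := inv_anti₀ (by linarith) h2
  refine h3.trans ?_
  rw [inv_eq_one_div, div_le_iff₀ (by linarith)]
  nlinarith [mul_nonneg h0 (by linarith : 0 ≤ 1 - 2 * u)]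

lemma phi_ge_sixth {t : ℝ} (h0 : 0 ≤ t) (h1 : t ≤ 1) : 1 / 6 ≤ phi t := by
  unfold phi
  have h2 : 1 / 2 ≤ Real.exp (-(t ^ 2) / 2) := by
    have := Real.add_one_le_exp (-(t ^ 2) / 2)
    have : t ^ 2 ≤ 1 := by nlinarith
    linarith
  have := c0_ge
  calc (1:ℝ) / 6 = 1 / 3 * (1 / 2) := by norm_num
    _ ≤ _ := mul_le_mul this h2 (by norm_num) (by linarith)

namespace Good

variable {Ω : Type} [mΩ : MeasurableSpace Ω] {P : Measure Ω} [IsProbabilityMeasure P]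
  {F : ℕ → MeasurableSpace Ω} {n : ℕ} {X v : ℕ → Ω → ℝ} {ρ γ δ x η a : ℝ}

lemma R0_pos (g : Good P F n X v ρ γ δ) (hx : 0 ≤ x) : (1 + x) * (δ + γ ^ (ρ / 2)) ≤ R0 ρ γ δ x ∧ 0 < R0 ρ γ δ x ∧
    x ^ (2 + ρ) * γ ^ ρ + x ^ 2 * δ ^ 2 ≤ R0 ρ γ δ x := by
  unfold R0
  have h1 := g.gam_half.2.2.2
  have h2 := g.δ0
  have h3 : 0 ≤ x ^ (2 + ρ) * γ ^ ρ := mul_nonneg (Real.rpow_nonneg hx _) g.gr_pos.le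
  have h4 : 0 ≤ x ^ 2 * δ ^ 2 := by positivity
  have h5 : 0 < (1 + x) * (δ + γ ^ (ρ / 2)) := by positivity
  exact ⟨by linarith, by linarith, by linarith⟩

lemma E0_R0 (g : Good P F n X v ρ γ δ) (hx : 0 ≤ x) : (1 + x) * E0 ρ γ δ x ≤ 10 * R0 ρ γ δ x := by
  unfold E0 R0
  obtain ⟨q1, q2, q3, q4⟩ := g.gam_half
  have h1 := one_add_rpow g.ρ0 g.ρ1 hx
  have h2 : (1 + x) * (1 + x) ^ (1 + ρ) = (1 + x) ^ (2 + ρ) := by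
    have h := Real.rpow_add (by linarith : 0 < 1 + x) 1 (1 + ρ)
    rw [Real.rpow_one] at h
    rw [← h]; congr 1; ring
  have h3 : γ ^ ρ * (1 + x) ^ (2 + ρ) ≤ γ ^ ρ * (8 * (1 + x ^ (2 + ρ))) := mul_le_mul_of_nonneg_left h1 g.gr_pos.le
  have h4 : γ ^ ρ ≤ γ ^ (ρ / 2) := by rw [q2]; nlinarith
  have h5 : 0 ≤ x * γ ^ (ρ / 2) := by positivity
  have h6 : δ ^ 2 ≤ δ := by nlinarith [g.δ0, g.δ1]
  have h7 : x * δ ^ 2 ≤ x * δ := mul_le_mul_of_nonneg_left h6 hx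
  have h8 : 0 ≤ x * δ := mul_nonneg hx g.δ0
  have h9 : 0 ≤ x ^ (2 + ρ) * γ ^ ρ := mul_nonneg (Real.rpow_nonneg hx _) g.gr_pos.le
  have h10 : 0 ≤ x ^ 2 * δ ^ 2 := by positivity
  have h11 : (1 + x) * (γ ^ ρ * (1 + x) ^ (1 + ρ) + γ ^ (ρ / 2) + δ + x * δ ^ 2)
    = γ ^ ρ * ((1 + x) * (1 + x) ^ (1 + ρ)) + γ ^ (ρ / 2) + x * γ ^ (ρ / 2) + δ + x * δ + x * δ ^ 2 + x ^ 2 * δ ^ 2 := by ring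
  rw [h11, h2]
  have := g.δ0
  linarith

lemma WW_meas (g : Good P F n X v ρ γ δ) : Measurable (WW X n) := by
  unfold WW
  have h1 : Measurable (fun ω => ∑ i ∈ Finset.range n, X i ω) := Finset.measurable_fun_sum _ fun i _ => g.Xmeas i
  have h2 : Measurable (fun ω => ∑ i ∈ Finset.range n, X i ω ^ 2) :=
    Finset.measurable_fun_sum _ fun i _ => (g.Xmeas i).pow_const 2
  exact h1.div h2.sqrt

lemma sum_sq_zero {ω : Ω} (h : ∑ i ∈ Finset.range n, X i ω ^ 2 = 0) : ∑ i ∈ Finset.range n, X i ω = 0 := by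
  have h1 := (Finset.sum_eq_zero_iff_of_nonneg (fun i _ => sq_nonneg (X i ω))).1 h
  exact Finset.sum_eq_zero fun i hi => pow_eq_zero_iff two_ne_zero |>.1 (h1 i hi)

lemma WW_of_TT {ω : Ω} (hx : 0 ≤ x) (h : 0 ≤ TT X n x ω) : x ≤ WW X n ω := by
  unfold TT at h
  unfold WW
  have hV : 0 ≤ ∑ i ∈ Finset.range n, X i ω ^ 2 := Finset.sum_nonneg fun i _ => sq_nonneg _
  rcases hV.eq_or_lt with h0 | h0
  · rw [sum_sq_zero h0.symm] at h ⊢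
    rw [← h0] at h
    rw [zero_div]; linarith
  · have h1 := Real.sqrt_pos.2 h0
    rw [le_div_iff₀ h1]
    have h2 := Real.sq_sqrt hV
    set w := Real.sqrt (∑ i ∈ Finset.range n, X i ω ^ 2)
    rw [← h2] at h
    have h3 := mul_nonneg hx (sq_nonneg (w - 1))
    linarith

lemma expTBM (g : Good P F n X v ρ γ δ) (hx : 0 ≤ x) :
    BM mΩ (fun ω => Real.exp (-(x * TT X n x ω)) * ii 0 (TT X n x ω)) := by
  have hT := g.TT_meas x
  refine ⟨((hT.const_mul x).neg.exp).mul (iiBM hT 0).1, 1, fun ω => ?_⟩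
  show |Real.exp (-(x * TT X n x ω)) * ii 0 (TT X n x ω)| ≤ 1
  unfold ii
  split_ifs with h
  · have : Real.exp (-(x * TT X n x ω)) ≤ 1 := Real.exp_le_one_iff.2 (by have := mul_nonneg hx h; linarith)
    rw [mul_one, abs_of_pos (Real.exp_pos _)]; exact this
  · norm_num

lemma low_base (g : Good P F n X v ρ γ δ) (hx : SmallX x γ) :
    Real.exp (-(4 * Ce * (x ^ (2 + ρ) * γ ^ ρ)) - x ^ 2 / 2) *
      ∫ ω, ZZ P F X x n ω * (Real.exp (-(x * TT X n x ω)) * ii 0 (TT X n x ω)) ∂P ≤ pW P X n x := by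
  unfold pW
  rw [← integral_const_mul]
  have hT := g.TT_meas x
  have hb := g.expTBM hx.1
  apply integral_mono_ae (((g.ZB x).mul hb).integrable.const_mul _) (iiBM g.WW_meas x).integrable
  filter_upwards [g.ZZ_exp hx] with ω hω
  have h1 : ii 0 (TT X n x ω) ≤ ii x (WW X n ω) := ii_mono fun h => WW_of_TT hx.1 h
  refine le_trans ?_ h1
  have h2 := hω.2
  have hU : x * ∑ i ∈ Finset.range n, X i ω - x ^ 2 / 2 * ∑ i ∈ Finset.range n, X i ω ^ 2 = x * TT X n x ω + x ^ 2 / 2 := by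
    unfold TT; ring
  rw [hU, ← Real.exp_add] at h2
  have h3 := mul_le_mul_of_nonneg_right h2 (mul_nonneg (Real.exp_pos (-(x * TT X n x ω))).le (ii_nonneg 0 (TT X n x ω)))
  have h4 := mul_le_mul_of_nonneg_left h3 (Real.exp_pos (-(4 * Ce * (x ^ (2 + ρ) * γ ^ ρ)) - x ^ 2 / 2)).le
  refine h4.trans (le_of_eq ?_)
  rw [← mul_assoc, ← mul_assoc, ← Real.exp_add, ← Real.exp_add]
  convert one_mul _
  rw [Real.exp_eq_one_iff]; ring

lemma low_fine (g : Good P F n X v ρ γ δ) (hx : SmallX x γ) (hs : 18 * (K1 * E0 ρ γ δ x) ≤ 1) :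
    Real.exp (-((4 * Ce + 2340 * K1) * R0 ρ γ δ x)) * (1 - stdNormalCDF x) ≤ pW P X n x := by
  have hb := g.low_base hx
  have hx0 := hx.1
  set I := ∫ ω, ZZ P F X x n ω * (Real.exp (-(x * TT X n x ω)) * ii 0 (TT X n x ω)) ∂P with hI
  have hT := g.TT_meas x
  have ht := transfer (g.ZB x).integrable (fun ω => (g.ZZ_pos x n ω).le) hT hx0 (g.kl hx)
  rw [← hI] at ht
  set e := K1 * E0 ρ γ δ x with he
  have he0 : 0 < e := mul_pos (by linarith [K1_ge]) (g.E0_pos hx0)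
  have hJ := JJ_lower hx0
  have hx1 : 0 < 1 + x := by linarith
  have hJ0 : 0 < JJ x := lt_of_lt_of_le (by positivity) hJ
  rw [div_le_iff₀ (by positivity)] at hJ
  have hER : (1 + x) * e ≤ 10 * K1 * R0 ρ γ δ x := by
    have := mul_le_mul_of_nonneg_left (g.E0_R0 hx0) (by linarith [K1_ge] : 0 ≤ K1)
    rw [he]; linarith
  have key : JJ x * Real.exp (-(234 * ((1 + x) * e))) ≤ I := by
    rcases le_or_gt (4 * e) (JJ x) with hc | hc
    · have h1 : JJ x - 2 * e ≤ I := by linarith [(abs_le.1 ht).1]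
      have h2 : 2 * e / JJ x ≤ 1 / 2 := by rw [div_le_iff₀ hJ0]; linarith
      have h3 := exp_neg_two_le (by positivity) h2
      have h4 : e / JJ x ≤ 27 * (1 + x) * e := by
        rw [div_le_iff₀ hJ0]; nlinarith
      have h5 : Real.exp (-(234 * ((1 + x) * e))) ≤ Real.exp (-(2 * (2 * e / JJ x))) := by
        apply Real.exp_le_exp.2
        have : 2 * e / JJ x = 2 * (e / JJ x) := by ring
        have : 0 ≤ (1 + x) * e := by positivity
        linarith
      have h6 : JJ x * (1 - 2 * e / JJ x) = JJ x - 2 * e := by field_simp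
      calc _ ≤ JJ x * (1 - 2 * e / JJ x) := mul_le_mul_of_nonneg_left (h5.trans h3) hJ0.le
        _ ≤ I := by linarith
    · have i1 := ((g.ZB x).mul (iiBM hT 0)).integrable (P := P)
      have i2 := ((g.ZB x).mul (iiBM hT (18 * e))).integrable (P := P)
      have hb := g.expTBM hx0
      have h1 : ∫ ω, ZZ P F X x n ω * (Real.exp (-(x * (18 * e))) * (ii 0 (TT X n x ω) - ii (18 * e) (TT X n x ω))) ∂P ≤ I := by
        apply g.Zint_mono ((BM.const _).mul ((iiBM hT 0).sub (iiBM hT _))) hb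
        refine Eventually.of_forall fun ω => ?_
        unfold ii
        split_ifs with a1 a2 a2
        · simp only [sub_self, mul_zero, mul_one]; exact (Real.exp_pos _).le
        · rw [sub_zero, mul_one, mul_one]
          apply Real.exp_le_exp.2
          have := mul_le_mul_of_nonneg_left (not_le.1 a2).le hx0
          linarith
        · exfalso; linarith
        · norm_num
      have h2 : ∫ ω, ZZ P F X x n ω * (Real.exp (-(x * (18 * e))) * (ii 0 (TT X n x ω) - ii (18 * e) (TT X n x ω))) ∂P
          = Real.exp (-(x * (18 * e))) * (∫ ω, ZZ P F X x n ω * ii 0 (TT X n x ω) ∂P - ∫ ω, ZZ P F X x n ω * ii (18 * e) (TT X n x ω) ∂P) := by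
        rw [← integral_sub i1 i2, ← integral_const_mul]
        congr 1; ext ω; ring
      have k1 := (abs_le.1 (g.kl hx 0)).1
      have k2 := (abs_le.1 (g.kl hx (18 * e))).2
      rw [← he] at k1 k2
      have h3 := cdf_incr (a := 0) (b := 18 * e) (m := 1 / 6) (by linarith) (fun t a1 a2 => phi_ge_sixth a1 (by linarith))
      have h4 : JJ x / 4 ≤ ∫ ω, ZZ P F X x n ω * ii 0 (TT X n x ω) ∂P - ∫ ω, ZZ P F X x n ω * ii (18 * e) (TT X n x ω) ∂P := by
        linarith
      have h5 : 1 ≤ 108 * ((1 + x) * e) := by nlinarith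
      have h6 : Real.exp (-(216 * ((1 + x) * e))) ≤ 1 / 4 := by
        have : Real.exp (-(216 * ((1 + x) * e))) ≤ Real.exp (-2) := Real.exp_le_exp.2 (by linarith)
        have h7 : 4 * Real.exp (-2) ≤ 1 := by
          rw [Real.exp_neg, ← div_eq_mul_inv, div_le_one (Real.exp_pos _)]
          have := Real.add_one_le_exp (1:ℝ)
          have h8 : Real.exp 2 = Real.exp 1 * Real.exp 1 := by rw [← Real.exp_add]; norm_num
          nlinarith
        linarith
      have h7 : Real.exp (-(234 * ((1 + x) * e))) ≤ Real.exp (-(x * (18 * e))) * Real.exp (-(216 * ((1 + x) * e))) := by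
        rw [← Real.exp_add]; apply Real.exp_le_exp.2; linarith
      have hE := Real.exp_pos (-(x * (18 * e)))
      calc JJ x * Real.exp (-(234 * ((1 + x) * e))) ≤ JJ x * (Real.exp (-(x * (18 * e))) * (1 / 4)) :=
            mul_le_mul_of_nonneg_left (h7.trans (mul_le_mul_of_nonneg_left h6 hE.le)) hJ0.le
        _ = Real.exp (-(x * (18 * e))) * (JJ x / 4) := by ring
        _ ≤ _ := (mul_le_mul_of_nonneg_left h4 hE.le).trans (h2 ▸ h1)
  refine le_trans ?_ hb
  rw [JJ_tail]
  have hA : x ^ (2 + ρ) * γ ^ ρ ≤ R0 ρ γ δ x := by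
    have h4 : 0 ≤ x ^ 2 * δ ^ 2 := by positivity
    linarith [(g.R0_pos hx0).2.2]
  have h8 := mul_le_mul_of_nonneg_left key (Real.exp_pos (-(4 * Ce * (x ^ (2 + ρ) * γ ^ ρ)) - x ^ 2 / 2)).le
  refine le_trans ?_ h8
  rw [← mul_assoc, mul_comm (Real.exp _ * Real.exp _), mul_comm (Real.exp _) (JJ x * _), mul_assoc, ← Real.exp_add, ← Real.exp_add]
  apply mul_le_mul_of_nonneg_left _ hJ0.le
  apply Real.exp_le_exp.2
  have := mul_le_mul_of_nonneg_left hA (by linarith [Ce_ge] : 0 ≤ 4 * Ce)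
  linarith

end Good
end Cr


namespace Cr

noncomputable def C0 : ℝ := 8448 * K0
noncomputable def K2 : ℝ := 180 * K1 * C0 + 10 * (C0 + 3)
noncomputable def K3 : ℝ := 32 * Ce * (C0 + 3) * K2 + 3 / 2 * K2 + (C0 + 2) * K2
lemma C0_ge : 8448 ≤ C0 := by unfold C0; linarith [K0_ge]

lemma cdf_three : 1 - stdNormalCDF 3 ≤ 1 / 16 := by
  have h := cdf_tail (w := 3) (by norm_num)
  have h2 : Real.exp (-(3:ℝ) ^ 2 / 2) ≤ 1 / 8 := by
    have h3 : -(3:ℝ) ^ 2 / 2 = -(9 / 4 + 9 / 4) := by norm_num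
    rw [h3, Real.exp_neg, Real.exp_add, inv_eq_one_div]
    have := Real.add_one_le_exp (9 / 4 : ℝ)
    apply one_div_le_one_div_of_le (by norm_num)
    nlinarith
  linarith

lemma rpow_split {ρ p b : ℝ} (h0 : 0 < ρ) (h1 : ρ ≤ 1) (hp : 0 ≤ p) (hb : 0 ≤ b) :
    (p + b) ^ (1 + ρ) ≤ 4 * (p ^ (1 + ρ) + b ^ (1 + ρ)) := by
  have hm : 0 ≤ max p b := le_max_of_le_left hp
  have h2 : (p + b) ^ (1 + ρ) ≤ (2 * max p b) ^ (1 + ρ) :=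
    Real.rpow_le_rpow (by linarith) (by linarith [le_max_left p b, le_max_right p b]) (by linarith)
  have h3 : (2 * max p b) ^ (1 + ρ) = 2 ^ (1 + ρ) * (max p b) ^ (1 + ρ) := Real.mul_rpow (by norm_num) hm
  have h4 : (2:ℝ) ^ (1 + ρ) ≤ 4 := by
    have := Real.rpow_le_rpow_of_exponent_le (by norm_num : (1:ℝ) ≤ 2) (by linarith : 1 + ρ ≤ 2)
    have e : (2:ℝ) ^ (2:ℝ) = 4 := by norm_num
    linarith
  have h5 : (max p b) ^ (1 + ρ) ≤ p ^ (1 + ρ) + b ^ (1 + ρ) := by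
    have hp : 0 ≤ p ^ (1 + ρ) := Real.rpow_nonneg hp _
    have hp' : 0 ≤ b ^ (1 + ρ) := Real.rpow_nonneg hb _
    rcases le_total p b with h | h
    · rw [max_eq_right h]; linarith
    · rw [max_eq_left h]; linarith
  have h6 : 0 ≤ (max p b) ^ (1 + ρ) := Real.rpow_nonneg hm _
  calc _ ≤ _ := h2
    _ = _ := h3
    _ ≤ 4 * (max p b) ^ (1 + ρ) := mul_le_mul_of_nonneg_right h4 h6
    _ ≤ _ := by linarith

lemma rpow_one_add {ρ γ p : ℝ} (hγ : 0 ≤ γ) (hp : 0 < p) : γ ^ ρ * p ^ (1 + ρ) = (p * γ) ^ ρ * p := by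
  rw [Real.mul_rpow hp.le hγ, Real.rpow_add hp, Real.rpow_one]; ring

namespace Good

variable {Ω : Type} [mΩ : MeasurableSpace Ω] {P : Measure Ω} [IsProbabilityMeasure P]
  {F : ℕ → MeasurableSpace Ω} {n : ℕ} {X v : ℕ → Ω → ℝ} {ρ γ δ x η a : ℝ}

lemma conc (g : Good P F n X v ρ γ δ) {y b : ℝ} (hy : SmallX y γ) (hb : 24 ≤ b)
    (hL : K0 * γ ^ ρ * ((1 + y) ^ (1 + ρ) * (2 / (b / 24)) + 6 / (b / 24)) ≤ 1 / 16) :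
    1 / 2 ≤ ∫ ω, ZZ P F X y n ω * (2 * qq X v δ (b / 24) y (-(b / 4)) n ω - 1 - 2 * qq X v δ (b / 24) y (b / 4) n ω) ∂P := by
  have hη : 1 ≤ b / 24 := by linarith
  have l1 := g.lindeberg hy (by linarith [g.γ1]) (Or.inr rfl) (η := b / 24) (-(b / 4))
  have l2 := g.lindeberg hy (by linarith [g.γ1]) (Or.inr rfl) (η := b / 24) (b / 4)
  set s := Real.sqrt ((b / 24) ^ 2 + (1 + δ ^ 2)) with hs
  have hs0 : 0 < s := Real.sqrt_pos.2 (by positivity)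
  have hs1 : s ≤ 2 * (b / 24) := by
    apply Real.sqrt_le_iff.2 ⟨by linarith, ?_⟩
    nlinarith [g.δ0, g.δ1]
  have h3 : 3 ≤ b / 4 / s := by rw [le_div_iff₀ hs0]; linarith
  have c1 : 1 - 1 / 16 ≤ stdNormalCDF (-(-(b / 4)) / s) := by
    rw [neg_neg]; linarith [cdf_mono h3, cdf_three]
  have c2 : stdNormalCDF (-(b / 4) / s) ≤ 1 / 16 := by
    rw [neg_div, cdf_neg]; linarith [cdf_mono h3, cdf_three]
  have i1 := ((g.ZB y).mul (g.qqBM y (b / 24) (-(b / 4)) n)).integrable (P := P)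
  have i2 := ((g.ZB y).mul (g.qqBM y (b / 24) (b / 4) n)).integrable (P := P)
  have i3 := (g.ZB y).integrable (P := P)
  have e : ∫ ω, ZZ P F X y n ω * (2 * qq X v δ (b / 24) y (-(b / 4)) n ω - 1 - 2 * qq X v δ (b / 24) y (b / 4) n ω) ∂P
      = 2 * ∫ ω, ZZ P F X y n ω * qq X v δ (b / 24) y (-(b / 4)) n ω ∂P - ∫ ω, ZZ P F X y n ω ∂P
        - 2 * ∫ ω, ZZ P F X y n ω * qq X v δ (b / 24) y (b / 4) n ω ∂P := by
    have j1 : Integrable (fun ω => 2 * (ZZ P F X y n ω * qq X v δ (b / 24) y (-(b / 4)) n ω)) P := i1.const_mul 2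
    have j2 : Integrable (fun ω => 2 * (ZZ P F X y n ω * qq X v δ (b / 24) y (b / 4) n ω)) P := i2.const_mul 2
    have j3 : Integrable (fun ω => 2 * (ZZ P F X y n ω * qq X v δ (b / 24) y (-(b / 4)) n ω) - ZZ P F X y n ω) P := j1.sub i3
    rw [← integral_const_mul, ← integral_const_mul, ← integral_sub j1 i3, ← integral_sub j3 j2]
    congr 1; ext ω; ring
  rw [e, g.ZZ_one hy n]
  linarith [(abs_le.1 l1).1, (abs_le.1 l2).2]

set_option maxHeartbeats 1600000 in
lemma low_crude (g : Good P F n X v ρ γ δ) (hx0 : 0 ≤ x) {ε : ℝ} (hε : (1 + x) * γ ≤ ε)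
    (h1 : (C0 + 2) * C0 * ε ^ ρ ≤ 1) (h2 : 2 * Ce * (C0 + 3) * ε ≤ 1) (hs : 1 < 18 * (K1 * E0 ρ γ δ x)) :
    Real.exp (-(K3 * R0 ρ γ δ x)) * (1 - stdNormalCDF x) ≤ pW P X n x := by
  have hC := C0_ge
  have hCe := Ce_ge
  have hK0 := K0_ge
  have hK1 := K1_ge
  have hγ := g.γ0
  have hδ0 := g.δ0
  have hδ1 := g.δ1
  have hx1 : 0 < 1 + x := by linarith
  have hgr := g.gr_pos
  have hδ2 : δ ^ 2 ≤ 1 / 16 := by nlinarith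
  have hε0 : 0 < ε := lt_of_lt_of_le (by positivity) hε
  have hερ : 0 ≤ ε ^ ρ := Real.rpow_nonneg hε0.le _
  set a0 := γ ^ ρ * (1 + x) ^ (1 + ρ) with ha0
  have ha0p : 0 < a0 := mul_pos hgr (Real.rpow_pos_of_pos hx1 _)
  set b := C0 + 3 * x * δ ^ 2 + C0 * a0 with hb
  have hxd : 0 ≤ x * δ ^ 2 := by positivity
  have hCa : 0 ≤ C0 * a0 := by positivity
  have hb0 : C0 ≤ b := by linarith
  have hbp : 0 < b := by linarith
  -- size of b
  have hC1 : C0 * ε ^ ρ ≤ 1 := by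
    have : C0 * ε ^ ρ ≤ (C0 + 2) * (C0 * ε ^ ρ) := by
      have : 0 ≤ C0 * ε ^ ρ := by positivity
      nlinarith
    linarith
  have ha1 : C0 * a0 ≤ 1 + x := by
    rw [ha0, rpow_one_add hγ.le hx1]
    have h3 : ((1 + x) * γ) ^ ρ ≤ ε ^ ρ := Real.rpow_le_rpow (by positivity) hε g.ρ0.le
    have h4 : C0 * ((1 + x) * γ) ^ ρ ≤ 1 := (mul_le_mul_of_nonneg_left h3 (by linarith)).trans hC1
    have := mul_le_mul_of_nonneg_right h4 hx1.le
    linarith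
  have hxd1 : x * δ ^ 2 ≤ x / 16 := by have := mul_le_mul_of_nonneg_left hδ2 hx0; linarith
  have hb1 : b ≤ (C0 + 2) * (1 + x) := by
    have := mul_nonneg (by linarith : 0 ≤ C0) hx0
    linarith
  have hy1 : x + b ≤ (C0 + 3) * (1 + x) := by linarith
  have hyg : (x + b) * γ ≤ 1 / (2 * Ce) := by
    rw [le_div_iff₀ (by linarith)]
    have h3 := mul_le_mul_of_nonneg_right hy1 hγ.le
    have h4 := mul_le_mul_of_nonneg_left hε (by linarith : 0 ≤ C0 + 3)
    have h5 : (x + b) * γ ≤ (C0 + 3) * ε := by linarith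
    have := mul_le_mul_of_nonneg_right h5 (by linarith : 0 ≤ 2 * Ce)
    linarith
  have hyg0 : 0 ≤ (x + b) * γ := by positivity
  have hy : SmallX (x + b) γ := by
    refine ⟨by linarith, hyg.trans ?_, ?_⟩
    · rw [div_le_one (by linarith)]; linarith
    · have h3 : ((x + b) * γ) ^ 2 ≤ (1 / (2 * Ce)) ^ 2 := pow_le_pow_left₀ hyg0 hyg 2
      have h4 : Ce * (1 / (2 * Ce)) ^ 2 = 1 / (4 * Ce) := by field_simp; norm_num
      have h5 : 1 / (4 * Ce) ≤ 1 / 2 := one_div_le_one_div_of_le (by norm_num) (by linarith)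
      have := mul_le_mul_of_nonneg_left h3 (by linarith : 0 ≤ Ce)
      linarith
  have hyp : γ ^ ρ * (1 + (x + b)) ^ (1 + ρ) ≤ 8 * b / C0 := by
    have h3 := rpow_split g.ρ0 g.ρ1 hx1.le hbp.le
    have h4 : γ ^ ρ * b ^ (1 + ρ) ≤ b / C0 := by
      rw [rpow_one_add hγ.le hbp]
      have h5 : b * γ ≤ (C0 + 2) * ε := by
        have h3 := mul_le_mul_of_nonneg_right hb1 hγ.le
        have h4 := mul_le_mul_of_nonneg_left hε (by linarith : 0 ≤ C0 + 2)
        linarith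
      have h6 : (b * γ) ^ ρ ≤ (C0 + 2) * ε ^ ρ := by
        refine (Real.rpow_le_rpow (by positivity) h5 g.ρ0.le).trans ?_
        rw [Real.mul_rpow (by linarith) hε0.le]
        apply mul_le_mul_of_nonneg_right _ hερ
        have := Real.rpow_le_rpow_of_exponent_le (by linarith : 1 ≤ C0 + 2) g.ρ1
        rwa [Real.rpow_one] at this
      rw [le_div_iff₀ (by linarith)]
      have h7 : (b * γ) ^ ρ * C0 ≤ 1 := by
        have := mul_le_mul_of_nonneg_right h6 (by linarith : 0 ≤ C0)
        linarith
      have := mul_le_mul_of_nonneg_right h7 hbp.le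
      linarith
    have h5 : a0 ≤ b / C0 := by rw [le_div_iff₀ (by linarith)]; linarith
    have h6 := mul_le_mul_of_nonneg_left h3 hgr.le
    rw [show 1 + (x + b) = 1 + x + b by ring]
    have h7 : 8 * b / C0 = 4 * (b / C0 + b / C0) := by ring
    rw [h7]
    linarith
  have hgb : γ ^ ρ ≤ b / C0 := by
    rw [le_div_iff₀ (by linarith)]
    have : γ ^ ρ ≤ 1 := Real.rpow_le_one hγ.le (by linarith [g.γ1]) g.ρ0.le
    have := mul_le_mul_of_nonneg_right this (by linarith : 0 ≤ C0)
    linarith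
  have hL : K0 * γ ^ ρ * ((1 + (x + b)) ^ (1 + ρ) * (2 / (b / 24)) + 6 / (b / 24)) ≤ 1 / 16 := by
    have e1 : K0 * γ ^ ρ * ((1 + (x + b)) ^ (1 + ρ) * (2 / (b / 24)) + 6 / (b / 24))
      = 24 * K0 / b * (2 * (γ ^ ρ * (1 + (x + b)) ^ (1 + ρ)) + 6 * γ ^ ρ) := by field_simp
    rw [e1]
    have h3 : 2 * (γ ^ ρ * (1 + (x + b)) ^ (1 + ρ)) + 6 * γ ^ ρ ≤ 22 * (b / C0) := by
      have : 8 * b / C0 = 8 * (b / C0) := by ring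
      linarith
    have h4 := mul_le_mul_of_nonneg_left h3 (by positivity : 0 ≤ 24 * K0 / b)
    refine h4.trans (le_of_eq ?_)
    unfold C0
    field_simp; norm_num
  have hc := g.conc hy (by linarith) hL
  set y := x + b with hydef
  set f := fun ω => 2 * qq X v δ (b / 24) y (-(b / 4)) n ω - 1 - 2 * qq X v δ (b / 24) y (b / 4) n ω with hf
  set A := 4 * Ce * (y ^ (2 + ρ) * γ ^ ρ) with hA
  have hfB : BM mΩ f := (((BM.const 2).mul (g.qqBM y (b / 24) (-(b / 4)) n)).sub (BM.const 1)).sub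
    ((BM.const 2).mul (g.qqBM y (b / 24) (b / 4) n))
  have main : Real.exp (-A - y * b / 2 - y ^ 2 / 2) * ∫ ω, ZZ P F X y n ω * f ω ∂P ≤ pW P X n x := by
    unfold pW
    rw [← integral_const_mul]
    apply integral_mono_ae (((g.ZB y).mul hfB).integrable.const_mul _) (iiBM g.WW_meas x).integrable
    filter_upwards [g.ZZ_exp hy, g.MM_TT hy.1] with ω w1 w2
    show Real.exp (-A - y * b / 2 - y ^ 2 / 2) * (ZZ P F X y n ω * f ω) ≤ ii x (WW X n ω)
    have hs0 : 0 < sS v δ (b / 24) n ω := (by linarith : 0 < b / 24).trans_le (g.sS_ge (by linarith) n ω)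
    have q1 := cdf_nonneg ((MM X v y n ω - b / 4) / sS v δ (b / 24) n ω)
    have q2 := cdf_le_one ((MM X v y n ω - -(b / 4)) / sS v δ (b / 24) n ω)
    have hfe : f ω = 2 * stdNormalCDF ((MM X v y n ω - -(b / 4)) / sS v δ (b / 24) n ω) - 1
      - 2 * stdNormalCDF ((MM X v y n ω - b / 4) / sS v δ (b / 24) n ω) := rfl
    have hZ := g.ZZ_pos y n ω
    have hE := Real.exp_pos (-A - y * b / 2 - y ^ 2 / 2)
    rcases le_or_gt (f ω) 0 with hf0 | hf0
    · exact (mul_nonpos_of_nonneg_of_nonpos hE.le (mul_nonpos_of_nonneg_of_nonpos hZ.le hf0)).trans (ii_nonneg _ _)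
    · have m1 : MM X v y n ω < b / 4 := by
        by_contra hcon
        have := cdf_mono (div_nonneg (by linarith [not_lt.1 hcon] : 0 ≤ MM X v y n ω - b / 4) hs0.le)
        rw [cdf_zero] at this
        rw [hfe] at hf0; linarith
      have m2 : -(b / 4) < MM X v y n ω := by
        by_contra hcon
        have := cdf_mono (div_nonpos_of_nonpos_of_nonneg (by linarith [not_lt.1 hcon] : MM X v y n ω - -(b / 4) ≤ 0) hs0.le)
        rw [cdf_zero] at this
        rw [hfe] at hf0; linarith
      have m3 : y / 2 * δ ^ 2 ≤ b / 4 := by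
        have := mul_le_mul_of_nonneg_left hδ2 hbp.le
        rw [hydef]; linarith
      have m4 := abs_le.1 w2
      have t1 : -(b / 2) ≤ TT X n y ω := by linarith [m4.2]
      have t2 : TT X n y ω ≤ b / 2 := by linarith [m4.1]
      have hw : x ≤ WW X n ω := by
        apply WW_of_TT hx0
        have hV : 0 ≤ ∑ i ∈ Finset.range n, X i ω ^ 2 := Finset.sum_nonneg fun i _ => sq_nonneg _
        have := mul_nonneg hbp.le hV
        have e : TT X n x ω = TT X n y ω + b / 2 * ∑ i ∈ Finset.range n, X i ω ^ 2 + b / 2 := by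
          unfold TT; rw [hydef]; ring
        rw [e]; linarith
      have hii : ii x (WW X n ω) = 1 := by unfold ii; rw [if_pos hw]
      rw [hii]
      have w3 := w1.2
      have hU : y * ∑ i ∈ Finset.range n, X i ω - y ^ 2 / 2 * ∑ i ∈ Finset.range n, X i ω ^ 2 = y * TT X n y ω + y ^ 2 / 2 := by
        unfold TT; ring
      rw [hU, ← Real.exp_add, ← hA] at w3
      have w4 : ZZ P F X y n ω ≤ Real.exp (A + (y * b / 2 + y ^ 2 / 2)) := by
        refine w3.trans (Real.exp_le_exp.2 ?_)
        have := mul_le_mul_of_nonneg_left t2 hy.1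
        linarith
      have hf1 : f ω ≤ 1 := by rw [hfe]; linarith
      calc _ ≤ Real.exp (-A - y * b / 2 - y ^ 2 / 2) * (ZZ P F X y n ω * 1) := by gcongr
        _ ≤ Real.exp (-A - y * b / 2 - y ^ 2 / 2) * Real.exp (A + (y * b / 2 + y ^ 2 / 2)) := by
          rw [mul_one]; exact mul_le_mul_of_nonneg_left w4 hE.le
        _ = 1 := by rw [← Real.exp_add, Real.exp_eq_one_iff]; ring
  have fin1 : Real.exp (-A - y * b / 2 - y ^ 2 / 2) * (1 / 2) ≤ pW P X n x :=
    (mul_le_mul_of_nonneg_left hc (Real.exp_pos _).le).trans main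
  refine le_trans ?_ fin1
  -- exponents
  have hER := g.E0_R0 hx0
  have hE0 : (1 + x) ≤ 180 * K1 * R0 ρ γ δ x := by
    have h3 := mul_le_mul_of_nonneg_left hER (by linarith : 0 ≤ 18 * K1)
    have h4 := mul_le_mul_of_nonneg_left hs.le hx1.le
    linarith
  have hbx : b * (1 + x) ≤ K2 * R0 ρ γ δ x := by
    have h3 : a0 + x * δ ^ 2 ≤ E0 ρ γ δ x := by
      unfold E0; rw [← ha0]
      linarith [g.gam_half.2.2.2]
    have h4 : b ≤ C0 + (C0 + 3) * E0 ρ γ δ x := by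
      have h5 := mul_le_mul_of_nonneg_left h3 (by linarith : 0 ≤ C0 + 3)
      have := mul_nonneg (by linarith : 0 ≤ C0) hxd
      linarith
    have h5 := mul_le_mul_of_nonneg_right h4 hx1.le
    have h6 := mul_le_mul_of_nonneg_left hE0 (by linarith : 0 ≤ C0)
    have h7 := mul_le_mul_of_nonneg_left hER (by linarith : 0 ≤ C0 + 3)
    unfold K2
    linarith
  have hbx0 : 0 ≤ b * (1 + x) := by positivity
  have p1 : x * b ≤ K2 * R0 ρ γ δ x := by linarith
  have p2 : b ^ 2 ≤ (C0 + 2) * (K2 * R0 ρ γ δ x) := by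
    have h3 := mul_le_mul_of_nonneg_left hb1 hbp.le
    have h4 := mul_le_mul_of_nonneg_left hbx (by linarith : 0 ≤ C0 + 2)
    linarith
  have p3 : A ≤ 32 * Ce * (C0 + 3) * (K2 * R0 ρ γ δ x) := by
    have hy0 : 0 < y := by linarith
    have h3 : y ^ (2 + ρ) * γ ^ ρ = y * (γ ^ ρ * y ^ (1 + ρ)) := by
      have h := Real.rpow_add hy0 1 (1 + ρ)
      rw [Real.rpow_one] at h
      rw [show (2 + ρ) = 1 + (1 + ρ) by ring, h]; ring
    have h4 : γ ^ ρ * y ^ (1 + ρ) ≤ 8 * b / C0 := by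
      refine le_trans (mul_le_mul_of_nonneg_left ?_ hgr.le) hyp
      exact Real.rpow_le_rpow hy0.le (by linarith) (by linarith [g.ρ0])
    have h5 : 8 * b / C0 ≤ 8 * b := by rw [div_le_iff₀ (by linarith)]; nlinarith
    have h6 : y ^ (2 + ρ) * γ ^ ρ ≤ (C0 + 3) * (1 + x) * (8 * b) := by
      rw [h3]
      exact mul_le_mul hy1 (h4.trans h5) (mul_nonneg hgr.le (Real.rpow_nonneg hy0.le _)) (by positivity)
    have h7 := mul_le_mul_of_nonneg_left h6 (by linarith : 0 ≤ 4 * Ce)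
    have h8 := mul_le_mul_of_nonneg_left hbx (by positivity : 0 ≤ 32 * Ce * (C0 + 3))
    rw [hA]; linarith
  have ht := cdf_tail hx0
  have h9 : -(K3 * R0 ρ γ δ x) + -(x ^ 2) / 2 ≤ -A - y * b / 2 - y ^ 2 / 2 := by
    unfold K3
    rw [hydef]
    linarith
  calc _ ≤ Real.exp (-(K3 * R0 ρ γ δ x)) * (Real.exp (-(x ^ 2) / 2) / 2) := mul_le_mul_of_nonneg_left ht (Real.exp_pos _).le
    _ = Real.exp (-(K3 * R0 ρ γ δ x) + -(x ^ 2) / 2) * (1 / 2) := by rw [Real.exp_add]; ring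
    _ ≤ _ := mul_le_mul_of_nonneg_right (Real.exp_le_exp.2 h9) (by norm_num)

end Good
end Cr


namespace Cr

open Classical in
/-- constant of the quadratic exponential expansion -/
noncomputable def Cq (a b : ℝ) : ℝ := if h : 0 < b then (exp_quad a b h).choose else 0

lemma Cq_nonneg {a b : ℝ} (hb : 0 < b) : 0 ≤ Cq a b := by
  unfold Cq; rw [dif_pos hb]; exact (exp_quad a b hb).choose_spec.1

lemma Cq_spec {a b : ℝ} (hb : 0 < b) {ρ : ℝ} (y : ℝ) (h0 : 0 ≤ ρ) (h1 : ρ ≤ 1) :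
    |Real.exp (a * y - b * y ^ 2) - 1 - a * y - (a ^ 2 / 2 - b) * y ^ 2| ≤ Cq a b * |y| ^ (2 + ρ) := by
  unfold Cq; rw [dif_pos hb]; exact (exp_quad a b hb).choose_spec.2 ρ y h0 h1

lemma Cq_scale {a b : ℝ} (hb : 0 < b) {ρ l : ℝ} (y : ℝ) (h0 : 0 ≤ ρ) (h1 : ρ ≤ 1) (hl : 0 ≤ l) :
    |Real.exp (a * (l * y) - b * (l * y) ^ 2) - (1 + a * l * y + (a ^ 2 / 2 - b) * l ^ 2 * y ^ 2)|
      ≤ Cq a b * l ^ (2 + ρ) * |y| ^ (2 + ρ) := by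
  have h := Cq_spec (a := a) hb (l * y) h0 h1
  rw [abs_mul, abs_of_nonneg hl, Real.mul_rpow hl (abs_nonneg _)] at h
  refine le_trans (le_of_eq ?_) (h.trans (le_of_eq (by ring)))
  congr 1; ring

lemma quad_bdd {a b : ℝ} (hb : 0 < b) (w : ℝ) : a * w - b * w ^ 2 ≤ a ^ 2 / (4 * b) := by
  rw [le_div_iff₀ (by linarith)]
  nlinarith [sq_nonneg (a - 2 * b * w)]

namespace Good

variable {Ω : Type} [mΩ : MeasurableSpace Ω] {P : Measure Ω} [IsProbabilityMeasure P]
  {F : ℕ → MeasurableSpace Ω} {n : ℕ} {X v : ℕ → Ω → ℝ} {ρ γ δ x η a : ℝ}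

lemma expsumBM (g : Good P F n X v ρ γ δ) {f : ℝ → ℝ} (hf : Measurable f) {B : ℝ} (hB : ∀ y, f y ≤ B) (m : ℕ) :
    BM mΩ (fun ω => Real.exp (∑ i ∈ Finset.range m, f (X i ω))) := by
  have h := (g.expBM hf hB 0 m).mono (g.le m)
  simpa using h

lemma gl_sum (g : Good P F n X v ρ γ δ) {f : ℝ → ℝ} (hf : Measurable f) {B : ℝ} (hB : ∀ y, f y ≤ B)
    {α β κ : ℝ} (hκ : 0 ≤ κ)
    (h : ∀ y, Real.exp (f y) ≤ 1 + α * y + β * y ^ 2 + κ * |y| ^ (2 + ρ)) :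
    ∫ ω, Real.exp (∑ i ∈ Finset.range n, f (X i ω)) ∂P ≤ Real.exp (β + |β| * δ ^ 2 + 2 * κ * γ ^ ρ) := by
  have h1 := g.gl_upper hf hB hκ h n
  set c := β + κ * γ ^ ρ with hc
  have hk : 0 ≤ κ * γ ^ ρ := mul_nonneg hκ g.gr_pos.le
  have i1 := ((g.expBM hf hB c n).mono (g.le n)).integrable (P := P)
  have hd : δ ^ 2 ≤ 1 := by nlinarith [g.δ0, g.δ1]
  calc ∫ ω, Real.exp (∑ i ∈ Finset.range n, f (X i ω)) ∂P
      ≤ ∫ ω, Real.exp (β + |β| * δ ^ 2 + 2 * κ * γ ^ ρ) * Real.exp (∑ i ∈ Finset.range n, (f (X i ω) - c * v i ω)) ∂P := by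
        apply integral_mono_ae (g.expsumBM hf hB n).integrable (i1.const_mul _)
        filter_upwards [g.sum] with ω hω
        rw [← Real.exp_add]
        apply Real.exp_le_exp.2
        rw [Finset.sum_sub_distrib, ← Finset.mul_sum]
        have h2 : c * (∑ i ∈ Finset.range n, v i ω - 1) ≤ |c| * δ ^ 2 :=
          (le_abs_self _).trans (by rw [abs_mul]; exact mul_le_mul_of_nonneg_left hω (abs_nonneg _))
        have h3 : |c| ≤ |β| + κ * γ ^ ρ := (abs_add_le _ _).trans (by rw [abs_of_nonneg hk])
        have h4 := mul_le_mul_of_nonneg_right h3 (sq_nonneg δ)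
        have h5 := mul_le_mul_of_nonneg_left hd hk
        linarith
    _ ≤ Real.exp (β + |β| * δ ^ 2 + 2 * κ * γ ^ ρ) * 1 := by
        rw [integral_const_mul]; exact mul_le_mul_of_nonneg_left h1 (Real.exp_pos _).le
    _ = _ := mul_one _

lemma eq_up (g : Good P F n X v ρ γ δ) {a b l : ℝ} (hb : 0 < b) (hl : 0 ≤ l) :
    BM mΩ (fun ω => Real.exp (∑ i ∈ Finset.range n, (a * (l * X i ω) - b * (l * X i ω) ^ 2))) ∧
    ∫ ω, Real.exp (∑ i ∈ Finset.range n, (a * (l * X i ω) - b * (l * X i ω) ^ 2)) ∂P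
      ≤ Real.exp ((a ^ 2 / 2 - b) * l ^ 2 + |(a ^ 2 / 2 - b) * l ^ 2| * δ ^ 2 + 2 * (Cq a b * l ^ (2 + ρ)) * γ ^ ρ) := by
  have hf : Measurable (fun y : ℝ => a * (l * y) - b * (l * y) ^ 2) := by fun_prop
  refine ⟨g.expsumBM hf (fun y => quad_bdd hb (l * y)) n, ?_⟩
  refine g.gl_sum hf (fun y => quad_bdd hb (l * y)) (α := a * l)
    (mul_nonneg (Cq_nonneg hb) (Real.rpow_nonneg hl _)) (fun y => ?_)
  have := (abs_le.1 (Cq_scale (a := a) hb y g.ρ0.le g.ρ1 hl)).2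
  linarith

lemma lam_pow (g : Good P F n X v ρ γ δ) {l : ℝ} (hl : 0 < l) : l ^ (2 + ρ) * γ ^ ρ = l ^ 2 * (l * γ) ^ ρ := by
  rw [Real.rpow_add hl, Real.mul_rpow hl.le g.γ0.le, Real.rpow_two]; ring

set_option maxHeartbeats 800000 in
/-- lower bound by a second-moment argument -/
lemma low_PZ (g : Good P F n X v ρ γ δ) {u c : ℝ} (hu : 0 < u) (hu1 : u ≤ 1) (hc : 0 < c) (hcγ : c ≤ γ)
    (hC1 : Cq 1 (1 / 4) * u ^ ρ ≤ 1 / 8) (hC2 : Cq 2 (1 / 2) * u ^ ρ ≤ 1 / 2) (hxu : 7 * (x * γ) ≤ u) :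
    4 * ((4 * u) ^ 2 / 80) ^ 2 * Real.exp (-(3 * (u / c) ^ 2)) ≤ pW P X n x := by
  have hγ := g.γ0
  set l := u / γ with hl
  have hl0 : 0 < l := by positivity
  have hlγ : l * γ = u := by rw [hl]; field_simp
  have hl1 : 4 * u ≤ l := by rw [hl, le_div_iff₀ hγ]; nlinarith [g.γ1]
  have hl2 : l ≤ u / c := by rw [hl]; exact div_le_div_of_nonneg_left hu.le hc hcγ
  have hpow := g.lam_pow hl0
  rw [hlγ] at hpow
  have hl2p : 0 < l ^ 2 := by positivity
  have hδ2 : δ ^ 2 ≤ 1 / 16 := by nlinarith [g.δ0, g.δ1]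
  set G := fun ω => ∑ i ∈ Finset.range n, (1 * (l * X i ω) - 1 / 4 * (l * X i ω) ^ 2) with hG
  have B1 := (g.eq_up (a := 1) (b := 1 / 4) (by norm_num) hl0.le).1
  have U2 := g.eq_up (a := 2) (b := 1 / 2) (by norm_num) hl0.le
  have e2 : ∀ ω, ∑ i ∈ Finset.range n, (2 * (l * X i ω) - 1 / 2 * (l * X i ω) ^ 2) = 2 * G ω := by
    intro ω; rw [hG]; simp only []; rw [Finset.mul_sum]; apply Finset.sum_congr rfl; intro i _; ring
  simp only [e2] at U2
  have E2 : ∫ ω, Real.exp (2 * G ω) ∂P ≤ Real.exp (3 * l ^ 2) := by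
    refine U2.2.trans (Real.exp_le_exp.2 ?_)
    have : (2:ℝ) ^ 2 / 2 - 1 / 2 = 3 / 2 := by norm_num
    rw [this, abs_of_pos (by positivity)]
    have h1 : 2 * (Cq 2 (1 / 2) * l ^ (2 + ρ)) * γ ^ ρ = 2 * l ^ 2 * (Cq 2 (1 / 2) * u ^ ρ) := by
      calc _ = 2 * Cq 2 (1 / 2) * (l ^ (2 + ρ) * γ ^ ρ) := by ring
        _ = _ := by rw [hpow]; ring
    rw [h1]
    have h2 := mul_le_mul_of_nonneg_left hC2 (by positivity : 0 ≤ 2 * l ^ 2)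
    have h3 := mul_le_mul_of_nonneg_left hδ2 (by positivity : 0 ≤ 3 / 2 * l ^ 2)
    linarith
  have E1 : Real.exp (l ^ 2 / 20) ≤ ∫ ω, Real.exp (G ω) ∂P := by
    have hf : Measurable (fun y : ℝ => 1 * (l * y) - 1 / 4 * (l * y) ^ 2) := by fun_prop
    have hκ : 0 ≤ Cq 1 (1 / 4) * l ^ (2 + ρ) := mul_nonneg (Cq_nonneg (by norm_num)) (Real.rpow_nonneg hl0.le _)
    have h0 := g.gl_lower hf (fun y => quad_bdd (a := 1) (b := 1 / 4) (by norm_num) (l * y)) (α := 1 * l)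
      (β := ((1:ℝ) ^ 2 / 2 - 1 / 4) * l ^ 2) (c := l ^ 2 / 16) hκ
      (fun y => by
        have := (abs_le.1 (Cq_scale (a := 1) (b := 1 / 4) (by norm_num) y g.ρ0.le g.ρ1 hl0.le)).1
        linarith)
      (fun w w0 w1 => by
        have t0 : 0 ≤ l ^ 2 / 16 * w := by positivity
        have t1 : l ^ 2 / 16 * w ≤ 1 := by
          have : l ^ 2 * w ≤ l ^ 2 * γ ^ 2 := mul_le_mul_of_nonneg_left w1 hl2p.le
          have h2 : l ^ 2 * γ ^ 2 = u ^ 2 := by rw [← hlγ]; ring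
          nlinarith
        have h3 := exp_le_quad (w := l ^ 2 / 16 * w) (by rw [abs_of_nonneg t0]; exact t1)
        have h4 : (l ^ 2 / 16 * w) ^ 2 ≤ l ^ 2 / 16 * w := by nlinarith
        have h5 : Cq 1 (1 / 4) * l ^ (2 + ρ) * γ ^ ρ ≤ l ^ 2 / 8 := by
          calc _ = Cq 1 (1 / 4) * (l ^ (2 + ρ) * γ ^ ρ) := by ring
            _ = l ^ 2 * (Cq 1 (1 / 4) * u ^ ρ) := by rw [hpow]; ring
            _ ≤ l ^ 2 * (1 / 8) := mul_le_mul_of_nonneg_left hC1 hl2p.le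
            _ = _ := by ring
        have h6 := mul_le_mul_of_nonneg_right h5 w0
        linarith) n
    have i1 := ((g.expBM hf (fun y => quad_bdd (a := 1) (b := 1 / 4) (by norm_num) (l * y)) (l ^ 2 / 16) n).mono (g.le n)).integrable (P := P)
    have h1 : ∫ ω, Real.exp (∑ i ∈ Finset.range n, (1 * (l * X i ω) - 1 / 4 * (l * X i ω) ^ 2 - l ^ 2 / 16 * v i ω)) ∂P
        ≤ ∫ ω, Real.exp (-(l ^ 2 / 20)) * Real.exp (G ω) ∂P := by
      apply integral_mono_ae i1 (B1.integrable.const_mul _)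
      filter_upwards [g.sum] with ω hω
      rw [← Real.exp_add]
      apply Real.exp_le_exp.2
      rw [Finset.sum_sub_distrib, ← Finset.mul_sum]
      have h2 := (abs_le.1 hω).1
      have h3 := mul_le_mul_of_nonneg_left (by linarith : 1 - 1 / 16 ≤ ∑ i ∈ Finset.range n, v i ω) hl2p.le
      show G ω - _ ≤ _
      linarith
    rw [integral_const_mul] at h1
    have h2 := mul_le_mul_of_nonneg_left (h0.trans h1) (Real.exp_pos (l ^ 2 / 20)).le
    rw [← mul_assoc, ← Real.exp_add] at h2
    simpa using h2
  have hG_meas : Measurable G := by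
    rw [hG]
    apply Finset.measurable_fun_sum
    intro i _
    have := g.Xmeas i
    fun_prop
  -- events
  have hev : ∀ ω, ii (l ^ 2 / 40) (G ω) ≤ ii x (WW X n ω) := by
    intro ω
    apply ii_mono
    intro h
    have hV : 0 ≤ ∑ i ∈ Finset.range n, X i ω ^ 2 := Finset.sum_nonneg fun i _ => sq_nonneg _
    have hGe : G ω = l * ∑ i ∈ Finset.range n, X i ω - l ^ 2 / 4 * ∑ i ∈ Finset.range n, X i ω ^ 2 := by
      show ∑ i ∈ Finset.range n, (1 * (l * X i ω) - 1 / 4 * (l * X i ω) ^ 2) = _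
      rw [Finset.sum_sub_distrib, Finset.mul_sum, Finset.mul_sum]
      congr 1 <;> (apply Finset.sum_congr rfl; intro i _; ring)
    rw [hGe] at h
    unfold WW
    rcases hV.eq_or_lt with h0 | h0
    · rw [sum_sq_zero h0.symm, ← h0] at h
      exfalso; linarith
    · have h1 := Real.sqrt_pos.2 h0
      rw [le_div_iff₀ h1]
      have h2 := Real.sq_sqrt hV
      set w := Real.sqrt (∑ i ∈ Finset.range n, X i ω ^ 2)
      rw [← h2] at h
      have h3 : 7 * x ≤ l := by rw [hl, le_div_iff₀ hγ]; linarith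
      have h4 : l * (x * w) ≤ l * (l / 7 * w) := by
        apply mul_le_mul_of_nonneg_left _ hl0.le
        exact mul_le_mul_of_nonneg_right (by linarith) h1.le
      have h5 : 0 ≤ l ^ 2 * (1 / 7 - w / 2) ^ 2 := by positivity
      have h6 : l * (x * w) ≤ l * ∑ i ∈ Finset.range n, X i ω := by
        have : 0 ≤ l ^ 2 := hl2p.le
        nlinarith
      exact le_of_mul_le_mul_left h6 hl0
  set p := pW P X n x with hp
  set s := l ^ 2 / 80 * Real.exp (-(3 * l ^ 2)) with hs
  have hs0 : 0 < s := by positivity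
  have hpt : ∀ ω, Real.exp (G ω) ≤ Real.exp (l ^ 2 / 40) + s * Real.exp (2 * G ω) + 1 / (4 * s) * ii x (WW X n ω) := by
    intro ω
    have h1 : 0 ≤ s * Real.exp (2 * G ω) := by positivity
    have h2 : 1 / (4 * s) * ii (l ^ 2 / 40) (G ω) ≤ 1 / (4 * s) * ii x (WW X n ω) := mul_le_mul_of_nonneg_left (hev ω) (by positivity)
    rcases le_or_gt (l ^ 2 / 40) (G ω) with h | h
    · have h3 : ii (l ^ 2 / 40) (G ω) = 1 := by unfold ii; rw [if_pos h]
      rw [h3] at h2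
      have h4 : Real.exp (2 * G ω) = Real.exp (G ω) ^ 2 := by rw [← Real.exp_nat_mul]; norm_num
      have h5 : Real.exp (G ω) ≤ s * Real.exp (G ω) ^ 2 + 1 / (4 * s) := by
        have h6 : 0 ≤ (2 * s * Real.exp (G ω) - 1) ^ 2 / (4 * s) := by positivity
        have h7 : (2 * s * Real.exp (G ω) - 1) ^ 2 / (4 * s) = s * Real.exp (G ω) ^ 2 - Real.exp (G ω) + 1 / (4 * s) := by
          field_simp; ring
        linarith
      rw [h4]
      have := Real.exp_pos (l ^ 2 / 40)
      linarith
    · have := Real.exp_le_exp.2 h.le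
      have h6 : 0 ≤ 1 / (4 * s) * ii x (WW X n ω) := mul_nonneg (by positivity) (ii_nonneg _ _)
      linarith
  have hInteg : ∫ ω, Real.exp (G ω) ∂P ≤ Real.exp (l ^ 2 / 40) + s * ∫ ω, Real.exp (2 * G ω) ∂P + 1 / (4 * s) * p := by
    have j1 : Integrable (fun ω => s * Real.exp (2 * G ω)) P := U2.1.integrable.const_mul s
    have j2 : Integrable (fun ω => 1 / (4 * s) * ii x (WW X n ω)) P := (iiBM g.WW_meas x).integrable.const_mul _
    have j3 : Integrable (fun _ : Ω => Real.exp (l ^ 2 / 40)) P := integrable_const _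
    have j4 : Integrable (fun ω => Real.exp (l ^ 2 / 40) + s * Real.exp (2 * G ω)) P := j3.add j1
    have h1 := integral_mono (B1.integrable (P := P)) (j4.add j2) hpt
    refine h1.trans (le_of_eq ?_)
    have e : ∫ ω, (Real.exp (l ^ 2 / 40) + s * Real.exp (2 * G ω) + 1 / (4 * s) * ii x (WW X n ω)) ∂P
      = Real.exp (l ^ 2 / 40) + s * ∫ ω, Real.exp (2 * G ω) ∂P + 1 / (4 * s) * p := by
      rw [integral_add j4 j2, integral_add j3 j1, integral_const_mul, integral_const_mul]
      simp [hp, pW]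
    exact e
  have h1 : s * ∫ ω, Real.exp (2 * G ω) ∂P ≤ l ^ 2 / 80 := by
    have := mul_le_mul_of_nonneg_left E2 hs0.le
    refine this.trans (le_of_eq ?_)
    rw [hs, mul_assoc, ← Real.exp_add]; simp
  have h2 : l ^ 2 / 40 ≤ Real.exp (l ^ 2 / 20) - Real.exp (l ^ 2 / 40) := by
    have h3 : Real.exp (l ^ 2 / 20) = Real.exp (l ^ 2 / 40) * Real.exp (l ^ 2 / 40) := by rw [← Real.exp_add]; congr 1; ring
    have h4 := Real.add_one_le_exp (l ^ 2 / 40)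
    rw [h3]
    nlinarith
  have h3 : l ^ 2 / 80 ≤ 1 / (4 * s) * p := by linarith
  have h4 : 4 * s * (l ^ 2 / 80) ≤ p := by
    have := mul_le_mul_of_nonneg_left h3 (by positivity : 0 ≤ 4 * s)
    have e : 4 * s * (1 / (4 * s) * p) = p := by field_simp
    linarith
  refine le_trans ?_ h4
  have h5 : (4 * u) ^ 2 ≤ l ^ 2 := pow_le_pow_left₀ (by linarith) hl1 2
  have h6 : Real.exp (-(3 * (u / c) ^ 2)) ≤ Real.exp (-(3 * l ^ 2)) := by
    apply Real.exp_le_exp.2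
    have := pow_le_pow_left₀ hl0.le hl2 2
    linarith
  have h7 : 4 * s * (l ^ 2 / 80) = 4 * (l ^ 2 / 80) ^ 2 * Real.exp (-(3 * l ^ 2)) := by rw [hs]; ring
  rw [h7]
  have h8 : ((4 * u) ^ 2 / 80) ^ 2 ≤ (l ^ 2 / 80) ^ 2 := pow_le_pow_left₀ (by positivity) (by linarith) 2
  exact mul_le_mul (by linarith) h6 (Real.exp_pos _).le (by positivity)

end Good
end Cr


namespace Cr

lemma small_rpow {M ρ : ℝ} (hM : 0 < M) (hρ : 0 < ρ) : ∃ ε : ℝ, 0 < ε ∧ ε ≤ 1 ∧ M * ε ^ ρ ≤ 1 := by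
  refine ⟨min 1 (M⁻¹ ^ (1 / ρ)), lt_min one_pos (Real.rpow_pos_of_pos (inv_pos.2 hM) _), min_le_left _ _, ?_⟩
  have h1 : (min 1 (M⁻¹ ^ (1 / ρ))) ^ ρ ≤ (M⁻¹ ^ (1 / ρ)) ^ ρ :=
    Real.rpow_le_rpow (le_min zero_le_one (Real.rpow_nonneg (inv_pos.2 hM).le _)) (min_le_right _ _) hρ.le
  have h2 : (M⁻¹ ^ (1 / ρ)) ^ ρ = M⁻¹ := by
    rw [← Real.rpow_mul (inv_pos.2 hM).le, one_div, inv_mul_cancel₀ hρ.ne', Real.rpow_one]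
  rw [h2] at h1
  have := mul_le_mul_of_nonneg_left h1 hM.le
  rwa [mul_inv_cancel₀ hM.ne'] at this

lemma smallX_of {x γ : ℝ} (hx : 0 ≤ x) (hγ : 0 < γ) (h : x * γ ≤ 1 / (2 * Ce)) : Good.SmallX x γ := by
  have hCe := Ce_ge
  have h0 : 0 ≤ x * γ := by positivity
  refine ⟨hx, h.trans ?_, ?_⟩
  · rw [div_le_one (by linarith)]; linarith
  · have h3 : (x * γ) ^ 2 ≤ (1 / (2 * Ce)) ^ 2 := pow_le_pow_left₀ h0 h 2
    have h4 : Ce * (1 / (2 * Ce)) ^ 2 = 1 / (4 * Ce) := by field_simp; norm_num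
    have h5 : 1 / (4 * Ce) ≤ 1 / 2 := one_div_le_one_div_of_le (by norm_num) (by linarith)
    have := mul_le_mul_of_nonneg_left h3 (by linarith : 0 ≤ Ce)
    linarith

lemma lower_bound {ρ : ℝ} (hρ : 0 < ρ) : ∃ K η0 : ℝ, 0 ≤ K ∧ 0 < η0 ∧
    ∀ {Ω : Type} [mΩ : MeasurableSpace Ω] {P : Measure Ω} [IsProbabilityMeasure P]
      {F : ℕ → MeasurableSpace Ω} {n : ℕ} {X v : ℕ → Ω → ℝ} {γ δ x : ℝ}, Good P F n X v ρ γ δ → 0 ≤ x → x * γ ≤ η0 →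
      Real.exp (-(K * R0 ρ γ δ x)) * (1 - stdNormalCDF x) ≤ pW P X n x := by
  have hC := C0_ge
  have hCe := Ce_ge
  have hK1 := K1_ge
  obtain ⟨ε1, e1, e2, e3⟩ := small_rpow (M := (C0 + 2) * C0) (by positivity) hρ
  have q1 := Cq_nonneg (a := 1) (b := 1 / 4) (by norm_num)
  have q2 := Cq_nonneg (a := 2) (b := 1 / 2) (by norm_num)
  obtain ⟨u, u1, u2, u3⟩ := small_rpow (M := 8 * Cq 1 (1 / 4) + 2 * Cq 2 (1 / 2) + 1) (by positivity) hρ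
  have hup : 0 < u ^ ρ := Real.rpow_pos_of_pos u1 _
  have hu8 : Cq 1 (1 / 4) * u ^ ρ ≤ 1 / 8 := by
    have := mul_nonneg q2 hup.le
    linarith
  have hu2 : Cq 2 (1 / 2) * u ^ ρ ≤ 1 / 2 := by
    have := mul_nonneg q1 hup.le
    linarith
  set ε := min ε1 (1 / (2 * Ce * (C0 + 3))) with hε
  have hε0 : 0 < ε := lt_min e1 (by positivity)
  have hε1 : (C0 + 2) * C0 * ε ^ ρ ≤ 1 := by
    refine le_trans (mul_le_mul_of_nonneg_left ?_ (by positivity)) e3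
    exact Real.rpow_le_rpow hε0.le (min_le_left _ _) hρ.le
  have hε2 : 2 * Ce * (C0 + 3) * ε ≤ 1 := by
    have : ε ≤ 1 / (2 * Ce * (C0 + 3)) := min_le_right _ _
    rw [le_div_iff₀ (by positivity)] at this
    linarith
  set p0 := 4 * ((4 * u) ^ 2 / 80) ^ 2 * Real.exp (-(3 * (u / (ε / 2)) ^ 2)) with hp0
  have hp0p : 0 < p0 := by positivity
  have hcp : 0 < (ε / 2) ^ (ρ / 2) := Real.rpow_pos_of_pos (by linarith) _
  have hK2 : 0 ≤ K2 := by unfold K2; positivity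
  have hK3 : 0 ≤ K3 := by unfold K3; positivity
  set K4 := |Real.log p0| / (ε / 2) ^ (ρ / 2) with hK4
  have hK4p : 0 ≤ K4 := by positivity
  refine ⟨4 * Ce + 2340 * K1 + K3 + K4, min (ε / 2) (min (u / 7) (1 / (2 * Ce))), by positivity,
    lt_min (by linarith) (lt_min (by linarith) (by positivity)), ?_⟩
  intro Ω mΩ P _ F n X v γ δ x g hx0 hxγ
  have a1 : x * γ ≤ ε / 2 := hxγ.trans (min_le_left _ _)
  have a2 : x * γ ≤ u / 7 := hxγ.trans ((min_le_right _ _).trans (min_le_left _ _))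
  have a3 : x * γ ≤ 1 / (2 * Ce) := hxγ.trans ((min_le_right _ _).trans (min_le_right _ _))
  have hR := (g.R0_pos hx0).2.1
  have hcc := (cdf_compl_pos x).le
  have mono : ∀ K, K ≤ 4 * Ce + 2340 * K1 + K3 + K4 → Real.exp (-(K * R0 ρ γ δ x)) * (1 - stdNormalCDF x) ≤ pW P X n x →
      Real.exp (-((4 * Ce + 2340 * K1 + K3 + K4) * R0 ρ γ δ x)) * (1 - stdNormalCDF x) ≤ pW P X n x := by
    intro K hK h
    refine le_trans (mul_le_mul_of_nonneg_right (Real.exp_le_exp.2 ?_) hcc) h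
    have := mul_le_mul_of_nonneg_right hK hR.le
    linarith
  rcases le_or_gt γ (ε / 2) with hc | hc
  · rcases le_or_gt (18 * (K1 * E0 ρ γ δ x)) 1 with hs | hs
    · exact mono (4 * Ce + 2340 * K1) (by linarith) (g.low_fine (smallX_of hx0 g.γ0 a3) hs)
    · exact mono K3 (by linarith) (g.low_crude hx0 (ε := ε) (by linarith) hε1 hε2 hs)
  · apply mono K4 (by linarith)
    have h1 := g.low_PZ (x := x) u1 u2 (by linarith : 0 < ε / 2) hc.le hu8 hu2 (by linarith)
    refine le_trans ?_ h1
    rw [← hp0]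
    have h2 : (ε / 2) ^ (ρ / 2) ≤ R0 ρ γ δ x := by
      have h3 := (g.R0_pos hx0).1
      have h4 : (ε / 2) ^ (ρ / 2) ≤ γ ^ (ρ / 2) := Real.rpow_le_rpow (by linarith) hc.le (by linarith)
      have h5 := g.gam_half.2.2.2
      have h6 := g.δ0
      have h7 : 0 ≤ x * (δ + γ ^ (ρ / 2)) := by positivity
      linarith
    have h3 : -(K4 * R0 ρ γ δ x) ≤ Real.log p0 := by
      have h4 : K4 * (ε / 2) ^ (ρ / 2) = |Real.log p0| := by rw [hK4]; field_simp
      have h5 := mul_le_mul_of_nonneg_left h2 hK4p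
      linarith [neg_abs_le (Real.log p0)]
    have h4 : Real.exp (-(K4 * R0 ρ γ δ x)) ≤ p0 := by
      have := Real.exp_le_exp.2 h3
      rwa [Real.exp_log hp0p] at this
    have h5 : 1 - stdNormalCDF x ≤ 1 := by linarith [cdf_nonneg x]
    calc _ ≤ p0 * 1 := mul_le_mul h4 h5 hcc hp0p.le
      _ = p0 := mul_one _

end Cr


namespace Cr
lemma two_add_sq_le (t : ℝ) : 2 + t ^ 2 ≤ Real.exp t + Real.exp (-t) := by
  have h1 : (t / 2) ^ 2 ≤ Real.sinh (t / 2) ^ 2 := by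
    rw [sq_le_sq]
    rcases le_total 0 t with h | h
    · rw [abs_of_nonneg (by linarith)]
      exact (Real.self_le_sinh_iff.2 (by linarith)).trans (le_abs_self _)
    · rw [abs_of_nonpos (by linarith), ← abs_neg, ← Real.sinh_neg]
      exact (Real.self_le_sinh_iff.2 (by linarith)).trans (le_abs_self _)
  rw [Real.sinh_eq] at h1
  have h2 : Real.exp t = Real.exp (t / 2) * Real.exp (t / 2) := by rw [← Real.exp_add]; ring_nf
  have h3 : Real.exp (-t) = Real.exp (-(t / 2)) * Real.exp (-(t / 2)) := by rw [← Real.exp_add]; ring_nf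
  have h4 : Real.exp (t / 2) * Real.exp (-(t / 2)) = 1 := by rw [← Real.exp_add]; simp
  rw [h2, h3]
  nlinarith

namespace Good

variable {Ω : Type} [mΩ : MeasurableSpace Ω] {P : Measure Ω} [IsProbabilityMeasure P]
  {F : ℕ → MeasurableSpace Ω} {n : ℕ} {X v : ℕ → Ω → ℝ} {ρ γ δ x η a : ℝ}

lemma up_A (g : Good P F n X v ρ γ δ) (hx : SmallX x γ) :
    ∫ ω, ii (-(γ ^ (ρ / 2) + δ)) (TT X n x ω) ∂P
      ≤ (1 - stdNormalCDF x) * Real.exp ((4 * Ce + 1080 * K1 + 28) * R0 ρ γ δ x) := by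
  have hx0 := hx.1
  have hx1 : 0 < 1 + x := by linarith
  have hK1 := K1_ge
  have hT := g.TT_meas x
  obtain ⟨q1, q2, q3, q4⟩ := g.gam_half
  have hδ := g.δ0
  set r := γ ^ (ρ / 2) + δ with hr
  have hr0 : 0 < r := by linarith
  set A := 4 * Ce * (x ^ (2 + ρ) * γ ^ ρ) with hA
  set e := K1 * E0 ρ γ δ x with he
  have i1 := ((g.ZB x).mul (iiBM hT 0)).integrable (P := P)
  have i2 := ((g.ZB x).mul (iiBM hT (-r))).integrable (P := P)
  have i3 := ((g.ZB x).mul (g.expTBM hx0)).integrable (P := P)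
  have key : ∫ ω, ii (-r) (TT X n x ω) ∂P ≤ ∫ ω, Real.exp (A + x * r - x ^ 2 / 2) *
      (ZZ P F X x n ω * (Real.exp (-(x * TT X n x ω)) * ii 0 (TT X n x ω)) +
        (ZZ P F X x n ω * ii (-r) (TT X n x ω) - ZZ P F X x n ω * ii 0 (TT X n x ω))) ∂P := by
    apply integral_mono_ae (iiBM hT (-r)).integrable ((i3.add (i2.sub i1)).const_mul _)
    filter_upwards [g.ZZ_exp hx] with ω hω
    have h2 := hω.1
    have hU : x * ∑ i ∈ Finset.range n, X i ω - x ^ 2 / 2 * ∑ i ∈ Finset.range n, X i ω ^ 2 = x * TT X n x ω + x ^ 2 / 2 := by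
      unfold TT; ring
    rw [hU, ← hA] at h2
    set t := TT X n x ω
    have hZ := g.ZZ_pos x n ω
    set Z := ZZ P F X x n ω
    show ii (-r) t ≤ Real.exp (A + x * r - x ^ 2 / 2) * (Z * (Real.exp (-(x * t)) * ii 0 t) + (Z * ii (-r) t - Z * ii 0 t))
    have h3 : 1 ≤ Real.exp (A - x ^ 2 / 2 - x * t) * Z := by
      have := mul_le_mul_of_nonneg_left h2 (Real.exp_pos (-(x * t + x ^ 2 / 2))).le
      rw [← mul_assoc, ← Real.exp_add, ← Real.exp_add, neg_add_cancel, Real.exp_zero] at this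
      refine this.trans (le_of_eq ?_)
      congr 2; ring
    have hxr : 0 ≤ x * r := by positivity
    unfold ii
    by_cases h0 : 0 ≤ t
    · rw [if_pos h0, if_pos (by linarith : -r ≤ t)]
      have h4 : Real.exp (A - x ^ 2 / 2 - x * t) ≤ Real.exp (A + x * r - x ^ 2 / 2) * Real.exp (-(x * t)) := by
        rw [← Real.exp_add]; apply Real.exp_le_exp.2; linarith
      have := mul_le_mul_of_nonneg_right h4 hZ.le
      refine h3.trans (this.trans (le_of_eq ?_))
      ring
    · rw [if_neg h0]
      by_cases h1 : -r ≤ t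
      · rw [if_pos h1]
        have h4 : Real.exp (A - x ^ 2 / 2 - x * t) ≤ Real.exp (A + x * r - x ^ 2 / 2) := by
          apply Real.exp_le_exp.2
          have := mul_le_mul_of_nonneg_left h1 hx0
          linarith
        have := mul_le_mul_of_nonneg_right h4 hZ.le
        refine h3.trans (this.trans (le_of_eq ?_))
        ring
      · rw [if_neg h1]; simp
  have i4 : Integrable (fun ω => ZZ P F X x n ω * ii (-r) (TT X n x ω) - ZZ P F X x n ω * ii 0 (TT X n x ω)) P := i2.sub i1
  rw [integral_const_mul, integral_add i3 i4, integral_sub i2 i1] at key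
  have ht := (abs_le.1 (transfer (g.ZB x).integrable (fun ω => (g.ZZ_pos x n ω).le) hT hx0 (g.kl hx))).2
  have k1 := (abs_le.1 (g.kl hx 0)).1
  have k2 := (abs_le.1 (g.kl hx (-r))).2
  rw [← he] at k1 k2 ht
  have hl := cdf_lip 0 (-r)
  rw [zero_sub, neg_neg, abs_of_pos hr0] at hl
  have hl := (le_abs_self _).trans hl
  have hJ := JJ_lower hx0
  have hJ0 : 0 < JJ x := lt_of_lt_of_le (by positivity) hJ
  rw [div_le_iff₀ (by positivity)] at hJ
  have b1 : (∫ ω, ZZ P F X x n ω * (Real.exp (-(x * TT X n x ω)) * ii 0 (TT X n x ω)) ∂P) +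
        ((∫ ω, ZZ P F X x n ω * ii (-r) (TT X n x ω) ∂P) - ∫ ω, ZZ P F X x n ω * ii 0 (TT X n x ω) ∂P) ≤ JJ x + (4 * e + r) := by
    linarith
  have he0 : 0 < e := mul_pos (by linarith [K1_ge]) (g.E0_pos hx0)
  have b2 : JJ x + (4 * e + r) ≤ JJ x * Real.exp (27 * (1 + x) * (4 * e + r)) := by
    have h4 := Real.add_one_le_exp (27 * (1 + x) * (4 * e + r))
    have h5 := mul_le_mul_of_nonneg_left h4 hJ0.le
    have h6 := mul_le_mul_of_nonneg_right hJ (by linarith : 0 ≤ 4 * e + r)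
    linarith
  have hR := g.R0_pos hx0
  have hER : (1 + x) * e ≤ 10 * K1 * R0 ρ γ δ x := by
    have := mul_le_mul_of_nonneg_left (g.E0_R0 hx0) (by linarith [K1_ge] : 0 ≤ K1)
    rw [he]; linarith
  have hrR : (1 + x) * r ≤ R0 ρ γ δ x := by
    have := hR.1
    rw [hr]; linarith
  have hAR : A ≤ 4 * Ce * R0 ρ γ δ x := by
    have h4 : 0 ≤ x ^ 2 * δ ^ 2 := by positivity
    rw [hA]
    exact mul_le_mul_of_nonneg_left (by linarith [hR.2.2]) (by linarith [Ce_ge])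
  refine key.trans ((mul_le_mul_of_nonneg_left (b1.trans b2) (Real.exp_pos _).le).trans ?_)
  rw [JJ_tail, mul_comm (Real.exp _) (JJ x), mul_comm (Real.exp _) (JJ x * _), mul_assoc, mul_assoc (JJ x), ← Real.exp_add, ← Real.exp_add]
  apply mul_le_mul_of_nonneg_left _ hJ0.le
  apply Real.exp_le_exp.2
  have : x * r ≤ (1 + x) * r := by linarith
  linarith

/-- quadratic variation concentrates -/
lemma V_tail (g : Good P F n X v ρ γ δ) {τ : ℝ} (hτ : 0 < τ) :
    ∫ ω, ii τ ((∑ i ∈ Finset.range n, X i ω ^ 2 - 1) ^ 2) ∂P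
      ≤ 2 * γ ^ ρ + 16 * Real.exp 9 * (γ ^ ρ + δ ^ 2) / τ := by
  set V' := fun ω => ∑ i ∈ Finset.range n, min (X i ω ^ 2) 1 with hV'
  have hδ2 : δ ^ 2 ≤ 1 / 16 := by nlinarith [g.δ0, g.δ1]
  have hgr := g.gr_pos
  have hgr1 : γ ^ ρ ≤ 1 := Real.rpow_le_one g.γ0.le (by linarith [g.γ1]) g.ρ0.le
  have f1 : Measurable (fun y : ℝ => 1 * min (y ^ 2) 1) := by fun_prop
  have f2 : Measurable (fun y : ℝ => (-1) * min (y ^ 2) 1) := by fun_prop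
  have bd1 : ∀ y : ℝ, 1 * min (y ^ 2) 1 ≤ 1 := fun y => by rw [one_mul]; exact min_le_right _ _
  have bd2 : ∀ y : ℝ, (-1) * min (y ^ 2) 1 ≤ 0 := fun y => by
    have : 0 ≤ min (y ^ 2) 1 := le_min (sq_nonneg y) zero_le_one
    linarith
  have u1 := g.gl_sum f1 bd1 (α := 0) (β := 1) (κ := 4) (by norm_num) (fun y => by
    have := trunc_sq (s := 1) (by norm_num) g.ρ0.le g.ρ1 y
    linarith)
  have u2 := g.gl_sum f2 bd2 (α := 0) (β := -1) (κ := 4) (by norm_num) (fun y => by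
    have := trunc_sq (s := -1) (by norm_num) g.ρ0.le g.ρ1 y
    linarith)
  have w1 := g.expsumBM f1 bd1 n
  have w2 := g.expsumBM f2 bd2 n
  have e1 : ∀ ω, ∑ i ∈ Finset.range n, 1 * min (X i ω ^ 2) 1 = V' ω := by
    intro ω; rw [← Finset.mul_sum, one_mul]
  have e2 : ∀ ω, ∑ i ∈ Finset.range n, (-1) * min (X i ω ^ 2) 1 = - V' ω := by
    intro ω; rw [← Finset.mul_sum]; show -1 * V' ω = _; ring
  simp only [e1, e2] at u1 u2 w1 w2
  rw [abs_one] at u1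
  rw [abs_neg, abs_one] at u2
  set q := δ ^ 2 + 8 * γ ^ ρ with hq
  have hq9 : q ≤ 9 := by linarith
  have hq0 : 0 ≤ q := by positivity
  have hJ : ∀ i, Integrable (fun ω => |X i ω| ^ (2 + ρ)) P := g.int
  have hJs : Integrable (fun ω => ∑ i ∈ Finset.range n, |X i ω| ^ (2 + ρ)) P := integrable_finsetSum _ fun i _ => hJ i
  have jump : ∫ ω, ∑ i ∈ Finset.range n, |X i ω| ^ (2 + ρ) ∂P ≤ 2 * γ ^ ρ := by
    rw [integral_finsetSum _ fun i _ => hJ i]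
    have h1 : ∀ i ∈ Finset.range n, ∫ ω, |X i ω| ^ (2 + ρ) ∂P ≤ γ ^ ρ * ∫ ω, v i ω ∂P := by
      intro i _
      have := g.e3 i (fun _ => 1) (BM.const 1) (fun _ => zero_le_one)
      simpa using this
    have iv : ∀ i, Integrable (v i) P := fun i => ((g.vBM i).mono (g.le i)).integrable
    refine (Finset.sum_le_sum h1).trans ?_
    rw [← Finset.mul_sum, ← integral_finsetSum _ fun i _ => iv i]
    have h2 : ∫ ω, ∑ i ∈ Finset.range n, v i ω ∂P ≤ ∫ _ω, (2:ℝ) ∂P := by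
      apply integral_mono_ae (integrable_finsetSum _ fun i _ => iv i) (integrable_const _)
      filter_upwards [g.sum] with ω hω
      linarith [(abs_le.1 hω).2]
    have h3 : ∫ _ω, (2:ℝ) ∂P = 2 := by simp
    rw [h3] at h2
    have := mul_le_mul_of_nonneg_left h2 hgr.le
    linarith
  have hVm : Measurable (fun ω => (∑ i ∈ Finset.range n, X i ω ^ 2 - 1) ^ 2) := by
    have h2 : Measurable (fun ω => ∑ i ∈ Finset.range n, X i ω ^ 2) :=
      Finset.measurable_fun_sum _ fun i _ => (g.Xmeas i).pow_const 2
    exact (h2.sub measurable_const).pow_const 2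
  have j1 : Integrable (fun ω => Real.exp (-1) * Real.exp (V' ω)) P := w1.integrable.const_mul _
  have j2 : Integrable (fun ω => Real.exp 1 * Real.exp (-V' ω)) P := w2.integrable.const_mul _
  have j3 : Integrable (fun ω => Real.exp (-1) * Real.exp (V' ω) + Real.exp 1 * Real.exp (-V' ω)) P := j1.add j2
  have j4 : Integrable (fun ω => Real.exp (-1) * Real.exp (V' ω) + Real.exp 1 * Real.exp (-V' ω) - 2) P := j3.sub (integrable_const _)
  have j5 : Integrable (fun ω => 1 / τ * (Real.exp (-1) * Real.exp (V' ω) + Real.exp 1 * Real.exp (-V' ω) - 2)) P := j4.const_mul _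
  have main : ∫ ω, ii τ ((∑ i ∈ Finset.range n, X i ω ^ 2 - 1) ^ 2) ∂P ≤ ∫ ω, (∑ i ∈ Finset.range n, |X i ω| ^ (2 + ρ) +
      1 / τ * (Real.exp (-1) * Real.exp (V' ω) + Real.exp 1 * Real.exp (-V' ω) - 2)) ∂P := by
    apply integral_mono (iiBM hVm τ).integrable (hJs.add j5)
    intro ω
    show ii τ ((∑ i ∈ Finset.range n, X i ω ^ 2 - 1) ^ 2) ≤ ∑ i ∈ Finset.range n, |X i ω| ^ (2 + ρ) +
      1 / τ * (Real.exp (-1) * Real.exp (V' ω) + Real.exp 1 * Real.exp (-V' ω) - 2)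
    rw [← Real.exp_add, ← Real.exp_add]
    have hp : ∀ i, 0 ≤ |X i ω| ^ (2 + ρ) := fun i => Real.rpow_nonneg (abs_nonneg _) _
    have hps : 0 ≤ ∑ i ∈ Finset.range n, |X i ω| ^ (2 + ρ) := Finset.sum_nonneg fun i _ => hp i
    have hcosh : (V' ω - 1) ^ 2 ≤ Real.exp (-1 + V' ω) + Real.exp (1 + -V' ω) - 2 := by
      have h1 := two_add_sq_le (V' ω - 1)
      rw [show -1 + V' ω = V' ω - 1 by ring, show 1 + -V' ω = -(V' ω - 1) by ring]
      linarith
    have h0 : 0 ≤ 1 / τ * (Real.exp (-1 + V' ω) + Real.exp (1 + -V' ω) - 2) :=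
      mul_nonneg (by positivity) ((sq_nonneg _).trans hcosh)
    by_cases hj : ∃ i ∈ Finset.range n, 1 < |X i ω|
    · obtain ⟨i, hi, hi1⟩ := hj
      have h1 : 1 ≤ |X i ω| ^ (2 + ρ) := Real.one_le_rpow hi1.le (by linarith [g.ρ0])
      have h2 := Finset.single_le_sum (fun i _ => hp i) hi
      have h3 := ii_le τ ((∑ i ∈ Finset.range n, X i ω ^ 2 - 1) ^ 2)
      linarith
    · push Not at hj
      have hVe : V' ω = ∑ i ∈ Finset.range n, X i ω ^ 2 := by
        apply Finset.sum_congr rfl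
        intro i hi
        apply min_eq_left
        exact (sq_le_one_iff_abs_le_one _).2 (hj i hi)
      rw [← hVe]
      unfold ii
      split_ifs with hh
      · have h1 : 1 ≤ 1 / τ * (Real.exp (-1 + V' ω) + Real.exp (1 + -V' ω) - 2) := by
          rw [one_div, ← div_eq_inv_mul, le_div_iff₀ hτ, one_mul]
          exact hh.trans hcosh
        linarith
      · linarith
  refine main.trans ?_
  rw [integral_add hJs j5, integral_const_mul, integral_sub j3 (integrable_const _), integral_add j1 j2, integral_const_mul, integral_const_mul]
  have c1 : Real.exp (-1) * ∫ ω, Real.exp (V' ω) ∂P ≤ Real.exp q := by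
    refine (mul_le_mul_of_nonneg_left u1 (Real.exp_pos _).le).trans (le_of_eq ?_)
    rw [← Real.exp_add, hq]; congr 1; ring
  have c2 : Real.exp 1 * ∫ ω, Real.exp (-V' ω) ∂P ≤ Real.exp q := by
    refine (mul_le_mul_of_nonneg_left u2 (Real.exp_pos _).le).trans (le_of_eq ?_)
    rw [← Real.exp_add, hq]; congr 1; ring
  have c3 : Real.exp q - 1 ≤ q * Real.exp 9 := by
    have h1 := Real.add_one_le_exp (-q)
    have h2 : Real.exp (-q) * Real.exp q = 1 := by rw [← Real.exp_add]; simp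
    have h3 := Real.exp_le_exp.2 hq9
    have h4 := mul_le_mul_of_nonneg_right h1 (Real.exp_pos q).le
    have h5 := mul_le_mul_of_nonneg_left h3 hq0
    linarith
  have c4 : ∫ _ω, (2:ℝ) ∂P = 2 := by simp
  rw [c4]
  have c5 : q ≤ 8 * (γ ^ ρ + δ ^ 2) := by rw [hq]; linarith [sq_nonneg δ]
  have c6 := mul_le_mul_of_nonneg_right c5 (Real.exp_pos 9).le
  have c7 : (Real.exp (-1) * ∫ ω, Real.exp (V' ω) ∂P) + (Real.exp 1 * ∫ ω, Real.exp (-V' ω) ∂P) - 2 ≤ 16 * Real.exp 9 * (γ ^ ρ + δ ^ 2) := by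
    linarith
  have c8 := mul_le_mul_of_nonneg_left c7 (by positivity : 0 ≤ 1 / τ)
  have c9 : 1 / τ * (16 * Real.exp 9 * (γ ^ ρ + δ ^ 2)) = 16 * Real.exp 9 * (γ ^ ρ + δ ^ 2) / τ := by ring
  linarith

end Good
end Cr


namespace Cr

lemma exp_two_step {a b : ℝ} (ha : 0 ≤ a) (hb : 0 ≤ b) : Real.exp a * (b ^ 2 / 2) ≤ Real.exp (a + b) - 1 - (a + b) := by
  have h1 := Real.quadratic_le_exp_of_nonneg hb
  have h2 := Real.add_one_le_exp a
  have h3 := mul_le_mul_of_nonneg_left h1 (Real.exp_pos a).le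
  have h4 := mul_le_mul_of_nonneg_right h2 (by linarith : 0 ≤ 1 + b)
  have h5 := mul_nonneg ha hb
  rw [Real.exp_add]
  linarith

/-- the comparison function -/
lemma FF_lower {w h : ℝ} (hp : 0 ≤ w → h ≤ w / 4) (hn : w ≤ 0 → h ≤ -w / 2) :
    w ^ 2 / 96 * Real.exp h ≤ 3 * Real.exp (w / 3) + Real.exp (-w) - 4 := by
  rcases le_total 0 w with h0 | h0
  · have h1 := exp_two_step (a := w / 4) (b := w / 12) (by linarith) (by linarith)
    rw [show w / 4 + w / 12 = w / 3 by ring] at h1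
    have h2 := Real.add_one_le_exp (-w)
    have h3 := mul_le_mul_of_nonneg_left (Real.exp_le_exp.2 (hp h0)) (by positivity : 0 ≤ w ^ 2 / 96)
    linarith
  · have h1 := exp_two_step (a := -w / 2) (b := -w / 2) (by linarith) (by linarith)
    rw [show -w / 2 + -w / 2 = -w by ring] at h1
    have h2 := Real.add_one_le_exp (w / 3)
    have h3 := mul_le_mul_of_nonneg_left (Real.exp_le_exp.2 (hn h0)) (by positivity : 0 ≤ w ^ 2 / 96)
    have h4 : 0 ≤ w ^ 2 * Real.exp (-w / 2) := by positivity
    linarith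

lemma FF_nonneg (w : ℝ) : 0 ≤ 3 * Real.exp (w / 3) + Real.exp (-w) - 4 := by
  have h2 := Real.add_one_le_exp (w / 3)
  have h3 := Real.add_one_le_exp (-w)
  linarith

/-- middle range pointwise bound -/
lemma mid_pt {x r S V : ℝ} (hx : 1 ≤ x) (hr : 0 < r) (hV : 0 ≤ V) (hV4 : V ≤ 4)
    (hS : x * Real.sqrt V ≤ S) (h : r ≤ x * (Real.sqrt V - 1) ^ 2 / 2) :
    x ^ 3 * r / 48 ≤ Real.exp (x * S - x ^ 2 / 2 * V - x ^ 2 / 2) *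
      (3 * Real.exp (x ^ 2 * (V - 1) / 3) + Real.exp (-(x ^ 2 * (V - 1))) - 4) := by
  set s := Real.sqrt V with hs
  have hs0 : 0 ≤ s := Real.sqrt_nonneg V
  have hsV : V = s ^ 2 := (Real.sq_sqrt hV).symm
  have hs2 : s ≤ 2 := by nlinarith
  have hx2 : 0 < x ^ 2 := by positivity
  have hF := FF_lower (w := x ^ 2 * (V - 1)) (h := x ^ 2 * (s - 1) ^ 2 / 2)
    (fun h0 => by
      have h1 : 0 ≤ V - 1 := by
        by_contra hc
        push Not at hc
        nlinarith
      have h2 : 1 ≤ s := by nlinarith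
      have h3 : (s - 1) ^ 2 / 2 ≤ (V - 1) / 4 := by rw [hsV]; nlinarith
      have := mul_le_mul_of_nonneg_left h3 hx2.le
      linarith)
    (fun h0 => by
      have h1 : V - 1 ≤ 0 := by
        by_contra hc
        push Not at hc
        nlinarith
      have h2 : s ≤ 1 := by nlinarith
      have h3 : (s - 1) ^ 2 / 2 ≤ -(V - 1) / 2 := by rw [hsV]; nlinarith
      have := mul_le_mul_of_nonneg_left h3 hx2.le
      linarith)
  have hU : -(x ^ 2 * (s - 1) ^ 2 / 2) ≤ x * S - x ^ 2 / 2 * V - x ^ 2 / 2 := by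
    have := mul_le_mul_of_nonneg_left hS (by linarith : 0 ≤ x)
    rw [hsV]; linarith
  have hE := Real.exp_le_exp.2 hU
  have hw : 2 * x ^ 3 * r ≤ (x ^ 2 * (V - 1)) ^ 2 := by
    have e : (x ^ 2 * (V - 1)) ^ 2 = x ^ 4 * (s - 1) ^ 2 * (s + 1) ^ 2 := by rw [hsV]; ring
    have h1 : x ^ 4 * (s - 1) ^ 2 * 1 ≤ x ^ 4 * (s - 1) ^ 2 * (s + 1) ^ 2 :=
      mul_le_mul_of_nonneg_left (by nlinarith) (by positivity)
    have h2 := mul_le_mul_of_nonneg_left h (by positivity : 0 ≤ x ^ 3)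
    rw [e]
    linarith
  have hc : Real.exp (-(x ^ 2 * (s - 1) ^ 2 / 2)) * Real.exp (x ^ 2 * (s - 1) ^ 2 / 2) = 1 := by
    rw [← Real.exp_add]; simp
  calc x ^ 3 * r / 48 ≤ (x ^ 2 * (V - 1)) ^ 2 / 96 * 1 := by linarith
    _ = Real.exp (-(x ^ 2 * (s - 1) ^ 2 / 2)) * ((x ^ 2 * (V - 1)) ^ 2 / 96 * Real.exp (x ^ 2 * (s - 1) ^ 2 / 2)) := by
      linear_combination (-(x ^ 2 * (V - 1)) ^ 2 / 96) * hc
    _ ≤ _ := mul_le_mul hE hF (by positivity) (Real.exp_pos _).le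

noncomputable def Km : ℝ := 1 + 2 * Cq 1 (1 / 6) + 2 * Cq 1 (3 / 2) + 4 * Ce
lemma Km_ge : 1 ≤ Km := by
  unfold Km
  have q1 := Cq_nonneg (a := 1) (b := 1 / 6) (by norm_num)
  have q2 := Cq_nonneg (a := 1) (b := 3 / 2) (by norm_num)
  linarith [Ce_ge]

/-- comparison functional -/
noncomputable def GG {Ω : Type} (X : ℕ → Ω → ℝ) (n : ℕ) (x : ℝ) (ω : Ω) : ℝ :=
  Real.exp (x * ∑ i ∈ Finset.range n, X i ω - x ^ 2 / 2 * ∑ i ∈ Finset.range n, X i ω ^ 2 - x ^ 2 / 2) *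
      (3 * Real.exp (x ^ 2 * (∑ i ∈ Finset.range n, X i ω ^ 2 - 1) / 3) +
        Real.exp (-(x ^ 2 * (∑ i ∈ Finset.range n, X i ω ^ 2 - 1))) - 4)

namespace Good
variable {Ω : Type} [mΩ : MeasurableSpace Ω] {P : Measure Ω} [IsProbabilityMeasure P]
  {F : ℕ → MeasurableSpace Ω} {n : ℕ} {X v : ℕ → Ω → ℝ} {ρ γ δ x η a : ℝ}

lemma GG_int (g : Good P F n X v ρ γ δ) (hx : SmallX x γ) :
    Integrable (GG X n x) P ∧ ∫ ω, GG X n x ω ∂P ≤ Real.exp (-(x ^ 2) / 2) *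
      (8 * Km * (x ^ (2 + ρ) * γ ^ ρ + x ^ 2 * δ ^ 2) * Real.exp (Km * (x ^ (2 + ρ) * γ ^ ρ + x ^ 2 * δ ^ 2))) := by
  have hx0 := hx.1
  obtain ⟨m1, u1⟩ := g.eq_up (a := 1) (b := 1 / 6) (l := x) (by norm_num) hx0
  obtain ⟨m2, u2⟩ := g.eq_up (a := 1) (b := 3 / 2) (l := x) (by norm_num) hx0
  obtain ⟨m3, _⟩ := g.eq_up (a := 1) (b := 1 / 2) (l := x) (by norm_num) hx0
  have es : ∀ (b : ℝ) ω, ∑ i ∈ Finset.range n, (1 * (x * X i ω) - b * (x * X i ω) ^ 2)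
      = x * ∑ i ∈ Finset.range n, X i ω - b * x ^ 2 * ∑ i ∈ Finset.range n, X i ω ^ 2 := by
    intro b ω
    rw [Finset.sum_sub_distrib, Finset.mul_sum, Finset.mul_sum]
    congr 1
    · exact Finset.sum_congr rfl fun i _ => by ring
    · exact Finset.sum_congr rfl fun i _ => by ring
  simp only [es] at m1 m2 m3 u1 u2
  set S := fun ω => ∑ i ∈ Finset.range n, X i ω with hS
  set V := fun ω => ∑ i ∈ Finset.range n, X i ω ^ 2 with hV
  set A0 := x ^ (2 + ρ) * γ ^ ρ with hA0
  have hA00 : 0 ≤ A0 := mul_nonneg (Real.rpow_nonneg hx0 _) g.gr_pos.le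
  set D := x ^ 2 * δ ^ 2 with hD
  have hD0 : 0 ≤ D := by positivity
  have q1 := Cq_nonneg (a := 1) (b := 1 / 6) (by norm_num)
  have q2 := Cq_nonneg (a := 1) (b := 3 / 2) (by norm_num)
  have hCe := Ce_ge
  have hKm := Km_ge
  have hKA : 0 ≤ Km * (A0 + D) := by positivity
  have eGG : GG X n x = fun ω => Real.exp (-(x ^ 2) / 2) * (3 * Real.exp (-(x ^ 2) / 3) * Real.exp (x * S ω - 1 / 6 * x ^ 2 * V ω) +
      Real.exp (x ^ 2) * Real.exp (x * S ω - 3 / 2 * x ^ 2 * V ω) - 4 * Real.exp (x * S ω - 1 / 2 * x ^ 2 * V ω)) := by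
    ext ω
    show Real.exp (x * S ω - x ^ 2 / 2 * V ω - x ^ 2 / 2) *
      (3 * Real.exp (x ^ 2 * (V ω - 1) / 3) + Real.exp (-(x ^ 2 * (V ω - 1))) - 4) = _
    have e1 : Real.exp (x * S ω - x ^ 2 / 2 * V ω - x ^ 2 / 2) * Real.exp (x ^ 2 * (V ω - 1) / 3)
       = Real.exp (-(x ^ 2) / 2) * (Real.exp (-(x ^ 2) / 3) * Real.exp (x * S ω - 1 / 6 * x ^ 2 * V ω)) := by
      rw [← Real.exp_add, ← Real.exp_add, ← Real.exp_add]; congr 1; ring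
    have e2 : Real.exp (x * S ω - x ^ 2 / 2 * V ω - x ^ 2 / 2) * Real.exp (-(x ^ 2 * (V ω - 1)))
       = Real.exp (-(x ^ 2) / 2) * (Real.exp (x ^ 2) * Real.exp (x * S ω - 3 / 2 * x ^ 2 * V ω)) := by
      rw [← Real.exp_add, ← Real.exp_add, ← Real.exp_add]; congr 1; ring
    have e3 : Real.exp (x * S ω - x ^ 2 / 2 * V ω - x ^ 2 / 2)
       = Real.exp (-(x ^ 2) / 2) * Real.exp (x * S ω - 1 / 2 * x ^ 2 * V ω) := by
      rw [← Real.exp_add]; congr 1; ring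
    rw [mul_sub, mul_add, mul_left_comm, e1, e2, e3]
    ring
  have i1 : Integrable (fun ω => 3 * Real.exp (-(x ^ 2) / 3) * Real.exp (x * S ω - 1 / 6 * x ^ 2 * V ω)) P := m1.integrable.const_mul _
  have i2 : Integrable (fun ω => Real.exp (x ^ 2) * Real.exp (x * S ω - 3 / 2 * x ^ 2 * V ω)) P := m2.integrable.const_mul _
  have i3 : Integrable (fun ω => 4 * Real.exp (x * S ω - 1 / 2 * x ^ 2 * V ω)) P := m3.integrable.const_mul _
  have i12 : Integrable (fun ω => 3 * Real.exp (-(x ^ 2) / 3) * Real.exp (x * S ω - 1 / 6 * x ^ 2 * V ω) +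
     Real.exp (x ^ 2) * Real.exp (x * S ω - 3 / 2 * x ^ 2 * V ω)) P := i1.add i2
  have i4 : Integrable (fun ω => 3 * Real.exp (-(x ^ 2) / 3) * Real.exp (x * S ω - 1 / 6 * x ^ 2 * V ω) +
     Real.exp (x ^ 2) * Real.exp (x * S ω - 3 / 2 * x ^ 2 * V ω) - 4 * Real.exp (x * S ω - 1 / 2 * x ^ 2 * V ω)) P := i12.sub i3
  rw [eGG]
  refine ⟨i4.const_mul _, ?_⟩
  rw [integral_const_mul]
  apply mul_le_mul_of_nonneg_left _ (Real.exp_pos _).le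
  rw [integral_sub i12 i3, integral_add i1 i2, integral_const_mul, integral_const_mul, integral_const_mul]
  have b1 : Real.exp (-(x ^ 2) / 3) * ∫ ω, Real.exp (x * S ω - 1 / 6 * x ^ 2 * V ω) ∂P ≤ Real.exp (Km * (A0 + D)) := by
    refine (mul_le_mul_of_nonneg_left u1 (Real.exp_pos _).le).trans ?_
    rw [← Real.exp_add]
    apply Real.exp_le_exp.2
    rw [abs_of_nonneg (by norm_num; positivity)]
    have : 0 ≤ Cq 1 (3 / 2) * A0 := by positivity
    have : 0 ≤ Cq 1 (3 / 2) * D := by positivity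
    have : 0 ≤ Cq 1 (1 / 6) * D := by positivity
    have : 0 ≤ Ce * D := by positivity
    have : 0 ≤ Ce * A0 := by positivity
    have e : -x ^ 2 / 3 + ((1 ^ 2 / 2 - 1 / 6) * x ^ 2 + (1 ^ 2 / 2 - 1 / 6) * x ^ 2 * δ ^ 2 + 2 * (Cq 1 (1 / 6) * x ^ (2 + ρ)) * γ ^ ρ)
      = 1 / 3 * D + 2 * (Cq 1 (1 / 6) * A0) := by rw [hD, hA0]; ring
    rw [e]
    unfold Km
    linarith
  have b2 : Real.exp (x ^ 2) * ∫ ω, Real.exp (x * S ω - 3 / 2 * x ^ 2 * V ω) ∂P ≤ Real.exp (Km * (A0 + D)) := by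
    refine (mul_le_mul_of_nonneg_left u2 (Real.exp_pos _).le).trans ?_
    rw [← Real.exp_add]
    apply Real.exp_le_exp.2
    rw [abs_of_nonpos (by norm_num; positivity)]
    have : 0 ≤ Cq 1 (3 / 2) * A0 := by positivity
    have : 0 ≤ Cq 1 (3 / 2) * D := by positivity
    have : 0 ≤ Cq 1 (1 / 6) * D := by positivity
    have : 0 ≤ Cq 1 (1 / 6) * A0 := by positivity
    have : 0 ≤ Ce * D := by positivity
    have : 0 ≤ Ce * A0 := by positivity
    have e : x ^ 2 + ((1 ^ 2 / 2 - 3 / 2) * x ^ 2 + -((1 ^ 2 / 2 - 3 / 2) * x ^ 2) * δ ^ 2 + 2 * (Cq 1 (3 / 2) * x ^ (2 + ρ)) * γ ^ ρ)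
      = D + 2 * (Cq 1 (3 / 2) * A0) := by rw [hD, hA0]; ring
    rw [e]
    unfold Km
    linarith
  have b3 : Real.exp (-(Km * (A0 + D))) ≤ ∫ ω, Real.exp (x * S ω - 1 / 2 * x ^ 2 * V ω) ∂P := by
    have h1 : ∫ ω, ZZ P F X x n ω ∂P ≤ ∫ ω, Real.exp (4 * Ce * A0) * Real.exp (x * S ω - 1 / 2 * x ^ 2 * V ω) ∂P := by
      apply integral_mono_ae (g.ZB x).integrable (m3.integrable.const_mul _)
      filter_upwards [g.ZZ_exp hx] with ω hω
      have h2 := hω.2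
      rw [show x ^ 2 / 2 = 1 / 2 * x ^ 2 by ring] at h2
      exact h2
    rw [g.ZZ_one hx, integral_const_mul] at h1
    have h2 := mul_le_mul_of_nonneg_left h1 (Real.exp_pos (-(4 * Ce * A0))).le
    rw [← mul_assoc (Real.exp _) (Real.exp _), ← Real.exp_add, neg_add_cancel, Real.exp_zero, one_mul, mul_one] at h2
    refine le_trans (Real.exp_le_exp.2 ?_) h2
    have : 0 ≤ Cq 1 (3 / 2) * A0 := by positivity
    have : 0 ≤ Cq 1 (3 / 2) * D := by positivity
    have : 0 ≤ Cq 1 (1 / 6) * D := by positivity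
    have : 0 ≤ Cq 1 (1 / 6) * A0 := by positivity
    have : 0 ≤ Ce * D := by positivity
    unfold Km
    linarith
  have b4 : Real.exp (Km * (A0 + D)) - Real.exp (-(Km * (A0 + D))) ≤ 2 * (Km * (A0 + D)) * Real.exp (Km * (A0 + D)) := by
    have h1 := Real.add_one_le_exp (-(2 * (Km * (A0 + D))))
    have h2 := mul_le_mul_of_nonneg_left h1 (Real.exp_pos (Km * (A0 + D))).le
    rw [← Real.exp_add, show Km * (A0 + D) + -(2 * (Km * (A0 + D))) = -(Km * (A0 + D)) by ring] at h2
    linarith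
  linarith

/-- middle range contribution -/
lemma up_mid (g : Good P F n X v ρ γ δ) (hx : SmallX x γ) (hx1 : 1 ≤ x) :
    48 / (x ^ 3 * (γ ^ (ρ / 2) + δ)) * ∫ ω, GG X n x ω ∂P ≤
      (1 - stdNormalCDF x) * (20736 * Km * R0 ρ γ δ x * Real.exp (Km * R0 ρ γ δ x)) := by
  obtain ⟨-, h⟩ := g.GG_int hx
  have hx0 := hx.1
  obtain ⟨gh1, gh2, gh3, gh4⟩ := g.gam_half
  have hδ0 := g.δ0
  set r := γ ^ (ρ / 2) + δ with hr
  have hr0 : 0 < r := by linarith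
  set A0 := x ^ (2 + ρ) * γ ^ ρ with hA0
  have hA00 : 0 ≤ A0 := mul_nonneg (Real.rpow_nonneg hx0 _) g.gr_pos.le
  set D := x ^ 2 * δ ^ 2 with hD
  have hD0 : 0 ≤ D := by positivity
  obtain ⟨R1, R2, R3⟩ := g.R0_pos hx0
  have hKm := Km_ge
  have hm := mills hx0
  rw [div_le_iff₀ (by positivity)] at hm
  have hcp := cdf_compl_pos x
  have hm2 : Real.exp (-(x ^ 2) / 2) ≤ (1 - stdNormalCDF x) * (54 * x) :=
    hm.trans (mul_le_mul_of_nonneg_left (by linarith) hcp.le)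
  have hAr : A0 + D ≤ x ^ 2 * r * R0 ρ γ δ x := by
    have h1 : x ^ (2 + ρ) ≤ x ^ 2 * x := by
      have : x ^ (2 + ρ) ≤ x ^ (3:ℝ) := Real.rpow_le_rpow_of_exponent_le hx1 (by linarith [g.ρ1])
      rw [show (3:ℝ) = ((3:ℕ):ℝ) by norm_num, Real.rpow_natCast] at this
      linarith
    have h2 : A0 ≤ x ^ 2 * x * (γ ^ (ρ / 2) * γ ^ (ρ / 2)) := by
      rw [hA0, gh2]
      exact mul_le_mul_of_nonneg_right h1 (by positivity)
    have h3 : x ^ 2 * (x * γ ^ (ρ / 2) * γ ^ (ρ / 2)) ≤ x ^ 2 * (x * γ ^ (ρ / 2) * r) := by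
      apply mul_le_mul_of_nonneg_left _ (by positivity)
      exact mul_le_mul_of_nonneg_left (by linarith) (by positivity)
    have h4 : x ^ 2 * (δ * δ) ≤ x ^ 2 * (δ * r) := by
      apply mul_le_mul_of_nonneg_left _ (by positivity)
      exact mul_le_mul_of_nonneg_left (by linarith) (by positivity)
    have h5 : x * γ ^ (ρ / 2) + δ ≤ R0 ρ γ δ x := by
      have : 0 ≤ x * δ := by positivity
      linarith
    have h6 := mul_le_mul_of_nonneg_left h5 (by positivity : 0 ≤ x ^ 2 * r)
    rw [hD]
    linarith
  have hEx : Real.exp (Km * (A0 + D)) ≤ Real.exp (Km * R0 ρ γ δ x) :=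
    Real.exp_le_exp.2 (mul_le_mul_of_nonneg_left R3 (by linarith))
  have h2 : 8 * Km * (A0 + D) * Real.exp (Km * (A0 + D)) ≤ 8 * Km * (x ^ 2 * r * R0 ρ γ δ x) * Real.exp (Km * R0 ρ γ δ x) :=
    mul_le_mul (mul_le_mul_of_nonneg_left hAr (by linarith)) hEx (Real.exp_pos _).le (by positivity)
  have h3 := h.trans (mul_le_mul hm2 h2 (by positivity) (by positivity))
  refine (mul_le_mul_of_nonneg_left h3 (by positivity)).trans (le_of_eq ?_)
  field_simp
  ring

end Good
end Cr


namespace Cr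

noncomputable def Mb : ℝ := 2 + 2 * Real.exp 9
noncomputable def Cb : ℝ := 64 + 2 * Real.exp 18

namespace Good
variable {Ω : Type} [mΩ : MeasurableSpace Ω] {P : Measure Ω} [IsProbabilityMeasure P]
  {F : ℕ → MeasurableSpace Ω} {n : ℕ} {X v : ℕ → Ω → ℝ} {ρ γ δ x η a : ℝ}

lemma S_of_WW {ω : Ω} (h : x ≤ WW X n ω) :
    x * Real.sqrt (∑ i ∈ Finset.range n, X i ω ^ 2) ≤ ∑ i ∈ Finset.range n, X i ω := by
  unfold WW at h
  have hV : 0 ≤ ∑ i ∈ Finset.range n, X i ω ^ 2 := Finset.sum_nonneg fun i _ => sq_nonneg _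
  rcases hV.eq_or_lt with h0 | h0
  · rw [sum_sq_zero h0.symm, ← h0]; simp
  · rwa [le_div_iff₀ (Real.sqrt_pos.2 h0)] at h

lemma big_pt {ω : Ω} (hx1 : 1 ≤ x) (hW : x ≤ WW X n ω) (hV4 : 4 ≤ ∑ i ∈ Finset.range n, X i ω ^ 2) :
    1 ≤ Real.exp (-(9 / 8 * x ^ 2)) * Real.exp (∑ i ∈ Finset.range n, 18 * (if |x * X i ω| ≤ 1 then 0 else 1))
      + Real.exp (-(9 / 4 * x ^ 2)) * Real.exp (∑ i ∈ Finset.range n, 3 / 2 * (if |x * X i ω| ≤ 1 then x * X i ω else 0)) := by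
  have hS := S_of_WW hW
  set S := ∑ i ∈ Finset.range n, X i ω with hSd
  set V := ∑ i ∈ Finset.range n, X i ω ^ 2 with hVd
  rw [← Real.exp_add, ← Real.exp_add, ← Finset.mul_sum, ← Finset.mul_sum]
  set N : ℝ := ∑ i ∈ Finset.range n, (if |x * X i ω| ≤ 1 then 0 else 1) with hN
  set L := ∑ i ∈ Finset.range n, (if |x * X i ω| ≤ 1 then x * X i ω else 0) with hL
  have hx0 : 0 < x := by linarith
  by_cases hc : x ^ 2 / 16 ≤ N
  · have h1 : 1 ≤ Real.exp (-(9 / 8 * x ^ 2) + 18 * N) := Real.one_le_exp (by linarith)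
    have h2 := Real.exp_pos (-(9 / 4 * x ^ 2) + 3 / 2 * L)
    linarith
  · push Not at hc
    have hs0 := Real.sqrt_nonneg V
    have hs2 : 2 ≤ Real.sqrt V := by
      apply Real.le_sqrt_of_sq_le; linarith
    have hsq : Real.sqrt V ^ 2 = V := Real.sq_sqrt (by linarith)
    set J := ∑ i ∈ Finset.range n, (if |x * X i ω| ≤ 1 then (0:ℝ) else 1) * X i ω with hJ
    have e : x * S = L + x * J := by
      rw [hSd, hL, hJ, Finset.mul_sum, Finset.mul_sum, ← Finset.sum_add_distrib]
      apply Finset.sum_congr rfl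
      intro i _
      split_ifs <;> ring
    have hcs : J ^ 2 ≤ N * V := by
      have h1 := Finset.sum_mul_sq_le_sq_mul_sq (Finset.range n) (fun i => if |x * X i ω| ≤ 1 then (0:ℝ) else 1) (fun i => X i ω)
      have h2 : ∑ i ∈ Finset.range n, (if |x * X i ω| ≤ 1 then (0:ℝ) else 1) ^ 2 = N := by
        apply Finset.sum_congr rfl
        intro i _
        split_ifs <;> norm_num
      rw [h2] at h1
      exact h1
    have hJ2 : J ≤ x * Real.sqrt V / 4 := by
      apply abs_le_of_sq_le_sq' _ (by positivity) |>.2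
      refine hcs.trans ((mul_le_mul_of_nonneg_right hc.le (by linarith)).trans (le_of_eq ?_))
      linear_combination (-(x ^ 2 / 16)) * hsq
    have hL2 : 3 / 2 * x ^ 2 ≤ L := by
      have h1 := mul_le_mul_of_nonneg_left hS hx0.le
      have h2 := mul_le_mul_of_nonneg_left hJ2 hx0.le
      have h3 := mul_le_mul_of_nonneg_left hs2 (by positivity : 0 ≤ x ^ 2)
      linarith
    have h1 : 1 ≤ Real.exp (-(9 / 4 * x ^ 2) + 3 / 2 * L) := Real.one_le_exp (by linarith)
    have h2 := Real.exp_pos (-(9 / 8 * x ^ 2) + 18 * N)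
    linarith

lemma Vmeas (g : Good P F n X v ρ γ δ) : Measurable (fun ω => ∑ i ∈ Finset.range n, X i ω ^ 2) :=
  Finset.measurable_fun_sum _ fun i _ => (g.Xmeas i).pow_const 2

lemma big_a (g : Good P F n X v ρ γ δ) (hx1 : 1 ≤ x) :
    ∫ ω, ii x (WW X n ω) * ii 4 (∑ i ∈ Finset.range n, X i ω ^ 2) ∂P
      ≤ 2 * Real.exp (-(9 / 8 * x ^ 2) + Cb * (x ^ (2 + ρ) * γ ^ ρ + x ^ 2 * δ ^ 2)) := by
  have hx0 : 0 ≤ x := by linarith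
  have ms : MeasurableSet {y : ℝ | |x * y| ≤ 1} := measurableSet_le (by fun_prop) measurable_const
  have f1 : Measurable (fun y : ℝ => 18 * (if |x * y| ≤ 1 then (0:ℝ) else 1)) :=
    (Measurable.ite ms measurable_const measurable_const).const_mul _
  have f2 : Measurable (fun y : ℝ => 3 / 2 * (if |x * y| ≤ 1 then x * y else 0)) :=
    (Measurable.ite ms (by fun_prop) measurable_const).const_mul _
  have B1 : ∀ y : ℝ, 18 * (if |x * y| ≤ 1 then (0:ℝ) else 1) ≤ 18 := fun y => by split_ifs <;> norm_num
  have B2 : ∀ y : ℝ, 3 / 2 * (if |x * y| ≤ 1 then x * y else 0) ≤ 3 / 2 := fun y => by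
    split_ifs with h
    · linarith [(abs_le.1 h).2]
    · norm_num
  have hxp : 0 ≤ x ^ (2 + ρ) := Real.rpow_nonneg hx0 _
  have sc : ∀ y : ℝ, |x * y| ^ (2 + ρ) = x ^ (2 + ρ) * |y| ^ (2 + ρ) := fun y => by
    rw [abs_mul, abs_of_nonneg hx0, Real.mul_rpow hx0 (abs_nonneg _)]
  have u1 := g.gl_sum f1 B1 (α := 0) (β := 0) (κ := Real.exp 18 * x ^ (2 + ρ)) (by positivity) (fun y => by
    have := trunc_jump (K := 18) g.ρ0.le (by norm_num) (x * y)
    rw [sc] at this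
    linarith)
  have u2 := g.gl_sum f2 B2 (α := 3 / 2 * x) (β := 9 / 8 * x ^ 2) (κ := 31 * x ^ (2 + ρ)) (by positivity) (fun y => by
    have := trunc_lin g.ρ0.le g.ρ1 (x * y)
    rw [sc] at this
    linarith)
  have w1 := g.expsumBM f1 B1 n
  have w2 := g.expsumBM f2 B2 n
  have i1 : Integrable (fun ω => Real.exp (-(9 / 8 * x ^ 2)) * Real.exp (∑ i ∈ Finset.range n, 18 * (if |x * X i ω| ≤ 1 then (0:ℝ) else 1))) P :=
    w1.integrable.const_mul _
  have i2 : Integrable (fun ω => Real.exp (-(9 / 4 * x ^ 2)) * Real.exp (∑ i ∈ Finset.range n, 3 / 2 * (if |x * X i ω| ≤ 1 then x * X i ω else 0))) P :=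
    w2.integrable.const_mul _
  have i0 := ((iiBM g.WW_meas x).mul (iiBM g.Vmeas 4)).integrable (P := P)
  have key := integral_mono i0 (i1.add i2) (fun ω => by
    show ii x (WW X n ω) * ii 4 (∑ i ∈ Finset.range n, X i ω ^ 2) ≤
      Real.exp (-(9 / 8 * x ^ 2)) * Real.exp (∑ i ∈ Finset.range n, 18 * (if |x * X i ω| ≤ 1 then (0:ℝ) else 1)) +
      Real.exp (-(9 / 4 * x ^ 2)) * Real.exp (∑ i ∈ Finset.range n, 3 / 2 * (if |x * X i ω| ≤ 1 then x * X i ω else 0))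
    by_cases h1 : x ≤ WW X n ω
    · by_cases h2 : 4 ≤ ∑ i ∈ Finset.range n, X i ω ^ 2
      · have := big_pt hx1 h1 h2
        unfold ii
        rw [if_pos h1, if_pos h2, one_mul]
        exact this
      · unfold ii
        rw [if_neg h2, mul_zero]
        positivity
    · unfold ii
      rw [if_neg h1, zero_mul]
      positivity)
  refine key.trans ?_
  have e : ∀ f h : Ω → ℝ, Integrable f P → Integrable h P → ∫ ω, (f + h) ω ∂P = ∫ ω, f ω ∂P + ∫ ω, h ω ∂P :=
    fun f h a b => integral_add a b
  rw [e _ _ i1 i2, integral_const_mul, integral_const_mul]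
  set A0 := x ^ (2 + ρ) * γ ^ ρ with hA0
  have hA00 : 0 ≤ A0 := mul_nonneg hxp g.gr_pos.le
  set D := x ^ 2 * δ ^ 2 with hD
  have hD0 : 0 ≤ D := by positivity
  have h18 := Real.exp_pos 18
  have t1 := mul_nonneg h18.le hA00
  have t2 := mul_nonneg h18.le hD0
  have b1 := mul_le_mul_of_nonneg_left u1 (Real.exp_pos (-(9 / 8 * x ^ 2))).le
  rw [← Real.exp_add] at b1
  have c1 : Real.exp (-(9 / 8 * x ^ 2) + (0 + |0| * δ ^ 2 + 2 * (Real.exp 18 * x ^ (2 + ρ)) * γ ^ ρ)) ≤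
      Real.exp (-(9 / 8 * x ^ 2) + Cb * (A0 + D)) := by
    apply Real.exp_le_exp.2
    have e1 : 0 + |0| * δ ^ 2 + 2 * (Real.exp 18 * x ^ (2 + ρ)) * γ ^ ρ = 2 * (Real.exp 18 * A0) := by
      rw [hA0, abs_zero]; ring
    rw [e1]; unfold Cb; linarith
  have b2 := mul_le_mul_of_nonneg_left u2 (Real.exp_pos (-(9 / 4 * x ^ 2))).le
  rw [← Real.exp_add, abs_of_nonneg (by positivity)] at b2
  have c2 : Real.exp (-(9 / 4 * x ^ 2) + (9 / 8 * x ^ 2 + 9 / 8 * x ^ 2 * δ ^ 2 + 2 * (31 * x ^ (2 + ρ)) * γ ^ ρ)) ≤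
      Real.exp (-(9 / 8 * x ^ 2) + Cb * (A0 + D)) := by
    apply Real.exp_le_exp.2
    have e1 : -(9 / 4 * x ^ 2) + (9 / 8 * x ^ 2 + 9 / 8 * x ^ 2 * δ ^ 2 + 2 * (31 * x ^ (2 + ρ)) * γ ^ ρ) = -(9 / 8 * x ^ 2) + (9 / 8 * D + 62 * A0) := by
      rw [hA0, hD]; ring
    rw [e1]; unfold Cb; linarith
  linarith

lemma big_b (g : Good P F n X v ρ γ δ) (x : ℝ) :
    ∫ ω, ii x (WW X n ω) * ii 4 (∑ i ∈ Finset.range n, X i ω ^ 2) ∂P ≤ Mb * (γ ^ (ρ / 2) + δ) ^ 2 := by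
  have i0 := ((iiBM g.WW_meas x).mul (iiBM g.Vmeas 4)).integrable (P := P)
  have hm : Measurable (fun ω => (∑ i ∈ Finset.range n, X i ω ^ 2 - 1) ^ 2) := (g.Vmeas.sub measurable_const).pow_const 2
  have key := integral_mono i0 (iiBM hm 9).integrable (fun ω => by
    show ii x (WW X n ω) * ii 4 (∑ i ∈ Finset.range n, X i ω ^ 2) ≤ ii 9 ((∑ i ∈ Finset.range n, X i ω ^ 2 - 1) ^ 2)
    refine (mul_le_of_le_one_left (ii_nonneg _ _) (ii_le _ _)).trans (ii_mono fun h => ?_)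
    nlinarith)
  refine key.trans ((g.V_tail (by norm_num)).trans ?_)
  obtain ⟨gh1, gh2, gh3, gh4⟩ := g.gam_half
  have hδ0 := g.δ0
  have h9 := Real.exp_pos 9
  have h1 : γ ^ ρ + δ ^ 2 ≤ (γ ^ (ρ / 2) + δ) ^ 2 := by
    rw [gh2]
    have := mul_nonneg gh4.le hδ0
    linarith [this]
  have h2 := mul_le_mul_of_nonneg_left h1 h9.le
  have h3 : 0 ≤ Real.exp 9 * (γ ^ ρ + δ ^ 2) := by
    have := g.gr_pos; positivity
  have h4 : 0 ≤ δ ^ 2 := sq_nonneg _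
  unfold Mb
  linarith

lemma big_c (g : Good P F n X v ρ γ δ) (hx1 : 1 ≤ x) :
    ∫ ω, ii x (WW X n ω) * ii 4 (∑ i ∈ Finset.range n, X i ω ^ 2) ∂P ≤
      (1 - stdNormalCDF x) * (216 * Mb * R0 ρ γ δ x * Real.exp (Cb * R0 ρ γ δ x)) := by
  have hx0 : 0 ≤ x := by linarith
  have ha := g.big_a hx1
  have hb := g.big_b x
  set p := ∫ ω, ii x (WW X n ω) * ii 4 (∑ i ∈ Finset.range n, X i ω ^ 2) ∂P with hp
  have hp0 : 0 ≤ p := integral_nonneg fun ω => mul_nonneg (ii_nonneg _ _) (ii_nonneg _ _)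
  obtain ⟨gh1, gh2, gh3, gh4⟩ := g.gam_half
  have hδ0 := g.δ0
  obtain ⟨R1, R2, R3⟩ := g.R0_pos hx0
  set r := γ ^ (ρ / 2) + δ with hr
  have hr0 : 0 < r := by linarith
  have hrR : r ≤ R0 ρ γ δ x := by
    have : 0 ≤ x * (δ + γ ^ (ρ / 2)) := by positivity
    linarith
  have hM : 2 ≤ Mb := by unfold Mb; linarith [Real.exp_pos 9]
  have hC : 0 ≤ Cb := by unfold Cb; positivity
  set R := R0 ρ γ δ x with hR
  have ha' : p ≤ 2 * Real.exp (-(9 / 8 * x ^ 2) + Cb * R) := by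
    refine ha.trans (mul_le_mul_of_nonneg_left (Real.exp_le_exp.2 ?_) (by norm_num))
    have := mul_le_mul_of_nonneg_left R3 hC
    linarith
  set q := Real.exp (-(9 / 16 * x ^ 2) + Cb * R / 2) with hq
  have hq0 : 0 < q := Real.exp_pos _
  have hqq : Real.exp (-(9 / 8 * x ^ 2) + Cb * R) = q ^ 2 := by
    rw [hq, sq (Real.exp _), ← Real.exp_add]; congr 1; ring
  have h1 : p ≤ 2 * Mb * r * q := by
    apply abs_le_of_sq_le_sq' _ (by positivity) |>.2
    have h2 : p ^ 2 ≤ (2 * q ^ 2) * (Mb * r ^ 2) := by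
      rw [sq]
      rw [hqq] at ha'
      exact mul_le_mul ha' hb hp0 (by positivity)
    refine h2.trans ?_
    have h3 : 0 ≤ Mb * (q ^ 2 * r ^ 2) * (4 * Mb - 2) := mul_nonneg (by positivity) (by linarith)
    linarith
  have hm := mills hx0
  rw [div_le_iff₀ (by positivity)] at hm
  have hcp := cdf_compl_pos x
  have hm2 : Real.exp (-(x ^ 2) / 2) ≤ (1 - stdNormalCDF x) * (54 * x) :=
    hm.trans (mul_le_mul_of_nonneg_left (by linarith) hcp.le)
  have hs : x * Real.exp (-(x ^ 2 / 16)) ≤ 2 := by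
    have h2 := Real.add_one_le_exp (x ^ 2 / 16)
    have h3 : x ≤ 2 * Real.exp (x ^ 2 / 16) := by nlinarith [sq_nonneg (x - 4)]
    have h4 := mul_le_mul_of_nonneg_right h3 (Real.exp_pos (-(x ^ 2 / 16))).le
    rw [mul_assoc, ← Real.exp_add, add_neg_cancel, Real.exp_zero, mul_one] at h4
    exact h4
  have hqe : q ≤ (1 - stdNormalCDF x) * 108 * Real.exp (Cb * R) := by
    have e1 : q = Real.exp (-(x ^ 2) / 2) * Real.exp (-(x ^ 2 / 16)) * Real.exp (Cb * R / 2) := by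
      rw [hq, ← Real.exp_add, ← Real.exp_add]; congr 1; ring
    have e2 : Real.exp (Cb * R / 2) ≤ Real.exp (Cb * R) := Real.exp_le_exp.2 (by
      have := mul_nonneg hC R2.le
      linarith)
    rw [e1]
    apply mul_le_mul _ e2 (Real.exp_pos _).le (by positivity)
    refine (mul_le_mul_of_nonneg_right hm2 (Real.exp_pos _).le).trans ?_
    have := mul_le_mul_of_nonneg_left hs (by positivity : 0 ≤ (1 - stdNormalCDF x) * 54)
    linarith
  refine h1.trans ((mul_le_mul (mul_le_mul_of_nonneg_left hrR (by positivity)) hqe hq0.le (by positivity)).trans (le_of_eq ?_))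
  ring

end Good

lemma exp_comb {a b c R : ℝ} (ha : 0 ≤ a) (hb : 0 ≤ b) (hc : 0 ≤ c) (hR : 0 ≤ R) :
    Real.exp (a * R) + b * R * Real.exp (c * R) ≤ Real.exp ((a + b + c) * R) := by
  have h1 : Real.exp (a * R) ≤ Real.exp ((a + c) * R) := Real.exp_le_exp.2 (by
    have := mul_nonneg hc hR; linarith)
  have h2 : Real.exp (c * R) ≤ Real.exp ((a + c) * R) := Real.exp_le_exp.2 (by
    have := mul_nonneg ha hR; linarith)
  have h3 := mul_le_mul_of_nonneg_left h2 (mul_nonneg hb hR)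
  have h4 := Real.add_one_le_exp (b * R)
  have h5 := mul_le_mul_of_nonneg_left h4 (Real.exp_pos ((a + c) * R)).le
  rw [← Real.exp_add, show (a + c) * R + b * R = (a + b + c) * R by ring] at h5
  linarith

noncomputable def Ka : ℝ := 4 * Ce + 1080 * K1 + 28
noncomputable def Ku : ℝ := Ka + (20736 * Km + 216 * Mb) + (Km + Cb)
lemma K_pos : 0 ≤ Ka ∧ 0 ≤ Km ∧ 0 ≤ Mb ∧ 0 ≤ Cb := by
  refine ⟨?_, ?_, ?_, ?_⟩
  · unfold Ka; linarith [Ce_ge, K1_ge]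
  · linarith [Km_ge]
  · unfold Mb; positivity
  · unfold Cb; positivity

namespace Good
variable {Ω : Type} [mΩ : MeasurableSpace Ω] {P : Measure Ω} [IsProbabilityMeasure P]
  {F : ℕ → MeasurableSpace Ω} {n : ℕ} {X v : ℕ → Ω → ℝ} {ρ γ δ x η a : ℝ}

lemma TT_low {ω : Ω} (hx : 0 ≤ x) (h : x ≤ WW X n ω) :
    -(x * (Real.sqrt (∑ i ∈ Finset.range n, X i ω ^ 2) - 1) ^ 2 / 2) ≤ TT X n x ω := by
  have h1 := S_of_WW h
  unfold TT
  have h2 := Real.sq_sqrt (Finset.sum_nonneg fun i (_ : i ∈ Finset.range n) => sq_nonneg (X i ω))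
  set s := Real.sqrt (∑ i ∈ Finset.range n, X i ω ^ 2) with hs
  rw [← h2]
  linarith

lemma up_small (g : Good P F n X v ρ γ δ) (hx : SmallX x γ) (hx1 : x ≤ 1) :
    pW P X n x ≤ Real.exp ((Ka + 108 * (2 + 8 * Real.exp 9)) * R0 ρ γ δ x) * (1 - stdNormalCDF x) := by
  have hx0 := hx.1
  obtain ⟨gh1, gh2, gh3, gh4⟩ := g.gam_half
  have hδ0 := g.δ0
  obtain ⟨R1, R2, R3⟩ := g.R0_pos hx0
  have hA := g.up_A hx
  set r := γ ^ (ρ / 2) + δ with hr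
  have hr0 : 0 < r := by linarith
  have hrR : r ≤ R0 ρ γ δ x := by
    have : 0 ≤ x * (δ + γ ^ (ρ / 2)) := by positivity
    linarith
  set R := R0 ρ γ δ x with hR
  have hm : Measurable (fun ω => (∑ i ∈ Finset.range n, X i ω ^ 2 - 1) ^ 2) := (g.Vmeas.sub measurable_const).pow_const 2
  have i1 : Integrable (fun ω => ii (-r) (TT X n x ω)) P := (iiBM (g.TT_meas x) _).integrable
  have i2 : Integrable (fun ω => ii (2 * r) ((∑ i ∈ Finset.range n, X i ω ^ 2 - 1) ^ 2)) P := (iiBM hm _).integrable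
  have i3 : Integrable (fun ω => ii (-r) (TT X n x ω) + ii (2 * r) ((∑ i ∈ Finset.range n, X i ω ^ 2 - 1) ^ 2)) P := i1.add i2
  have key : pW P X n x ≤ ∫ ω, (ii (-r) (TT X n x ω) + ii (2 * r) ((∑ i ∈ Finset.range n, X i ω ^ 2 - 1) ^ 2)) ∂P := by
    apply integral_mono (iiBM g.WW_meas x).integrable i3
    intro ω
    show ii x (WW X n ω) ≤ ii (-r) (TT X n x ω) + ii (2 * r) ((∑ i ∈ Finset.range n, X i ω ^ 2 - 1) ^ 2)
    by_cases h1 : -r ≤ TT X n x ω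
    · have h2 := ii_le x (WW X n ω)
      have h3 := ii_nonneg (2 * r) ((∑ i ∈ Finset.range n, X i ω ^ 2 - 1) ^ 2)
      have h4 : ii (-r) (TT X n x ω) = 1 := if_pos h1
      linarith
    · have h4 : ii (-r) (TT X n x ω) = 0 := if_neg h1
      rw [h4, zero_add]
      apply ii_mono
      intro hW
      have h5 := TT_low hx0 hW
      push Not at h1
      have h2 := Real.sq_sqrt (Finset.sum_nonneg fun i (_ : i ∈ Finset.range n) => sq_nonneg (X i ω))
      have hs0 := Real.sqrt_nonneg (∑ i ∈ Finset.range n, X i ω ^ 2)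
      set s := Real.sqrt (∑ i ∈ Finset.range n, X i ω ^ 2) with hs
      rw [← h2]
      have h6 : x * (s - 1) ^ 2 ≤ (s - 1) ^ 2 := by
        have := mul_le_mul_of_nonneg_right hx1 (sq_nonneg (s - 1))
        linarith
      have h7 : (s - 1) ^ 2 * 1 ≤ (s - 1) ^ 2 * (s + 1) ^ 2 := mul_le_mul_of_nonneg_left (by nlinarith) (sq_nonneg _)
      linarith
  rw [integral_add i1 i2] at key
  have hV := g.V_tail (by linarith : 0 < 2 * r)
  have h9 := Real.exp_pos 9
  have hV2 : 2 * γ ^ ρ + 16 * Real.exp 9 * (γ ^ ρ + δ ^ 2) / (2 * r) ≤ (2 + 8 * Real.exp 9) * r := by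
    have h1 : γ ^ ρ ≤ r := by
      rw [gh2]
      have := mul_le_mul_of_nonneg_left gh3 gh4.le
      linarith
    have h2 : γ ^ ρ + δ ^ 2 ≤ r ^ 2 := by
      rw [gh2, hr]
      have := mul_nonneg gh4.le hδ0
      linarith [this]
    have h3 : 16 * Real.exp 9 * (γ ^ ρ + δ ^ 2) / (2 * r) ≤ 8 * Real.exp 9 * r := by
      rw [div_le_iff₀ (by positivity)]
      have := mul_le_mul_of_nonneg_left h2 h9.le
      linarith
    linarith
  have hcp := cdf_compl_pos x
  have hc1 : 1 ≤ 108 * (1 - stdNormalCDF x) := by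
    have hm := mills hx0
    rw [div_le_iff₀ (by positivity)] at hm
    have h1 : 1 / 2 ≤ Real.exp (-(x ^ 2) / 2) := by
      have := Real.add_one_le_exp (-(x ^ 2) / 2)
      nlinarith
    have h2 : (1 - stdNormalCDF x) * (27 * (1 + x)) ≤ (1 - stdNormalCDF x) * 54 := mul_le_mul_of_nonneg_left (by linarith) hcp.le
    linarith
  have hfin := exp_comb (a := Ka) (b := 108 * (2 + 8 * Real.exp 9)) (c := 0) K_pos.1 (by positivity) le_rfl R2.le
  rw [zero_mul, Real.exp_zero, mul_one, add_zero] at hfin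
  have h1 : (2 + 8 * Real.exp 9) * r ≤ (2 + 8 * Real.exp 9) * R * (108 * (1 - stdNormalCDF x)) := by
    have h2 := mul_le_mul_of_nonneg_left hrR (by positivity : 0 ≤ 2 + 8 * Real.exp 9)
    have h3 := mul_le_mul_of_nonneg_left hc1 (by positivity : 0 ≤ (2 + 8 * Real.exp 9) * R)
    linarith
  have h2 := mul_le_mul_of_nonneg_right hfin hcp.le
  have hA' : ∫ ω, ii (-r) (TT X n x ω) ∂P ≤ (1 - stdNormalCDF x) * Real.exp (Ka * R) := hA
  linarith

lemma up_large (g : Good P F n X v ρ γ δ) (hx : SmallX x γ) (hx1 : 1 ≤ x) :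
    pW P X n x ≤ Real.exp (Ku * R0 ρ γ δ x) * (1 - stdNormalCDF x) := by
  have hx0 := hx.1
  obtain ⟨gh1, gh2, gh3, gh4⟩ := g.gam_half
  have hδ0 := g.δ0
  obtain ⟨R1, R2, R3⟩ := g.R0_pos hx0
  have hA := g.up_A hx
  have hB := g.up_mid hx hx1
  have hC := g.big_c hx1
  set r := γ ^ (ρ / 2) + δ with hr
  have hr0 : 0 < r := by linarith
  set R := R0 ρ γ δ x with hR
  set q := 48 / (x ^ 3 * r) with hq
  have hq0 : 0 < q := by positivity
  have i1 : Integrable (fun ω => ii (-r) (TT X n x ω)) P := (iiBM (g.TT_meas x) _).integrable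
  have i2 : Integrable (fun ω => q * GG X n x ω) P := (g.GG_int hx).1.const_mul _
  have i3 : Integrable (fun ω => ii x (WW X n ω) * ii 4 (∑ i ∈ Finset.range n, X i ω ^ 2)) P :=
    ((iiBM g.WW_meas x).mul (iiBM g.Vmeas 4)).integrable
  have i12 : Integrable (fun ω => ii (-r) (TT X n x ω) + q * GG X n x ω) P := i1.add i2
  have i4 : Integrable (fun ω => ii (-r) (TT X n x ω) + q * GG X n x ω +
    ii x (WW X n ω) * ii 4 (∑ i ∈ Finset.range n, X i ω ^ 2)) P := i12.add i3
  have key : pW P X n x ≤ ∫ ω, (ii (-r) (TT X n x ω) + q * GG X n x ω +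
      ii x (WW X n ω) * ii 4 (∑ i ∈ Finset.range n, X i ω ^ 2)) ∂P := by
    apply integral_mono (iiBM g.WW_meas x).integrable i4
    intro ω
    show ii x (WW X n ω) ≤ ii (-r) (TT X n x ω) + q * GG X n x ω +
      ii x (WW X n ω) * ii 4 (∑ i ∈ Finset.range n, X i ω ^ 2)
    have hG0 : 0 ≤ GG X n x ω := mul_nonneg (Real.exp_pos _).le (FF_nonneg _)
    have hqG := mul_nonneg hq0.le hG0
    have hT0 := ii_nonneg (-r) (TT X n x ω)
    have hW0 := ii_nonneg x (WW X n ω)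
    have hV0 := ii_nonneg 4 (∑ i ∈ Finset.range n, X i ω ^ 2)
    have hWV := mul_nonneg hW0 hV0
    by_cases hW : x ≤ WW X n ω
    · have hW1 : ii x (WW X n ω) = 1 := if_pos hW
      rw [hW1]
      by_cases h1 : -r ≤ TT X n x ω
      · have h4 : ii (-r) (TT X n x ω) = 1 := if_pos h1
        linarith
      · by_cases hV : 4 ≤ ∑ i ∈ Finset.range n, X i ω ^ 2
        · have h4 : ii 4 (∑ i ∈ Finset.range n, X i ω ^ 2) = 1 := if_pos hV
          linarith
        · push Not at hV h1
          have h5 := TT_low hx0 hW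
          have h6 := mid_pt hx1 hr0 (Finset.sum_nonneg fun i (_ : i ∈ Finset.range n) => sq_nonneg (X i ω)) hV.le (S_of_WW hW) (by linarith)
          have h7 := mul_le_mul_of_nonneg_left h6 hq0.le
          have h8 : q * (x ^ 3 * r / 48) = 1 := by rw [hq]; field_simp
          rw [h8] at h7
          have h9 : 1 ≤ q * GG X n x ω := h7
          linarith
    · have hW1 : ii x (WW X n ω) = 0 := if_neg hW
      rw [hW1] at hWV ⊢
      linarith
  rw [integral_add i12 i3, integral_add i1 i2, integral_const_mul] at key
  obtain ⟨k1, k2, k3, k4⟩ := K_pos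
  have hcp := cdf_compl_pos x
  have hfin := exp_comb (a := Ka) (b := 20736 * Km + 216 * Mb) (c := Km + Cb) k1 (by positivity) (by positivity) R2.le
  have e1 : 20736 * Km * R * Real.exp (Km * R) ≤ 20736 * Km * R * Real.exp ((Km + Cb) * R) :=
    mul_le_mul_of_nonneg_left (Real.exp_le_exp.2 (by have := mul_nonneg k4 R2.le; linarith)) (by positivity)
  have e2 : 216 * Mb * R * Real.exp (Cb * R) ≤ 216 * Mb * R * Real.exp ((Km + Cb) * R) :=
    mul_le_mul_of_nonneg_left (Real.exp_le_exp.2 (by have := mul_nonneg k2 R2.le; linarith)) (by positivity)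
  have hA' : ∫ ω, ii (-r) (TT X n x ω) ∂P ≤ (1 - stdNormalCDF x) * Real.exp (Ka * R) := hA
  have h3 : Real.exp (Ka * R) + 20736 * Km * R * Real.exp (Km * R) + 216 * Mb * R * Real.exp (Cb * R) ≤ Real.exp (Ku * R) := by
    unfold Ku
    linarith
  have h4 := mul_le_mul_of_nonneg_left h3 hcp.le
  linarith

end Good

noncomputable def Kf : ℝ := Ku + (Ka + 108 * (2 + 8 * Real.exp 9))

lemma upper_bound {ρ : ℝ} {Ω : Type} [mΩ : MeasurableSpace Ω] {P : Measure Ω} [IsProbabilityMeasure P]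
      {F : ℕ → MeasurableSpace Ω} {n : ℕ} {X v : ℕ → Ω → ℝ} {γ δ x : ℝ} (g : Good P F n X v ρ γ δ) (hx : 0 ≤ x)
      (h : x * γ ≤ 1 / (2 * Ce)) :
      pW P X n x ≤ Real.exp (Kf * R0 ρ γ δ x) * (1 - stdNormalCDF x) := by
  have hs := smallX_of hx g.γ0 h
  obtain ⟨k1, k2, k3, k4⟩ := K_pos
  have hR := (g.R0_pos hx).2.1
  have hcp := cdf_compl_pos x
  have hKu : 0 ≤ Ku := by unfold Ku; positivity
  rcases le_total x 1 with h1 | h1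
  · refine (g.up_small hs h1).trans (mul_le_mul_of_nonneg_right (Real.exp_le_exp.2 ?_) hcp.le)
    apply mul_le_mul_of_nonneg_right _ hR.le
    unfold Kf; linarith
  · refine (g.up_large hs h1).trans (mul_le_mul_of_nonneg_right (Real.exp_le_exp.2 ?_) hcp.le)
    apply mul_le_mul_of_nonneg_right _ hR.le
    unfold Kf
    have : 0 ≤ 108 * (2 + 8 * Real.exp 9) := by positivity
    linarith

end Cr


namespace Cr

/-- tangent line inequality -/
lemma tangent {ρ m y : ℝ} (h0 : 0 < ρ) (hm : 0 < m) :
    m ^ ρ * ((1 + ρ / 2) * y ^ 2 - ρ / 2 * m ^ 2) ≤ |y| ^ (2 + ρ) := by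
  have hb := one_add_mul_self_le_rpow_one_add (s := y ^ 2 / m ^ 2 - 1) (by
    have : 0 ≤ y ^ 2 / m ^ 2 := by positivity
    linarith) (p := 1 + ρ / 2) (by linarith)
  rw [show 1 + (y ^ 2 / m ^ 2 - 1) = (|y| / m) ^ 2 by rw [div_pow, sq_abs]; ring,
    ← Real.rpow_natCast (|y| / m) 2, ← Real.rpow_mul (by positivity),
    show ((2:ℕ):ℝ) * (1 + ρ / 2) = 2 + ρ by push_cast; ring, Real.div_rpow (abs_nonneg _) hm.le, le_div_iff₀ (by positivity)] at hb
  refine le_trans (le_of_eq ?_) hb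
  rw [Real.rpow_add hm, Real.rpow_two]
  field_simp
  ring

section conv
variable {Ω : Type} [mΩ : MeasurableSpace Ω] {P : Measure Ω} [IsProbabilityMeasure P]

lemma Bsq_pos (A : MDS Ω P) : 0 < A.Bsq := by
  unfold MDS.Bsq
  apply Finset.sum_pos
  · intro i hi
    rw [Finset.mem_Icc] at hi
    exact A.var_pos i hi.1 hi.2
  · exact ⟨1, Finset.mem_Icc.2 ⟨le_rfl, A.npos⟩⟩

lemma sum_shift (f : ℕ → ℝ) (n : ℕ) : ∑ i ∈ Finset.Icc 1 n, f i = ∑ i ∈ Finset.range n, f (i + 1) := by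
  rw [Finset.range_eq_Ico, Finset.sum_Ico_add' f 0 n 1]
  rfl

lemma pull {m : MeasurableSpace Ω} (hm : m ≤ mΩ) {f Y : Ω → ℝ} (hf : Integrable f P) (hY : BM m Y) :
    ∫ ω, Y ω * f ω ∂P = ∫ ω, Y ω * (P[f|m]) ω ∂P := by
  have iY : Integrable (fun ω => Y ω * f ω) P := (hY.mono hm).mul_integrable hf
  have h := condExp_mul_of_stronglyMeasurable_left (m := m) (μ := P) hY.1.stronglyMeasurable iY hf
  have h2 := integral_congr_ae h
  rw [integral_condExp hm] at h2
  exact h2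

lemma cv_le {ρ γ : ℝ} (A : MDS Ω P) (h0 : 0 < ρ) (h4 : A.CondA4 ρ γ) {i : ℕ} (hi : i < A.n) :
    ∀ᵐ ω ∂P, (P[fun ω' => (A.X (i + 1) ω') ^ 2|A.F i]) ω ≤ γ ^ 2 * A.Bsq := by
  obtain ⟨g0, g1, hInteg, hA⟩ := h4
  have hB := Bsq_pos A
  set m := γ * Real.sqrt A.Bsq with hm
  have hm0 : 0 < m := mul_pos g0 (Real.sqrt_pos.2 hB)
  have hm2 : m ^ 2 = γ ^ 2 * A.Bsq := by rw [hm, mul_pow, Real.sq_sqrt hB.le]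
  have i2 := A.sq_int (i + 1) (by omega) (by omega)
  have i3 := hInteg (i + 1) (by omega) (by omega)
  have h1 := hA (i + 1) (by omega) (by omega)
  have e1 := condExp_smul (m ^ ρ * (1 + ρ / 2)) (fun ω' => (A.X (i + 1) ω') ^ 2) (A.F i) (μ := P)
  have i2' : Integrable ((m ^ ρ * (1 + ρ / 2)) • (fun ω' => (A.X (i + 1) ω') ^ 2)) P := i2.smul _
  have e2 := condExp_sub i2' (integrable_const (m ^ ρ * (ρ / 2 * m ^ 2))) (A.F i) (μ := P)
  rw [condExp_const (A.F_le i)] at e2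
  have e3 := condExp_mono (m := A.F i) (i2'.sub (integrable_const (m ^ ρ * (ρ / 2 * m ^ 2)))) i3
    (Eventually.of_forall fun ω => by
      have := tangent (y := A.X (i + 1) ω) h0 hm0
      simp only [Pi.sub_apply, Pi.smul_apply, smul_eq_mul]
      linarith)
  filter_upwards [h1, e1, e2, e3] with ω a1 a2 a3 a4
  rw [a3, Pi.sub_apply, a2, Pi.smul_apply, smul_eq_mul] at a4
  have a5 := a4.trans a1
  rw [← hm2]
  set c := (P[fun ω' => (A.X (i + 1) ω') ^ 2|A.F i]) ω with hc
  have a6 : m ^ ρ * (1 + ρ / 2) * c - m ^ ρ * (ρ / 2 * m ^ 2) ≤ m ^ ρ * c := a5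
  have hmr : 0 < m ^ ρ := Real.rpow_pos_of_pos hm0 _
  have a7 : m ^ ρ * (ρ / 2) * c ≤ m ^ ρ * (ρ / 2) * m ^ 2 := by linarith
  exact le_of_mul_le_mul_left a7 (by positivity)

noncomputable def nX (A : MDS Ω P) (i : ℕ) (ω : Ω) : ℝ := if i < A.n then A.X (i + 1) ω / Real.sqrt A.Bsq else 0
noncomputable def nv (A : MDS Ω P) (γ : ℝ) (i : ℕ) (ω : Ω) : ℝ :=
  if i < A.n then max 0 (min (γ ^ 2) ((P[fun ω' => (A.X (i + 1) ω') ^ 2|A.F i]) ω / A.Bsq)) else 0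

lemma nv_ae {ρ γ : ℝ} (A : MDS Ω P) (h0 : 0 < ρ) (h4 : A.CondA4 ρ γ) {i : ℕ} (hi : i < A.n) :
    ∀ᵐ ω ∂P, nv A γ i ω = (P[fun ω' => (A.X (i + 1) ω') ^ 2|A.F i]) ω / A.Bsq := by
  have hB := Bsq_pos A
  have hn : 0 ≤ᵐ[P] P[fun ω' => (A.X (i + 1) ω') ^ 2|A.F i] := condExp_nonneg (Eventually.of_forall fun ω => sq_nonneg _)
  filter_upwards [cv_le A h0 h4 hi, hn] with ω h1 h2
  unfold nv
  rw [if_pos hi, min_eq_right (by rw [div_le_iff₀ hB]; exact h1), max_eq_right (div_nonneg h2 hB.le)]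

lemma toGood {ρ γ δ : ℝ} (A : MDS Ω P) (h0 : 0 < ρ) (h01 : ρ ≤ 1) (h1 : A.CondA1 δ) (h4 : A.CondA4 ρ γ) :
    Good P A.F A.n (nX A) (nv A γ) ρ γ δ := by
  have hB := Bsq_pos A
  have hs := Real.sqrt_pos.2 hB
  have hss := Real.sq_sqrt hB.le
  have h4' := h4
  obtain ⟨g0, g1, hInteg, hA⟩ := h4'
  have eneg : ∀ i, ¬ i < A.n → nX A i = fun _ => 0 := fun i hi => by ext ω; exact if_neg hi
  have epos : ∀ i, i < A.n → nX A i = fun ω => A.X (i + 1) ω / Real.sqrt A.Bsq := fun i hi => by ext ω; exact if_pos hi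
  have vneg : ∀ i, ¬ i < A.n → nv A γ i = fun _ => 0 := fun i hi => by ext ω; exact if_neg hi
  have vint : ∀ i (Y : Ω → ℝ), i < A.n → ∫ ω, Y ω * nv A γ i ω ∂P
      = (1 / A.Bsq) * ∫ ω, Y ω * (P[fun ω' => (A.X (i + 1) ω') ^ 2|A.F i]) ω ∂P := by
    intro i Y hi
    rw [← integral_const_mul]
    apply integral_congr_ae
    filter_upwards [nv_ae A h0 h4 hi] with ω hω
    rw [hω]; ring
  have epow : ∀ i, i < A.n → (fun ω => |nX A i ω| ^ (2 + ρ)) = fun ω => (1 / Real.sqrt A.Bsq ^ (2 + ρ)) * |A.X (i + 1) ω| ^ (2 + ρ) := by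
    intro i hi
    ext ω
    rw [epos i hi, abs_div, abs_of_pos hs, Real.div_rpow (abs_nonneg _) hs.le]
    ring
  refine ⟨A.F_mono, A.F_le, ?_, ?_, ?_, ?_, ?_, ?_, ?_, ?_, ?_, h0, h01, g0, g1, h1.1, h1.2.1⟩
  · intro i
    by_cases hi : i < A.n
    · rw [epos i hi]
      exact (A.meas (i + 1) (by omega) (by omega)).measurable.div_const _
    · rw [eneg i hi]; exact measurable_const
  · intro i
    by_cases hi : i < A.n
    · have e : nv A γ i = fun ω => max 0 (min (γ ^ 2) ((P[fun ω' => (A.X (i + 1) ω') ^ 2|A.F i]) ω / A.Bsq)) := by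
        ext ω; exact if_pos hi
      rw [e]
      exact measurable_const.max (measurable_const.min (stronglyMeasurable_condExp.measurable.div_const _))
    · rw [vneg i hi]; exact measurable_const
  · intro i ω
    unfold nv
    split_ifs
    · exact le_max_left _ _
    · exact le_rfl
  · intro i ω
    unfold nv
    split_ifs
    · exact max_le (sq_nonneg γ) (min_le_left _ _)
    · exact sq_nonneg γ
  · intro i
    by_cases hi : i < A.n
    · rw [epow i hi]
      exact (hInteg (i + 1) (by omega) (by omega)).const_mul _
    · rw [eneg i hi]
      exact integrable_const _
  · intro i Y hY
    by_cases hi : i < A.n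
    · have hXi : Integrable (A.X (i + 1)) P := by
        have h2 := A.sq_int (i + 1) (by omega) (by omega)
        have hm : AEStronglyMeasurable (A.X (i + 1)) P :=
          ((A.meas (i + 1) (by omega) (by omega)).mono (A.F_le _)).aestronglyMeasurable
        exact ((memLp_two_iff_integrable_sq hm).2 h2).integrable (by norm_num)
      have hp := pull (A.F_le i) hXi hY
      have hz : ∫ ω, Y ω * (P[A.X (i + 1)|A.F i]) ω ∂P = 0 := by
        have hz0 := A.mean_zero (i + 1) (by omega) (by omega)
        rw [show (0:ℝ) = ∫ _ω, (0:ℝ) ∂P by simp]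
        apply integral_congr_ae
        filter_upwards [hz0] with ω hω
        have : (P[A.X (i + 1)|A.F i]) ω = 0 := hω
        rw [this, mul_zero]
      rw [hz] at hp
      rw [epos i hi]
      have e : (fun ω => Y ω * (A.X (i + 1) ω / Real.sqrt A.Bsq)) = fun ω => (1 / Real.sqrt A.Bsq) * (Y ω * A.X (i + 1) ω) := by
        ext ω; ring
      rw [e, integral_const_mul, hp, mul_zero]
    · rw [eneg i hi]; simp
  · intro i Y hY
    by_cases hi : i < A.n
    · have h2 := A.sq_int (i + 1) (by omega) (by omega)
      have hp := pull (A.F_le i) h2 hY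
      rw [vint i Y hi, ← hp, epos i hi, ← integral_const_mul]
      congr 1; ext ω
      rw [div_pow, hss]; ring
    · rw [eneg i hi, vneg i hi]; simp
  · intro i Y hY hY0
    by_cases hi : i < A.n
    · have h3 := hInteg (i + 1) (by omega) (by omega)
      have hp := pull (A.F_le i) h3 hY
      have e : (fun ω => Y ω * |nX A i ω| ^ (2 + ρ)) = fun ω => (1 / Real.sqrt A.Bsq ^ (2 + ρ)) * (Y ω * |A.X (i + 1) ω| ^ (2 + ρ)) := by
        have := epow i hi
        ext ω
        rw [congrFun this ω]; ring
      rw [e, integral_const_mul, hp, vint i Y hi]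
      have hY' := hY.mono (A.F_le i)
      have key : ∫ ω, Y ω * (P[fun ω' => |A.X (i + 1) ω'| ^ (2 + ρ)|A.F i]) ω ∂P ≤
          ∫ ω, (γ * Real.sqrt A.Bsq) ^ ρ * (Y ω * (P[fun ω' => (A.X (i + 1) ω') ^ 2|A.F i]) ω) ∂P := by
        apply integral_mono_ae (hY'.mul_integrable integrable_condExp) ((hY'.mul_integrable integrable_condExp).const_mul _)
        filter_upwards [hA (i + 1) (by omega) (by omega)] with ω hω
        have := mul_le_mul_of_nonneg_left hω (hY0 ω)
        refine le_trans this (le_of_eq ?_)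
        show Y ω * ((γ * Real.sqrt A.Bsq) ^ ρ * (P[fun ω' => (A.X (i + 1) ω') ^ 2|A.F i]) ω) = _
        ring
      rw [integral_const_mul] at key
      refine (mul_le_mul_of_nonneg_left key (by positivity)).trans (le_of_eq ?_)
      rw [Real.mul_rpow g0.le hs.le, Real.rpow_add hs, Real.rpow_two, hss]
      have := Real.rpow_pos_of_pos hs ρ
      field_simp
    · rw [eneg i hi, vneg i hi]
      have : (2 + ρ) ≠ 0 := by linarith
      simp [Real.zero_rpow this]
  · have hall : ∀ᵐ ω ∂P, ∀ i, i < A.n → nv A γ i ω = (P[fun ω' => (A.X (i + 1) ω') ^ 2|A.F i]) ω / A.Bsq := by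
      rw [ae_all_iff]
      intro i
      by_cases hi : i < A.n
      · filter_upwards [nv_ae A h0 h4 hi] with ω hω
        exact fun _ => hω
      · exact Eventually.of_forall fun ω h => absurd h hi
    filter_upwards [hall, h1.2.2] with ω a1 a2
    have e : ∑ i ∈ Finset.range A.n, nv A γ i ω = A.CV ω / A.Bsq := by
      unfold MDS.CV
      rw [sum_shift, Finset.sum_div]
      exact Finset.sum_congr rfl fun i hi => a1 i (Finset.mem_range.1 hi)
    rw [e, show A.CV ω / A.Bsq - 1 = (A.CV ω - A.Bsq) / A.Bsq by field_simp, abs_div, abs_of_pos hB, div_le_iff₀ hB]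
    exact a2

lemma WW_nX (A : MDS Ω P) (ω : Ω) : WW (nX A) A.n ω = A.W ω := by
  have hB := Bsq_pos A
  have hs := Real.sqrt_pos.2 hB
  unfold WW MDS.W MDS.S MDS.QV
  rw [sum_shift, sum_shift]
  have e1 : ∑ i ∈ Finset.range A.n, nX A i ω = (∑ i ∈ Finset.range A.n, A.X (i + 1) ω) / Real.sqrt A.Bsq := by
    rw [Finset.sum_div]
    exact Finset.sum_congr rfl fun i hi => if_pos (Finset.mem_range.1 hi)
  have e2 : ∑ i ∈ Finset.range A.n, nX A i ω ^ 2 = (∑ i ∈ Finset.range A.n, A.X (i + 1) ω ^ 2) / A.Bsq := by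
    rw [Finset.sum_div]
    apply Finset.sum_congr rfl
    intro i hi
    have : nX A i ω = A.X (i + 1) ω / Real.sqrt A.Bsq := if_pos (Finset.mem_range.1 hi)
    rw [this, div_pow, Real.sq_sqrt hB.le]
  rw [e1, e2, Real.sqrt_div' _ hB.le, div_div_div_cancel_right₀ hs.ne']

lemma WW_neg (X : ℕ → Ω → ℝ) (n : ℕ) (ω : Ω) : WW (fun i ω => - X i ω) n ω = - WW X n ω := by
  unfold WW
  simp only [Finset.sum_neg_distrib, neg_sq, neg_div]

lemma pW_eq {X : ℕ → Ω → ℝ} {n : ℕ} (h : Measurable (WW X n)) (x : ℝ) : pW P X n x = (P {ω | x ≤ WW X n ω}).toReal := by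
  have hm : MeasurableSet {ω | x ≤ WW X n ω} := measurableSet_le measurable_const h
  have := integral_indicator_one (μ := P) hm
  rw [← measureReal_def, ← this]
  unfold pW ii
  congr 1

end conv

lemma red {ρ γ x : ℝ} (h0 : 0 < ρ) (h1 : ρ ≤ 1) (g0 : 0 < γ) (g1 : γ ≤ 1) (hx : 0 ≤ x) :
    (1 + x) * γ ^ (ρ / 2) ≤ 2 * (x ^ (2 + ρ) * γ ^ ρ + (1 + x) * (γ ^ (ρ * (2 - ρ) / 4) / (1 + x ^ (ρ * (2 + ρ) / 4)))) := by
  have hq0 : 0 < ρ * (2 + ρ) / 4 := by positivity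
  have hγq : 0 < γ ^ (ρ * (2 - ρ) / 4) := Real.rpow_pos_of_pos g0 _
  have hγ2 : 0 < γ ^ (ρ / 2) := Real.rpow_pos_of_pos g0 _
  have hγρ : 0 < γ ^ ρ := Real.rpow_pos_of_pos g0 _
  have hle : γ ^ (ρ / 2) ≤ γ ^ (ρ * (2 - ρ) / 4) := Real.rpow_le_rpow_of_exponent_ge g0 g1 (by nlinarith)
  have hxq : 0 ≤ x ^ (ρ * (2 + ρ) / 4) := Real.rpow_nonneg hx _
  have hxr : 0 ≤ x ^ (2 + ρ) := Real.rpow_nonneg hx _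
  have hf : 0 ≤ (1 + x) * (γ ^ (ρ * (2 - ρ) / 4) / (1 + x ^ (ρ * (2 + ρ) / 4))) := by positivity
  have ht : 0 ≤ x ^ (2 + ρ) * γ ^ ρ := by positivity
  have suff : γ ^ (ρ / 2) * (1 + x ^ (ρ * (2 + ρ) / 4)) ≤ 2 * γ ^ (ρ * (2 - ρ) / 4) →
      (1 + x) * γ ^ (ρ / 2) ≤ 2 * (x ^ (2 + ρ) * γ ^ ρ + (1 + x) * (γ ^ (ρ * (2 - ρ) / 4) / (1 + x ^ (ρ * (2 + ρ) / 4)))) := by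
    intro h
    have h2 : γ ^ (ρ / 2) ≤ 2 * γ ^ (ρ * (2 - ρ) / 4) / (1 + x ^ (ρ * (2 + ρ) / 4)) := by
      rw [le_div_iff₀ (by positivity)]; exact h
    have h3 := mul_le_mul_of_nonneg_left h2 (by linarith : 0 ≤ 1 + x)
    rw [mul_div_assoc] at h3
    linarith
  rcases le_total x 1 with hx1 | hx1
  · apply suff
    have h2 : x ^ (ρ * (2 + ρ) / 4) ≤ 1 := Real.rpow_le_one hx hx1 hq0.le
    have h3 := mul_le_mul_of_nonneg_left h2 hγ2.le
    linarith
  · have hxp : 0 < x := by linarith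
    rcases le_total 1 (x ^ (1 + ρ) * γ ^ (ρ / 2)) with hc | hc
    · have e1 : x ^ (2 + ρ) * γ ^ ρ = x * γ ^ (ρ / 2) * (x ^ (1 + ρ) * γ ^ (ρ / 2)) := by
        rw [show (2:ℝ) + ρ = 1 + (1 + ρ) by ring, Real.rpow_add hxp, Real.rpow_one,
          show γ ^ ρ = γ ^ (ρ / 2) * γ ^ (ρ / 2) by rw [← Real.rpow_add g0]; ring_nf]
        ring
      have h2 := mul_le_mul_of_nonneg_left hc (by positivity : 0 ≤ x * γ ^ (ρ / 2))
      have h3 := mul_le_mul_of_nonneg_right hx1 hγ2.le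
      linarith
    · apply suff
      have h2 : (x ^ (1 + ρ) * γ ^ (ρ / 2)) ^ (ρ / 2) ≤ 1 := Real.rpow_le_one (by positivity) hc (by linarith)
      rw [Real.mul_rpow (by positivity) hγ2.le, ← Real.rpow_mul hx, ← Real.rpow_mul g0.le] at h2
      have h3 : x ^ (ρ * (2 + ρ) / 4) ≤ x ^ ((1 + ρ) * (ρ / 2)) :=
        Real.rpow_le_rpow_of_exponent_le hx1 (by nlinarith)
      have h4 : x ^ (ρ * (2 + ρ) / 4) * γ ^ (ρ / 2 * (ρ / 2)) ≤ 1 :=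
        (mul_le_mul_of_nonneg_right h3 (Real.rpow_nonneg g0.le _)).trans h2
      have h5 : γ ^ (ρ / 2) = γ ^ (ρ / 2 * (ρ / 2)) * γ ^ (ρ * (2 - ρ) / 4) := by
        rw [← Real.rpow_add g0]; congr 1; ring
      have h6 := mul_le_mul_of_nonneg_right h4 hγq.le
      have h7 : x ^ (ρ * (2 + ρ) / 4) * γ ^ (ρ / 2) ≤ γ ^ (ρ * (2 - ρ) / 4) := by
        rw [h5]; linarith
      linarith

lemma theta {p Q L c R : ℝ} (hQ : 0 < Q) (hc : 0 < c) (hR : 0 < R) (hL : L ≤ c * R)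
    (h1 : Real.exp (-L) * Q ≤ p) (h2 : p ≤ Real.exp L * Q) :
    ∃ θ : ℝ, |θ| ≤ 1 ∧ p / Q = Real.exp (θ * c * R) := by
  have hp : 0 < p := lt_of_lt_of_le (by positivity) h1
  have hpq : 0 < p / Q := by positivity
  have hcR : 0 < c * R := by positivity
  have a1 : -L ≤ Real.log (p / Q) := by
    rw [Real.le_log_iff_exp_le hpq, le_div_iff₀ hQ]; exact h1
  have a2 : Real.log (p / Q) ≤ L := by
    rw [Real.log_le_iff_le_exp hpq, div_le_iff₀ hQ]; exact h2
  refine ⟨Real.log (p / Q) / (c * R), ?_, ?_⟩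
  · rw [abs_div, abs_of_pos hcR, div_le_one hcR, abs_le]
    constructor <;> linarith
  · rw [mul_assoc, div_mul_cancel₀ _ hcR.ne', Real.exp_log hpq]

lemma both {ρ : ℝ} (hρ : 0 < ρ) (hρ1 : ρ ≤ 1) : ∃ c η0 : ℝ, 0 < c ∧ 0 < η0 ∧
    ∀ {Ω : Type} [mΩ : MeasurableSpace Ω] {P : Measure Ω} [IsProbabilityMeasure P] (A : MDS Ω P) {γ δ x : ℝ},
      A.CondA1 δ → A.CondA4 ρ γ → 0 ≤ x → x * γ ≤ η0 → ∀ R : ℝ,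
      x ^ (2 + ρ) * γ ^ ρ + x ^ 2 * δ ^ 2 + (1 + x) * (δ + γ ^ (ρ * (2 - ρ) / 4) / (1 + x ^ (ρ * (2 + ρ) / 4))) ≤ R →
      (∃ θ : ℝ, |θ| ≤ 1 ∧ (P {ω | x ≤ A.W ω}).toReal / (1 - stdNormalCDF x) = Real.exp (θ * c * R)) ∧
      (∃ θ : ℝ, |θ| ≤ 1 ∧ (P {ω | A.W ω ≤ -x}).toReal / stdNormalCDF (-x) = Real.exp (θ * c * R)) := by
  obtain ⟨K, η0, hK, hη, hlow⟩ := lower_bound hρ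
  have hCe := Ce_ge
  refine ⟨3 * (K + |Kf| + 1), min η0 (1 / (2 * Ce)), by positivity, lt_min hη (by positivity), ?_⟩
  intro Ω mΩ P _ A γ δ x h1 h4 hx hxγ R hR
  have g := toGood A hρ hρ1 h1 h4
  obtain ⟨R1, R2, R3⟩ := g.R0_pos hx
  have hcp := cdf_compl_pos x
  have hRR : R0 ρ γ δ x ≤ 3 * R := by
    have hred := red hρ hρ1 g.γ0 (by linarith [g.γ1]) hx
    unfold R0
    have t1 : 0 ≤ x ^ (2 + ρ) * γ ^ ρ := mul_nonneg (Real.rpow_nonneg hx _) g.gr_pos.le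
    have t2 : 0 ≤ x ^ 2 * δ ^ 2 := by positivity
    have t3 : 0 ≤ (1 + x) * δ := mul_nonneg (by linarith) g.δ0
    have t4 : 0 ≤ (1 + x) * (γ ^ (ρ * (2 - ρ) / 4) / (1 + x ^ (ρ * (2 + ρ) / 4))) := by
      have := Real.rpow_nonneg g.γ0.le (ρ * (2 - ρ) / 4)
      have := Real.rpow_nonneg hx (ρ * (2 + ρ) / 4)
      positivity
    linarith
  have hRp : 0 < R := by linarith
  have hKc : 0 ≤ K + |Kf| + 1 := by positivity
  have hL : (K + |Kf| + 1) * R0 ρ γ δ x ≤ 3 * (K + |Kf| + 1) * R := by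
    have := mul_le_mul_of_nonneg_left hRR hKc
    linarith
  have main : ∀ {X : ℕ → Ω → ℝ}, Good P A.F A.n X (nv A γ) ρ γ δ →
      ∃ θ : ℝ, |θ| ≤ 1 ∧ (P {ω | x ≤ WW X A.n ω}).toReal / (1 - stdNormalCDF x) = Real.exp (θ * (3 * (K + |Kf| + 1)) * R) := by
    intro X g'
    have a1 := hlow g' hx (hxγ.trans (min_le_left _ _))
    have a2 := upper_bound g' hx (hxγ.trans (min_le_right _ _))
    rw [pW_eq g'.WW_meas] at a1 a2
    apply theta hcp (by positivity) hRp hL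
    · refine le_trans (mul_le_mul_of_nonneg_right (Real.exp_le_exp.2 ?_) hcp.le) a1
      have := mul_nonneg (by positivity : 0 ≤ |Kf| + 1) R2.le
      linarith
    · refine a2.trans (mul_le_mul_of_nonneg_right (Real.exp_le_exp.2 ?_) hcp.le)
      have := mul_nonneg (by linarith [le_abs_self Kf] : 0 ≤ K + |Kf| + 1 - Kf) R2.le
      linarith
  constructor
  · have := main g
    simp only [WW_nX] at this
    exact this
  · have := main g.neg
    have e : {ω | x ≤ WW (fun i ω => - nX A i ω) A.n ω} = {ω | A.W ω ≤ -x} := by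
      ext ω
      simp only [Set.mem_setOf_eq, WW_neg, WW_nX]
      exact le_neg
    rw [e] at this
    rw [cdf_neg]
    exact this

end Cr

theorem cramer_expansion_A1A4 :
    (∀ ρ : ℝ, 0 < ρ → ρ < 1 →
      ∃ c : ℝ, 0 < c ∧
        ∀ (Ω : Type) [MeasurableSpace Ω] (P : Measure Ω), IsProbabilityMeasure P →
          ∀ (A : ℕ → MDS Ω P) (δ γ x : ℕ → ℝ),
            (∀ n, (A n).CondA1 (δ n)) →
            (∀ n, (A n).CondA4 ρ (γ n)) →
            (∀ n, 0 ≤ x n) →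
            Tendsto (fun n => x n * γ n) atTop (nhds 0) →
            ∀ᶠ n in atTop,
              (∃ θ : ℝ, |θ| ≤ 1 ∧
                  (P {ω | x n ≤ (A n).W ω}).toReal / (1 - stdNormalCDF (x n)) =
                    Real.exp (θ * c * (x n ^ (2 + ρ) * γ n ^ ρ + x n ^ 2 * δ n ^ 2 + (1 + x n) * (δ n + γ n ^ (ρ * (2 - ρ) / 4) / (1 + x n ^ (ρ * (2 + ρ) / 4)))))) ∧
              (∃ θ : ℝ, |θ| ≤ 1 ∧
                  (P {ω | (A n).W ω ≤ -x n}).toReal / stdNormalCDF (-x n) =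
                    Real.exp (θ * c * (x n ^ (2 + ρ) * γ n ^ ρ + x n ^ 2 * δ n ^ 2 + (1 + x n) * (δ n + γ n ^ (ρ * (2 - ρ) / 4) / (1 + x n ^ (ρ * (2 + ρ) / 4))))))) ∧
    (∃ c : ℝ, 0 < c ∧
        ∀ (Ω : Type) [MeasurableSpace Ω] (P : Measure Ω), IsProbabilityMeasure P →
          ∀ (A : ℕ → MDS Ω P) (δ γ x : ℕ → ℝ),
            (∀ n, (A n).CondA1 (δ n)) →
            (∀ n, (A n).CondA4 1 (γ n)) →
            (∀ n, 0 ≤ x n) →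
            Tendsto (fun n => x n * γ n) atTop (nhds 0) →
            ∀ᶠ n in atTop,
              (∃ θ : ℝ, |θ| ≤ 1 ∧
                  (P {ω | x n ≤ (A n).W ω}).toReal / (1 - stdNormalCDF (x n)) =
                    Real.exp (θ * c * (x n ^ 3 * γ n + x n ^ 2 * δ n ^ 2 + (1 + x n) * (δ n + γ n * |Real.log (γ n)| + γ n ^ ((1 : ℝ) / 4) / (1 + x n ^ ((3 : ℝ) / 4)))))) ∧
              (∃ θ : ℝ, |θ| ≤ 1 ∧
                  (P {ω | (A n).W ω ≤ -x n}).toReal / stdNormalCDF (-x n) =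
                    Real.exp (θ * c * (x n ^ 3 * γ n + x n ^ 2 * δ n ^ 2 + (1 + x n) * (δ n + γ n * |Real.log (γ n)| + γ n ^ ((1 : ℝ) / 4) / (1 + x n ^ ((3 : ℝ) / 4))))))) := by
  constructor
  · intro ρ h0 h1
    obtain ⟨c, η0, hc, hη, H⟩ := Cr.both h0 h1.le
    refine ⟨c, hc, ?_⟩
    intro Ω _ P hP A δ γ x hA1 hA4 hx hlim
    filter_upwards [hlim.eventually (gt_mem_nhds hη)] with n hn
    exact H (A n) (hA1 n) (hA4 n) (hx n) (le_of_lt hn) _ le_rfl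
  · obtain ⟨c, η0, hc, hη, H⟩ := Cr.both one_pos le_rfl
    refine ⟨c, hc, ?_⟩
    intro Ω _ P hP A δ γ x hA1 hA4 hx hlim
    filter_upwards [hlim.eventually (gt_mem_nhds hη)] with n hn
    refine H (A n) (hA1 n) (hA4 n) (hx n) (le_of_lt hn) _ ?_
    have hg := (hA4 n).1
    have e1 : x n ^ ((2:ℝ) + 1) = x n ^ 3 := by
      rw [show (2:ℝ) + 1 = ((3:ℕ):ℝ) by norm_num, Real.rpow_natCast]
    rw [e1, Real.rpow_one, show (1:ℝ) * (2 - 1) / 4 = 1 / 4 by norm_num, show (1:ℝ) * (2 + 1) / 4 = 3 / 4 by norm_num]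
    have h5 : 0 ≤ (1 + x n) * (γ n * |Real.log (γ n)|) :=
      mul_nonneg (by linarith [hx n]) (mul_nonneg hg.le (abs_nonneg _))
    linarith
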